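/- There exist absolute constants c, C > 0 and n_0 such that for all n ≥ n_0 and all γ ∈ [−1,1] with γ√n ∈ ℤ: c · 4^{−n} · C(2n,n) · exp(2n · sup_{α∈ℝ} F_1(α)) ≤ E[X_γ] ≤ C · 4^{−n} · C(2n,n) · exp(2n · sup_{α∈ℝ} F_1(α)), where F_1 is defined with parameter γ and the expectation is over G ∼ G(2n,1/2). -/

import Mathlib

open MeasureTheory ProbabilityTheory

/-- `P[Z ≥ t]` for a standard Gaussian `Z`. -/
noncomputable def gaussTail (t : ℝ) : ℝ :=
  ((gaussianReal 0 1) {x | t ≤ x}).toReal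

/-- The law of a pair of independent standard Gaussians. -/
noncomputable def gauss2 : Measure (ℝ × ℝ) :=
  (gaussianReal 0 1).prod (gaussianReal 0 1)

/-- `F₁(α) = log 2 − α² + log P[Z ≥ (γ+α)√2]`. -/
noncomputable def F1 (γ α : ℝ) : ℝ :=
  Real.log 2 - α ^ 2 + Real.log (gaussTail ((γ + α) * Real.sqrt 2))

/-- `f(β,α) = P[√(β/2)Z₁ + √((1−β)/2)Z₂ ≥ γ+α ∧ √(β/2)Z₁ − √((1−β)/2)Z₂ ≥ γ+α]`. -/
noncomputable def fB (γ β α : ℝ) : ℝ :=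
  (gauss2 {p : ℝ × ℝ |
      γ + α ≤ Real.sqrt (β / 2) * p.1 + Real.sqrt ((1 - β) / 2) * p.2 ∧
      γ + α ≤ Real.sqrt (β / 2) * p.1 - Real.sqrt ((1 - β) / 2) * p.2}).toReal

/-- The two-partition exponent function `F₂`. -/
noncomputable def F2 (γ β α₁ α₂ : ℝ) : ℝ :=
  2 * Real.log 2 - 2 * β * Real.log β - 2 * (1 - β) * Real.log (1 - β)
    - 2 * α₁ ^ 2 - 2 * α₂ ^ 2
    + 2 * β * Real.log (fB γ β α₁) + 2 * (1 - β) * Real.log (fB γ (1 - β) α₂)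

/-- `γ` is the critical constant: `γ > 0` and
`log 2 + sup_α (−α² + log P[Z ≥ (γ+α)√2]) = 0`. -/
def IsGammaCrit (γ : ℝ) : Prop :=
  0 < γ ∧
    Real.log 2 +
      (⨆ α : ℝ, (-α ^ 2 + Real.log (gaussTail ((γ + α) * Real.sqrt 2)))) = 0

/-- The probability, under the uniform measure on labeled graphs on `Fin n`
(equivalently under `G(n,1/2)`), of a graph property `P`. -/
noncomputable def graphProb (n : ℕ) (P : SimpleGraph (Fin n) → Prop) : ℝ :=
  (Nat.card {G : SimpleGraph (Fin n) // P G} : ℝ) / 2 ^ n.choose 2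

/-- `deg(v,S)`: the number of neighbors of `v` inside the vertex set `S`. -/
noncomputable def degIn {n : ℕ} (G : SimpleGraph (Fin n)) (v : Fin n)
    (S : Finset (Fin n)) : ℕ :=
  Nat.card {w : Fin n // w ∈ S ∧ G.Adj v w}

/-- `X_γ`: the number of bisections `[2n] = A ∪ Aᶜ` with `|A| = n` such that every vertex
has at least `γ√n` more neighbours in its own part than in the other part. -/
noncomputable def Xgamma (n : ℕ) (γ : ℝ) (G : SimpleGraph (Fin (2 * n))) : ℕ :=
  Nat.card {A : Finset (Fin (2 * n)) //
    A.card = n ∧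
    (∀ v ∈ A, (degIn G v Aᶜ : ℝ) + γ * Real.sqrt n ≤ (degIn G v A : ℝ)) ∧
    (∀ v ∈ (Aᶜ : Finset (Fin (2 * n))),
      (degIn G v A : ℝ) + γ * Real.sqrt n ≤ (degIn G v Aᶜ : ℝ))}

/-- `E[X_γ]` over `G ∼ G(2n, 1/2)`. -/
noncomputable def EXgamma (n : ℕ) (γ : ℝ) : ℝ :=
  (∑ G : SimpleGraph (Fin (2 * n)), (Xgamma n γ G : ℝ)) / 2 ^ (2 * n).choose 2

/-- `E[X_γ²]` over `G ∼ G(2n, 1/2)`. -/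
noncomputable def EXgammaSq (n : ℕ) (γ : ℝ) : ℝ :=
  (∑ G : SimpleGraph (Fin (2 * n)), (Xgamma n γ G : ℝ) ^ 2) / 2 ^ (2 * n).choose 2

/-- The edges of the complete graph on `Fin N`, as increasing pairs. -/
abbrev Edge (N : ℕ) := {p : Fin N × Fin N // p.1 < p.2}

/-- A sum over edges of a symmetric function is half of the off-diagonal double sum. -/
theorem sum_edge_symm {N : ℕ} (g : Fin N → Fin N → ℝ) (hg : ∀ j k, g j k = g k j) :
    ∑ e : Edge N, g e.1.1 e.1.2 = (∑ j, ∑ k, g j k - ∑ j, g j j) / 2 := by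
  have h1 : ∑ e : Edge N, g e.1.1 e.1.2
      = ∑ p : Fin N × Fin N, if p.1 < p.2 then g p.1 p.2 else 0 := by
    rw [← Finset.sum_filter]
    exact (Finset.sum_subtype (Finset.univ.filter fun p : Fin N × Fin N => p.1 < p.2)
      (by simp) (fun p => g p.1 p.2)).symm
  have h2 : ∑ p : Fin N × Fin N, (if p.1 < p.2 then g p.1 p.2 else 0)
      = ∑ j, ∑ k, if j < k then g j k else 0 := Fintype.sum_prod_type _
  have h3 : ∑ j, ∑ k, (if j < k then g j k else 0) = ∑ j, ∑ k, if k < j then g j k else 0 := by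
    rw [Finset.sum_comm]
    exact Finset.sum_congr rfl fun j _ => Finset.sum_congr rfl fun k _ => by rw [hg]
  have h4 : ∑ j, ∑ k, g j k = ∑ j, ∑ k, (if j < k then g j k else 0)
      + ∑ j, ∑ k, (if k < j then g j k else 0) + ∑ j, g j j := by
    rw [← Finset.sum_add_distrib, ← Finset.sum_add_distrib]
    refine Finset.sum_congr rfl fun j _ => ?_
    have : g j j = ∑ k, if k = j then g j k else 0 := by simp
    rw [this, ← Finset.sum_add_distrib, ← Finset.sum_add_distrib]
    refine Finset.sum_congr rfl fun k _ => ?_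
    rcases lt_trichotomy j k with h | h | h
    · simp [h, h.not_gt, h.ne']
    · simp [h]
    · simp [h, h.not_gt, h.ne]
  rw [h1, h2, h4, ← h3]; ring

/-- A nonnegative symmetric function sums over edges to at most half of the full double sum. -/
theorem sum_edge_le {N : ℕ} (g : Fin N → Fin N → ℝ) (hg : ∀ j k, g j k = g k j)
    (h0 : ∀ j, 0 ≤ g j j) :
    ∑ e : Edge N, g e.1.1 e.1.2 ≤ (∑ j, ∑ k, g j k) / 2 := by
  rw [sum_edge_symm g hg]
  have := Finset.sum_nonneg fun j (_ : j ∈ Finset.univ) => h0 j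
  linarith

theorem card_edge (N : ℕ) : Fintype.card (Edge N) = N.choose 2 := by
  have h := sum_edge_symm (N := N) (fun _ _ => 1) (fun _ _ => rfl)
  have h2 := Nat.cast_choose_two ℝ N
  have : (Fintype.card (Edge N) : ℝ) = N.choose 2 := by
    rw [h2]
    simp only [Finset.sum_const, Finset.card_univ, nsmul_eq_mul, mul_one, Fintype.card_fin] at h
    rw [h]; ring
  exact_mod_cast this

/-- The sum of squares of `β j + β k` over the edges. -/
theorem sum_edge_add_sq {N : ℕ} (b : Fin N → ℝ) :
    ∑ e : Edge N, (b e.1.1 + b e.1.2) ^ 2 = ((N : ℝ) - 2) * ∑ j, b j ^ 2 + (∑ j, b j) ^ 2 := by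
  rw [sum_edge_symm (fun j k => (b j + b k) ^ 2) (fun j k => by ring)]
  have h1 : ∀ j k, (b j + b k) ^ 2 = b j ^ 2 + 2 * (b j * b k) + b k ^ 2 := fun j k => by ring
  simp only [h1, Finset.sum_add_distrib, ← Finset.mul_sum, ← Finset.sum_mul, Finset.sum_const,
    Finset.card_univ, Fintype.card_fin, nsmul_eq_mul]
  have h2 : ∀ j, b j * b j = b j ^ 2 := fun j => by ring
  simp only [h2]
  ring

/-- Sums over edges of `u j + u k` for nonnegative `u`. -/
theorem sum_edge_add_le {N : ℕ} (u : Fin N → ℝ) (hu : ∀ j, 0 ≤ u j) :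
    ∑ e : Edge N, (u e.1.1 + u e.1.2) ≤ N * ∑ j, u j := by
  refine (sum_edge_le (fun j k => u j + u k) (fun j k => by ring)
    (fun j => by have := hu j; positivity)).trans (le_of_eq ?_)
  simp only [Finset.sum_add_distrib, ← Finset.mul_sum, Finset.sum_const,
    Finset.card_univ, Fintype.card_fin, nsmul_eq_mul]
  ring

/-- The incidence number of the vertex `v` and the edge `e`. -/
def inc {N : ℕ} (e : Edge N) (v : Fin N) : ℤ :=
  (if e.1.1 = v then 1 else 0) + (if e.1.2 = v then 1 else 0)

/-- The sign attached to a bit. -/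
def sgn (b : Bool) : ℤ := if b then 1 else -1

/-- The sum of the signs of the edges at `v`. -/
def signSum {N : ℕ} (x : Edge N → Bool) (v : Fin N) : ℤ := ∑ e, sgn (x e) * inc e v

theorem sum_mul_inc {N : ℕ} {R : Type*} [CommRing R] (e : Edge N) (u : Fin N → R) :
    ∑ v, u v * (inc e v : R) = u e.1.1 + u e.1.2 := by
  simp [inc, mul_add, Finset.sum_add_distrib]

theorem sum_mul_signSum {N : ℕ} {R : Type*} [CommRing R] (x : Edge N → Bool) (u : Fin N → R) :
    ∑ v, u v * (signSum x v : R) = ∑ e : Edge N, (sgn (x e) : R) * (u e.1.1 + u e.1.2) := by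
  simp only [signSum, Int.cast_sum, Finset.mul_sum, Int.cast_mul]
  rw [Finset.sum_comm]
  refine Finset.sum_congr rfl fun e _ => ?_
  rw [← sum_mul_inc, Finset.mul_sum]
  exact Finset.sum_congr rfl fun v _ => by ring

theorem sum_inc {N : ℕ} (v : Fin N) : ∑ e : Edge N, inc e v = (N : ℤ) - 1 := by
  have h := sum_edge_symm (N := N)
    (fun j k => (if j = v then 1 else 0) + (if k = v then 1 else 0)) (fun j k => by ring)
  have h2 : ((∑ e : Edge N, inc e v : ℤ) : ℝ) = ((N : ℤ) - 1 : ℤ) := by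
    push_cast [inc]
    rw [h]
    simp only [Finset.sum_add_distrib, Finset.sum_const, Finset.card_univ, Fintype.card_fin,
      Finset.sum_ite_eq', Finset.mem_univ, if_true, nsmul_eq_mul, mul_ite, mul_one, mul_zero]
    ring
  exact_mod_cast h2

theorem sgn_emod_two (b : Bool) : ∃ m : ℤ, sgn b = 1 + 2 * m := by
  cases b
  · exact ⟨-1, by decide⟩
  · exact ⟨0, by decide⟩

theorem signSum_parity {N : ℕ} (x : Edge N → Bool) (v : Fin N) :
    ∃ m : ℤ, signSum x v = (N : ℤ) - 1 + 2 * m := by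
  choose m hm using fun b => sgn_emod_two b
  refine ⟨∑ e, m (x e) * inc e v, ?_⟩
  rw [← sum_inc v, Finset.mul_sum, ← Finset.sum_add_distrib]
  exact Finset.sum_congr rfl fun e _ => by rw [hm]; ring

theorem sum_signSum_mod {N : ℕ} (x : Edge N → Bool) :
    ∃ m : ℤ, ∑ v, signSum x v = 2 * (N.choose 2 : ℤ) + 4 * m := by
  choose m hm using fun b => sgn_emod_two b
  refine ⟨∑ e, m (x e), ?_⟩
  have h := sum_mul_signSum x (fun _ => (1 : ℤ))
  simp only [one_mul, Int.cast_id] at h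
  rw [h, ← card_edge, Finset.mul_sum]
  have : 2 * (Fintype.card (Edge N) : ℤ) = ∑ e : Edge N, 2 := by simp [mul_comm]
  rw [this, ← Finset.sum_add_distrib]
  exact Finset.sum_congr rfl fun e _ => by rw [hm]; ring

theorem abs_signSum_le {N : ℕ} (x : Edge N → Bool) (v : Fin N) :
    |signSum x v| ≤ (N : ℤ) - 1 := by
  rw [← sum_inc v]
  refine (Finset.abs_sum_le_sum_abs _ _).trans (Finset.sum_le_sum fun e _ => ?_)
  have h1 : |sgn (x e)| = 1 := by cases x e <;> simp [sgn]
  have h2 : 0 ≤ inc e v := by unfold inc; split_ifs <;> norm_num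
  rw [abs_mul, h1, one_mul, abs_of_nonneg h2]

/-- Half side lengths of the Fourier box. The coordinate `0` gets a shorter side because the
total sum of the signed degrees is determined modulo `4`. -/
noncomputable def boxLen {N : ℕ} (j : Fin N) : ℝ := if j.val = 0 then Real.pi / 4 else Real.pi / 2

/-- Lebesgue measure on the Fourier box. -/
noncomputable def boxMeasure (N : ℕ) : Measure (Fin N → ℝ) :=
  Measure.pi fun j => volume.restrict (Set.Ioc (-boxLen j) (boxLen j))

/-- The normalised characteristic function of the signed degrees under the tilt `b`. -/
noncomputable def charFn {N : ℕ} (b : Fin N → ℝ) (s : Fin N → ℤ) (θ : Fin N → ℝ) : ℂ :=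
  (∏ e : Edge N, Complex.cosh (((b e.1.1 + b e.1.2 : ℝ) : ℂ) + (θ e.1.1 + θ e.1.2 : ℝ) * Complex.I)
    / Complex.cosh ((b e.1.1 + b e.1.2 : ℝ) : ℂ))
  * Complex.exp (-(∑ j, (s j : ℝ) * θ j : ℝ) * Complex.I)

/-- The number of sign patterns with signed degrees `s`. -/
def signCount {N : ℕ} (s : Fin N → ℤ) : ℕ :=
  (Finset.univ.filter fun x : Edge N → Bool => signSum x = s).card

theorem boxLen_pos {N : ℕ} (j : Fin N) : 0 < boxLen j := by
  unfold boxLen; split_ifs <;> positivity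

instance {N : ℕ} : IsFiniteMeasure (boxMeasure N) := by
  unfold boxMeasure; infer_instance

theorem integral_exp_int_mul {ℓ : ℝ} (hℓ : 0 < ℓ) (k : ℤ) (hk : ∃ m : ℤ, (k : ℝ) * ℓ = m * Real.pi) :
    ∫ θ in Set.Ioc (-ℓ) ℓ, Complex.exp ((k : ℂ) * θ * Complex.I) = if k = 0 then 2 * (ℓ : ℂ) else 0 := by
  rw [← intervalIntegral.integral_of_le (by linarith)]
  split_ifs with h
  · simp [h]; ring
  · obtain ⟨m, hm⟩ := hk
    have hc : (k : ℂ) * Complex.I ≠ 0 := by simp [h]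
    have h2 : ∀ θ : ℝ, (k : ℂ) * θ * Complex.I = (k * Complex.I) * θ := fun θ => by ring
    simp only [h2]
    rw [integral_exp_mul_complex hc]
    have hm' : (k : ℂ) * ℓ = m * Real.pi := by exact_mod_cast hm
    have e1 : (k : ℂ) * Complex.I * (ℓ : ℝ) = ((-ℓ : ℝ) : ℂ) * (k * Complex.I)
        + m * (2 * Real.pi * Complex.I) := by
      push_cast
      linear_combination (2 * Complex.I) * hm'
    rw [e1, Complex.exp_add, Complex.exp_int_mul_two_pi_mul_I, mul_one,
      mul_comm ((-ℓ : ℝ) : ℂ), sub_self, zero_div]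

theorem exists_mul_boxLen {N : ℕ} (j : Fin N) (k : ℤ) (h : ∃ m : ℤ, k = 4 * m) :
    ∃ m : ℤ, (k : ℝ) * boxLen j = m * Real.pi := by
  obtain ⟨m, rfl⟩ := h
  unfold boxLen
  split_ifs
  · exact ⟨m, by push_cast; ring⟩
  · exact ⟨2 * m, by push_cast; ring⟩

theorem integral_prod_exp {N : ℕ} (hN : 0 < N) (k : Fin N → ℤ)
    (h1 : ∀ j, ∃ m : ℤ, k j = 2 * m) (h2 : ∃ m : ℤ, ∑ j, k j = 4 * m) :
    ∫ θ, ∏ j, Complex.exp ((k j : ℂ) * (θ j : ℝ) * Complex.I) ∂(boxMeasure N)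
      = if k = 0 then ∏ j : Fin N, 2 * (boxLen j : ℂ) else 0 := by
  unfold boxMeasure
  rw [integral_fintype_prod_eq_prod (fun j (θ : ℝ) => Complex.exp ((k j : ℂ) * θ * Complex.I))]
  have hne : ∀ j : Fin N, j.val ≠ 0 → k j ≠ 0 →
      ∫ θ in Set.Ioc (-boxLen j) (boxLen j), Complex.exp ((k j : ℂ) * θ * Complex.I) = 0 := by
    intro j hj hk
    rw [integral_exp_int_mul (boxLen_pos j), if_neg hk]
    obtain ⟨m, hm⟩ := h1 j
    refine ⟨m, ?_⟩
    rw [hm, boxLen, if_neg hj]; push_cast; ring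
  split_ifs with h
  · refine Finset.prod_congr rfl fun j _ => ?_
    rw [integral_exp_int_mul (boxLen_pos j) _ ⟨0, by simp [h]⟩, if_pos (by simp [h])]
  · by_cases h3 : ∃ j : Fin N, j.val ≠ 0 ∧ k j ≠ 0
    · obtain ⟨j, hj, hk⟩ := h3
      exact Finset.prod_eq_zero (Finset.mem_univ j) (hne j hj hk)
    · push Not at h3
      set z : Fin N := ⟨0, hN⟩
      have hz : ∀ j, j ≠ z → k j = 0 := fun j hj => h3 j fun h => hj (Fin.ext h)
      have hsum : ∑ j, k j = k z := Finset.sum_eq_single z (fun j _ hj => hz j hj) (by simp)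
      have hkz : k z ≠ 0 := fun h0 => h <| funext fun j => by
        by_cases hj : j = z
        · rw [hj, h0]; rfl
        · exact hz j hj
      refine Finset.prod_eq_zero (Finset.mem_univ z) ?_
      rw [integral_exp_int_mul (boxLen_pos z) _ (exists_mul_boxLen z _ (hsum ▸ h2)), if_neg hkz]

theorem continuous_charFn {N : ℕ} (b : Fin N → ℝ) (s : Fin N → ℤ) : Continuous (charFn b s) := by
  unfold charFn
  fun_prop

theorem prod_cosh_eq {N : ℕ} (c : Fin N → ℂ) :
    ∏ e : Edge N, Complex.cosh (c e.1.1 + c e.1.2)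
      = (∑ x : Edge N → Bool, Complex.exp (∑ j, (signSum x j : ℂ) * c j)) / 2 ^ (N.choose 2) := by
  have h1 : ∀ e : Edge N, Complex.cosh (c e.1.1 + c e.1.2)
      = (∑ y : Bool, Complex.exp ((sgn y : ℂ) * (c e.1.1 + c e.1.2))) / 2 := fun e => by
    simp [sgn, Complex.cosh]
  simp only [h1]
  rw [Finset.prod_div_distrib, Finset.prod_const, Finset.card_univ, card_edge, Fintype.prod_sum]
  congr 1
  refine Finset.sum_congr rfl fun x _ => ?_
  rw [← Complex.exp_sum, ← sum_mul_signSum]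
  congr 1
  exact Finset.sum_congr rfl fun v _ => mul_comm _ _

/-- Fourier inversion for the number of sign patterns with given signed degrees. -/
theorem signCount_fourier {N : ℕ} (hN : 0 < N) (b : Fin N → ℝ) (s : Fin N → ℤ)
    (h1 : ∀ j, ∃ m : ℤ, s j = (N : ℤ) - 1 + 2 * m)
    (h2 : ∃ m : ℤ, ∑ j, s j = 2 * (N.choose 2 : ℤ) + 4 * m) :
    (signCount s : ℂ) / 2 ^ (N.choose 2) * ∏ j : Fin N, 2 * (boxLen j : ℂ)
      = Complex.exp (-(∑ j, (s j : ℝ) * b j : ℝ))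
        * (∏ e : Edge N, Complex.cosh ((b e.1.1 + b e.1.2 : ℝ) : ℂ))
        * ∫ θ, charFn b s θ ∂(boxMeasure N) := by
  have hc : ∀ e : Edge N, Complex.cosh ((b e.1.1 + b e.1.2 : ℝ) : ℂ) ≠ 0 := fun e => by
    rw [← Complex.ofReal_cosh]
    exact_mod_cast (Real.cosh_pos _).ne'
  have key : ∀ θ : Fin N → ℝ, Complex.exp (-(∑ j, (s j : ℝ) * b j : ℝ))
      * (∏ e : Edge N, Complex.cosh ((b e.1.1 + b e.1.2 : ℝ) : ℂ)) * charFn b s θ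
      = (∑ x : Edge N → Bool, Complex.exp (∑ j, ((signSum x j - s j : ℤ) : ℂ) * b j) *
          ∏ j, Complex.exp (((signSum x j - s j : ℤ) : ℂ) * (θ j : ℝ) * Complex.I))
          / 2 ^ (N.choose 2) := by
    intro θ
    have h3 : (∏ e : Edge N, Complex.cosh ((b e.1.1 + b e.1.2 : ℝ) : ℂ)) * (∏ e : Edge N,
        Complex.cosh (((b e.1.1 + b e.1.2 : ℝ) : ℂ) + (θ e.1.1 + θ e.1.2 : ℝ) * Complex.I)
        / Complex.cosh ((b e.1.1 + b e.1.2 : ℝ) : ℂ))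
        = (∑ x : Edge N → Bool, Complex.exp (∑ j, (signSum x j : ℂ) * (b j + θ j * Complex.I)))
          / 2 ^ (N.choose 2) := by
      rw [← prod_cosh_eq, ← Finset.prod_mul_distrib]
      refine Finset.prod_congr rfl fun e _ => ?_
      rw [mul_div_cancel₀ _ (hc e)]
      push_cast
      congr 1; ring
    unfold charFn
    rw [mul_assoc, ← mul_assoc (∏ e : Edge N, _), h3, div_mul_eq_mul_div, mul_div_assoc', Finset.sum_mul,
      Finset.mul_sum]
    congr 1
    refine Finset.sum_congr rfl fun x _ => ?_
    rw [← Complex.exp_sum, ← Complex.exp_add, ← Complex.exp_add, ← Complex.exp_add]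
    congr 1
    push_cast
    simp only [mul_add, sub_mul, Finset.sum_add_distrib, Finset.sum_sub_distrib, Finset.sum_mul,
      neg_mul, mul_assoc]
    ring
  rw [← integral_const_mul]
  simp only [key]
  rw [integral_div, integral_finsetSum]
  · simp only [integral_const_mul]
    have h4 : ∀ x : Edge N → Bool, ∫ θ, ∏ j, Complex.exp (((signSum x j - s j : ℤ) : ℂ)
        * (θ j : ℝ) * Complex.I) ∂(boxMeasure N)
        = if signSum x = s then ∏ j : Fin N, 2 * (boxLen j : ℂ) else 0 := by
      intro x
      rw [integral_prod_exp hN (fun j => signSum x j - s j)]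
      · have : (fun j => signSum x j - s j) = 0 ↔ signSum x = s := by
          constructor
          · intro h; ext j; have := congrFun h j; simp only [Pi.zero_apply] at this; omega
          · rintro rfl; ext j; simp
        simp only [this]
      · intro j
        obtain ⟨m, hm⟩ := h1 j
        obtain ⟨m', hm'⟩ := signSum_parity x j
        exact ⟨m' - m, by rw [hm, hm']; ring⟩
      · obtain ⟨m, hm⟩ := h2
        obtain ⟨m', hm'⟩ := sum_signSum_mod x
        exact ⟨m' - m, by rw [Finset.sum_sub_distrib, hm, hm']; ring⟩
    simp only [h4]
    have h5 : ∀ x : Edge N → Bool, Complex.exp (∑ j, ((signSum x j - s j : ℤ) : ℂ) * b j) *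
        (if signSum x = s then ∏ j : Fin N, 2 * (boxLen j : ℂ) else 0)
        = if signSum x = s then ∏ j : Fin N, 2 * (boxLen j : ℂ) else 0 := by
      intro x
      split_ifs with h
      · simp [h]
      · simp
    simp only [h5]
    rw [← Finset.sum_filter, Finset.sum_const, nsmul_eq_mul, signCount]
    ring
  · intro x _
    refine Integrable.const_mul ?_ _
    refine Integrable.of_bound (Continuous.aestronglyMeasurable (by fun_prop)) 1
      (Filter.Eventually.of_forall fun θ => ?_)
    rw [norm_prod]
    refine (Finset.prod_eq_one fun j _ => ?_).le
    have : ((signSum x j - s j : ℤ) : ℂ) * (θ j : ℝ) * Complex.I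
        = (((signSum x j - s j : ℤ) * θ j : ℝ) : ℂ) * Complex.I := by push_cast; ring
    rw [this, Complex.norm_exp_ofReal_mul_I]

theorem normSq_cosh (β x : ℝ) :
    ‖Complex.cosh ((β : ℂ) + x * Complex.I)‖ ^ 2 = Real.cosh β ^ 2 - Real.sin x ^ 2 := by
  rw [← Complex.normSq_eq_norm_sq, Complex.cosh_add, Complex.cosh_mul_I, Complex.sinh_mul_I,
    ← Complex.ofReal_cosh, ← Complex.ofReal_sinh, ← Complex.ofReal_cos, ← Complex.ofReal_sin]
  simp only [Complex.normSq_apply, Complex.add_re, Complex.add_im, Complex.mul_re, Complex.mul_im,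
    Complex.ofReal_re, Complex.ofReal_im, Complex.I_re, Complex.I_im]
  have h1 := Real.cosh_sq β
  have h2 := Real.sin_sq_add_cos_sq x
  ring_nf
  rw [h1]
  have : Real.cos x ^ 2 = 1 - Real.sin x ^ 2 := by linarith
  rw [this]; ring

theorem one_sub_sq_mul_cosh_sq_le (β : ℝ) : (1 - β ^ 2) * Real.cosh β ^ 2 ≤ 1 := by
  have h1 : Real.cosh β ^ 2 ≤ Real.exp (β ^ 2) := by
    have := pow_le_pow_left₀ (Real.cosh_pos β).le (Real.cosh_le_exp_half_sq β) 2
    rwa [← Real.exp_nat_mul, show ((2 : ℕ) : ℝ) * (β ^ 2 / 2) = β ^ 2 by push_cast; ring] at this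
  have h2 : 1 - β ^ 2 ≤ Real.exp (-β ^ 2) := by linarith [Real.add_one_le_exp (-β ^ 2)]
  calc (1 - β ^ 2) * Real.cosh β ^ 2 ≤ Real.exp (-β ^ 2) * Real.cosh β ^ 2 := by gcongr
    _ ≤ Real.exp (-β ^ 2) * Real.exp (β ^ 2) := by gcongr
    _ = 1 := by rw [← Real.exp_add]; simp

theorem norm_cosh_div_le (β x : ℝ) :
    ‖Complex.cosh ((β : ℂ) + x * Complex.I) / Complex.cosh (β : ℂ)‖
      ≤ Real.exp (-((1 - β ^ 2) * Real.sin x ^ 2) / 2) := by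
  refine le_of_sq_le_sq ?_ (Real.exp_pos _).le
  have hc := Real.cosh_pos β
  rw [norm_div, div_pow, normSq_cosh, ← Complex.ofReal_cosh, Complex.norm_real, Real.norm_eq_abs,
    sq_abs, ← Real.exp_nat_mul, div_le_iff₀ (by positivity)]
  have h1 := Real.add_one_le_exp (((2 : ℕ) : ℝ) * (-((1 - β ^ 2) * Real.sin x ^ 2) / 2))
  have h2 := one_sub_sq_mul_cosh_sq_le β
  push_cast at h1 ⊢
  have h3 : 0 ≤ Real.sin x ^ 2 := sq_nonneg _
  have h4 : 0 < Real.cosh β ^ 2 := by positivity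
  nlinarith [mul_le_mul_of_nonneg_right h1 h4.le, mul_le_mul_of_nonneg_right h2 h3]

theorem abs_cos_le_norm_cosh_div (β x : ℝ) :
    |Real.cos x| ≤ ‖Complex.cosh ((β : ℂ) + x * Complex.I) / Complex.cosh (β : ℂ)‖ := by
  refine le_of_sq_le_sq ?_ (norm_nonneg _)
  have hc := Real.one_le_cosh β
  have hc' := Real.cosh_pos β
  rw [norm_div, div_pow, normSq_cosh, ← Complex.ofReal_cosh, Complex.norm_real, Real.norm_eq_abs,
    sq_abs, sq_abs, le_div_iff₀ (by positivity), Real.cos_sq']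
  have h1 : 1 ≤ Real.cosh β ^ 2 := one_le_pow₀ hc
  nlinarith [mul_nonneg (sq_nonneg (Real.sin x)) (sub_nonneg.2 h1)]

theorem norm_charFn {N : ℕ} (b : Fin N → ℝ) (s : Fin N → ℤ) (θ : Fin N → ℝ) :
    ‖charFn b s θ‖ = ∏ e : Edge N, ‖Complex.cosh (((b e.1.1 + b e.1.2 : ℝ) : ℂ)
      + (θ e.1.1 + θ e.1.2 : ℝ) * Complex.I) / Complex.cosh ((b e.1.1 + b e.1.2 : ℝ) : ℂ)‖ := by
  have : (-(∑ j, (s j : ℝ) * θ j : ℝ) : ℂ) * Complex.I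
      = ((-∑ j, (s j : ℝ) * θ j : ℝ) : ℂ) * Complex.I := by push_cast; rfl
  rw [charFn, this, norm_mul, Complex.norm_exp_ofReal_mul_I, mul_one, norm_prod]

theorem norm_charFn_le {N : ℕ} (b : Fin N → ℝ) (s : Fin N → ℤ) (θ : Fin N → ℝ) :
    ‖charFn b s θ‖ ≤ Real.exp (-(∑ e : Edge N, (1 - (b e.1.1 + b e.1.2) ^ 2)
      * Real.sin (θ e.1.1 + θ e.1.2) ^ 2) / 2) := by
  rw [norm_charFn, ← Finset.sum_neg_distrib, Finset.sum_div, Real.exp_sum]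
  exact Finset.prod_le_prod (fun _ _ => norm_nonneg _) fun e _ => norm_cosh_div_le _ _

/-- The weight `q` is either `sin²` or `cos²` of the coordinates; this records what is used. -/
structure IsAngleWeight {N : ℕ} (θ q : Fin N → ℝ) : Prop where
  nonneg : ∀ j, 0 ≤ q j
  le_one : ∀ j, q j ≤ 1
  sin_sq_le : ∀ j k, Real.sin (θ j + θ k) ^ 2 ≤ 2 * (q j + q k)
  le_sum : (∑ j, q j) * (N - ∑ j, q j) - 2 * ∑ j, q j
    ≤ ∑ e : Edge N, Real.sin (θ e.1.1 + θ e.1.2) ^ 2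

theorem sum_edge_sin_sq {N : ℕ} (θ : Fin N → ℝ) :
    ∑ e : Edge N, Real.sin (θ e.1.1 + θ e.1.2) ^ 2
      = (∑ j, Real.sin (θ j) ^ 2) * (∑ j, Real.cos (θ j) ^ 2)
        + (∑ j, Real.sin (θ j) * Real.cos (θ j)) ^ 2
        - 2 * ∑ j, Real.sin (θ j) ^ 2 * Real.cos (θ j) ^ 2 := by
  rw [sum_edge_symm (fun j k => Real.sin (θ j + θ k) ^ 2) (fun j k => by rw [add_comm])]
  have h1 : ∀ j k, Real.sin (θ j + θ k) ^ 2 = Real.sin (θ j) ^ 2 * Real.cos (θ k) ^ 2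
      + Real.cos (θ j) ^ 2 * Real.sin (θ k) ^ 2
      + 2 * ((Real.sin (θ j) * Real.cos (θ j)) * (Real.sin (θ k) * Real.cos (θ k))) := fun j k => by
    rw [Real.sin_add]; ring
  have h2 : ∀ j, Real.sin (θ j + θ j) ^ 2 = 4 * (Real.sin (θ j) ^ 2 * Real.cos (θ j) ^ 2) :=
    fun j => by rw [h1]; ring
  simp only [h2]
  simp only [h1, Finset.sum_add_distrib, ← Finset.mul_sum, ← Finset.sum_mul]
  ring

theorem isAngleWeight_sin {N : ℕ} (θ : Fin N → ℝ) :
    IsAngleWeight θ (fun j => Real.sin (θ j) ^ 2) where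
  nonneg j := sq_nonneg _
  le_one j := Real.sin_sq_le_one _
  sin_sq_le j k := by
    rw [Real.sin_add]
    have h1 := Real.sin_sq_add_cos_sq (θ j)
    have h2 := Real.sin_sq_add_cos_sq (θ k)
    nlinarith [sq_nonneg (Real.sin (θ j) * Real.cos (θ k) - Real.cos (θ j) * Real.sin (θ k)),
      sq_nonneg (Real.sin (θ j) * Real.sin (θ k)), sq_nonneg (Real.cos (θ j) * Real.cos (θ k))]
  le_sum := by
    rw [sum_edge_sin_sq]
    have h1 : ∑ j, Real.cos (θ j) ^ 2 = N - ∑ j, Real.sin (θ j) ^ 2 := by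
      simp [Real.cos_sq', Finset.sum_sub_distrib]
    rw [h1]
    have h2 : ∑ j, Real.sin (θ j) ^ 2 * Real.cos (θ j) ^ 2 ≤ ∑ j, Real.sin (θ j) ^ 2 :=
      Finset.sum_le_sum fun j _ => mul_le_of_le_one_right (sq_nonneg _) (Real.cos_sq_le_one _)
    nlinarith [sq_nonneg (∑ j, Real.sin (θ j) * Real.cos (θ j))]

theorem isAngleWeight_cos {N : ℕ} (θ : Fin N → ℝ) :
    IsAngleWeight θ (fun j => Real.cos (θ j) ^ 2) where
  nonneg j := sq_nonneg _
  le_one j := Real.cos_sq_le_one _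
  sin_sq_le j k := by
    rw [Real.sin_add]
    have h1 := Real.sin_sq_add_cos_sq (θ j)
    have h2 := Real.sin_sq_add_cos_sq (θ k)
    nlinarith [sq_nonneg (Real.sin (θ j) * Real.cos (θ k) - Real.cos (θ j) * Real.sin (θ k)),
      sq_nonneg (Real.sin (θ j) * Real.sin (θ k)), sq_nonneg (Real.cos (θ j) * Real.cos (θ k))]
  le_sum := by
    rw [sum_edge_sin_sq]
    have h1 : ∑ j, Real.sin (θ j) ^ 2 = N - ∑ j, Real.cos (θ j) ^ 2 := by
      simp [Real.sin_sq, Finset.sum_sub_distrib]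
    rw [h1]
    have h2 : ∑ j, Real.sin (θ j) ^ 2 * Real.cos (θ j) ^ 2 ≤ ∑ j, Real.cos (θ j) ^ 2 :=
      Finset.sum_le_sum fun j _ => mul_le_of_le_one_left (sq_nonneg _) (Real.sin_sq_le_one _)
    nlinarith [sq_nonneg (∑ j, Real.sin (θ j) * Real.cos (θ j))]

theorem IsAngleWeight.norm_charFn_le_near {N : ℕ} {θ q : Fin N → ℝ} (h : IsAngleWeight θ q)
    {b : Fin N → ℝ} {B K : ℝ} (hB : ∑ j, b j ^ 2 ≤ B) (hK : ∑ j, q j ≤ K) (s : Fin N → ℤ) :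
    ‖charFn b s θ‖ ≤ Real.exp (K ^ 2 + 2 * K + 4 * B * K)
      * ∏ j, Real.exp (-(N / 2 * (1 - 4 * b j ^ 2)) * q j) := by
  refine (norm_charFn_le b s θ).trans ?_
  rw [← Real.exp_sum, ← Real.exp_add, Real.exp_le_exp]
  set U := ∑ j, q j with hU
  have hU0 : 0 ≤ U := Finset.sum_nonneg fun j _ => h.nonneg j
  have h1 : ∑ e : Edge N, (b e.1.1 + b e.1.2) ^ 2 * Real.sin (θ e.1.1 + θ e.1.2) ^ 2
      ≤ 4 * N * (∑ j, b j ^ 2 * q j) + 4 * (∑ j, b j ^ 2) * U := by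
    have h2 : ∑ e : Edge N, (b e.1.1 + b e.1.2) ^ 2 * Real.sin (θ e.1.1 + θ e.1.2) ^ 2
        ≤ ∑ e : Edge N, (2 * (b e.1.1 ^ 2 + b e.1.2 ^ 2)) * (2 * (q e.1.1 + q e.1.2)) := by
      refine Finset.sum_le_sum fun e _ => ?_
      refine mul_le_mul ?_ (h.sin_sq_le _ _) (sq_nonneg _) (by positivity)
      nlinarith [sq_nonneg (b e.1.1 - b e.1.2)]
    refine h2.trans ((sum_edge_le (fun j k => (2 * (b j ^ 2 + b k ^ 2)) * (2 * (q j + q k)))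
      (fun j k => by ring) (fun j => ?_)).trans (le_of_eq ?_))
    · have := h.nonneg j
      positivity
    · have h3 : ∀ j k, (2 * (b j ^ 2 + b k ^ 2)) * (2 * (q j + q k)) = 4 * (b j ^ 2 * q j)
        + 4 * (b k ^ 2 * q k) + 4 * (b j ^ 2 * q k) + 4 * (q j * b k ^ 2) := fun j k => by ring
      simp only [h3, Finset.sum_add_distrib, ← Finset.mul_sum, ← Finset.sum_mul, Finset.sum_const,
        Finset.card_univ, Fintype.card_fin, nsmul_eq_mul, ← hU]
      have h4 : ∑ j, b j ^ 2 * (N * q j) = N * ∑ j, b j ^ 2 * q j := by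
        rw [Finset.mul_sum]
        exact Finset.sum_congr rfl fun j _ => by ring
      rw [h4]
      ring
  have h4 := h.le_sum
  rw [← hU] at h4
  have h5 : ∑ e : Edge N, (1 - (b e.1.1 + b e.1.2) ^ 2) * Real.sin (θ e.1.1 + θ e.1.2) ^ 2
      = ∑ e : Edge N, Real.sin (θ e.1.1 + θ e.1.2) ^ 2
        - ∑ e : Edge N, (b e.1.1 + b e.1.2) ^ 2 * Real.sin (θ e.1.1 + θ e.1.2) ^ 2 := by
    rw [← Finset.sum_sub_distrib]
    exact Finset.sum_congr rfl fun e _ => by ring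
  have h6 : ∑ j, -(N / 2 * (1 - 4 * b j ^ 2)) * q j
      = -(N / 2) * U + 2 * N * ∑ j, b j ^ 2 * q j := by
    rw [hU, Finset.mul_sum, Finset.mul_sum, ← Finset.sum_add_distrib]
    exact Finset.sum_congr rfl fun j _ => by ring
  rw [h5, h6]
  have hB0 : 0 ≤ ∑ j, b j ^ 2 := Finset.sum_nonneg fun j _ => sq_nonneg _
  have h7 : (∑ j, b j ^ 2) * U ≤ B * K := mul_le_mul hB hK hU0 (hB0.trans hB)
  have h8 : 0 ≤ B * K := (mul_nonneg hB0 hU0).trans h7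
  nlinarith

theorem IsAngleWeight.norm_charFn_le_far {N : ℕ} {θ q : Fin N → ℝ} (h : IsAngleWeight θ q)
    {b : Fin N → ℝ} (hb : ∀ j, |b j| ≤ 1 / 4) {K : ℝ} (hN : 12 ≤ N)
    (hK : K ≤ ∑ j, q j) (hq : ∑ j, q j ≤ N / 2) (s : Fin N → ℤ) :
    ‖charFn b s θ‖ ≤ Real.exp (-(N / 16 * K)) * ∏ j, Real.exp (-(N / 16) * q j) := by
  refine (norm_charFn_le b s θ).trans ?_
  rw [← Real.exp_sum, ← Real.exp_add, Real.exp_le_exp, ← Finset.mul_sum]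
  set U := ∑ j, q j with hU
  have hU0 : 0 ≤ U := Finset.sum_nonneg fun j _ => h.nonneg j
  have h1 : 3 / 4 * ∑ e : Edge N, Real.sin (θ e.1.1 + θ e.1.2) ^ 2 ≤
      ∑ e : Edge N, (1 - (b e.1.1 + b e.1.2) ^ 2) * Real.sin (θ e.1.1 + θ e.1.2) ^ 2 := by
    rw [Finset.mul_sum]
    refine Finset.sum_le_sum fun e _ => mul_le_mul_of_nonneg_right ?_ (sq_nonneg _)
    have h1 := abs_le.mp (hb e.1.1)
    have h2 := abs_le.mp (hb e.1.2)
    nlinarith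
  have h4 := h.le_sum
  rw [← hU] at h4
  have hN' : (12 : ℝ) ≤ N := by exact_mod_cast hN
  nlinarith

theorem sq_sub_pow_four_le_sin_sq (x : ℝ) : x ^ 2 - x ^ 4 ≤ Real.sin x ^ 2 := by
  have key : ∀ y : ℝ, 0 < y → y ^ 2 - y ^ 4 ≤ Real.sin y ^ 2 := fun y hy => by
    rcases le_or_gt 1 y with h | h
    · have : y ^ 2 - y ^ 4 ≤ 0 := by
        nlinarith [mul_nonneg (sq_nonneg y) (show 0 ≤ y ^ 2 - 1 by nlinarith)]
      exact this.trans (sq_nonneg _)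
    · have h1 := Real.sin_gt_sub_cube hy
      have h2 : 0 ≤ y - y ^ 3 / 6 := by nlinarith [mul_pos hy hy]
      have h3 := pow_le_pow_left₀ h2 h1.le 2
      nlinarith [mul_pos hy hy, pow_pos hy 4, pow_pos hy 6]
  rcases lt_trichotomy x 0 with h | h | h
  · have h1 := key (-x) (by linarith)
    rw [Real.sin_neg] at h1
    linarith [show (-x) ^ 2 - (-x) ^ 4 = x ^ 2 - x ^ 4 by ring, neg_sq (Real.sin x)]
  · simp [h]
  · exact key x h

theorem two_fifths_mul_sq_le_sin_sq {x : ℝ} (hx : |x| ≤ Real.pi / 2) :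
    2 / 5 * x ^ 2 ≤ Real.sin x ^ 2 := by
  have h1 := Real.mul_le_sin (abs_nonneg x) hx
  have h2 : 0 ≤ 2 / Real.pi * |x| := by positivity
  have h3 := pow_le_pow_left₀ h2 h1 2
  have h4 : Real.sin |x| ^ 2 = Real.sin x ^ 2 := by
    rcases abs_choice x with h | h <;> simp [h]
  rw [h4, mul_pow, sq_abs] at h3
  refine le_trans ?_ h3
  refine mul_le_mul_of_nonneg_right ?_ (sq_nonneg _)
  rw [div_pow, le_div_iff₀ (by positivity)]
  nlinarith [Real.pi_lt_d2, Real.pi_pos]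

theorem pow_mul_exp_neg_le (m : ℕ) {c y : ℝ} (hc : 0 < c) (hy : 0 ≤ y) :
    y ^ m * Real.exp (-(2 * c) * y) ≤ m.factorial / c ^ m * Real.exp (-c * y) := by
  have h1 := Real.pow_div_factorial_le_exp (c * y) (by positivity) m
  rw [div_le_iff₀ (by positivity), mul_pow] at h1
  have h2 : Real.exp (-(2 * c) * y) = Real.exp (-c * y) * Real.exp (-c * y) := by
    rw [← Real.exp_add]; ring_nf
  have h3 : Real.exp (c * y) * Real.exp (-c * y) = 1 := by rw [← Real.exp_add]; ring_nf; simp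
  rw [h2, ← mul_assoc]
  refine mul_le_mul_of_nonneg_right ?_ (Real.exp_pos _).le
  rw [le_div_iff₀ (by positivity)]
  calc y ^ m * Real.exp (-c * y) * c ^ m = (c ^ m * y ^ m) * Real.exp (-c * y) := by ring
    _ ≤ (Real.exp (c * y) * m.factorial) * Real.exp (-c * y) := by gcongr
    _ = m.factorial * (Real.exp (c * y) * Real.exp (-c * y)) := by ring
    _ = m.factorial := by rw [h3, mul_one]

theorem exp_neg_sin_sq_le {a x : ℝ} (ha : 0 < a) (hx : |x| ≤ Real.pi / 2) :
    Real.exp (-a * Real.sin x ^ 2)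
      ≤ Real.exp (-a * x ^ 2) + 50 / a * Real.exp (-(a / 5) * x ^ 2) := by
  have h1 := sq_sub_pow_four_le_sin_sq x
  have h2 := two_fifths_mul_sq_le_sin_sq hx
  set u := Real.sin x ^ 2
  have h3 : Real.exp (-a * u) * (1 - a * (x ^ 2 - u)) ≤ Real.exp (-a * x ^ 2) := by
    have : Real.exp (-a * x ^ 2) = Real.exp (-a * u) * Real.exp (-a * (x ^ 2 - u)) := by
      rw [← Real.exp_add]; ring_nf
    rw [this]
    gcongr
    linarith [Real.add_one_le_exp (-a * (x ^ 2 - u))]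
  have h4 : Real.exp (-a * u) ≤ Real.exp (-(2 * (a / 5)) * x ^ 2) := by
    rw [Real.exp_le_exp]; nlinarith
  have h5 := pow_mul_exp_neg_le 2 (c := a / 5) (y := x ^ 2) (by positivity) (sq_nonneg x)
  have h6 : Real.exp (-a * u) * (a * (x ^ 2 - u)) ≤ 50 / a * Real.exp (-(a / 5) * x ^ 2) := by
    calc Real.exp (-a * u) * (a * (x ^ 2 - u)) ≤ Real.exp (-a * u) * (a * (x ^ 2) ^ 2) := by
          gcongr; nlinarith
      _ ≤ Real.exp (-(2 * (a / 5)) * x ^ 2) * (a * (x ^ 2) ^ 2) := by gcongr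
      _ = a * ((x ^ 2) ^ 2 * Real.exp (-(2 * (a / 5)) * x ^ 2)) := by ring
      _ ≤ a * (Nat.factorial 2 / (a / 5) ^ 2 * Real.exp (-(a / 5) * x ^ 2)) := by gcongr
      _ = _ := by
        simp only [Nat.factorial]
        push_cast
        field_simp
        norm_num
  linarith

theorem setIntegral_Ioc_le {ℓ : ℝ} (hℓ : ℓ ≤ Real.pi / 2) {f g : ℝ → ℝ} (hf : Continuous f)
    (hg : Integrable g) (hg0 : ∀ x, 0 ≤ g x) (h : ∀ x, |x| ≤ Real.pi / 2 → f x ≤ g x) :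
    ∫ x in Set.Ioc (-ℓ) ℓ, f x ≤ ∫ x, g x := by
  refine (setIntegral_mono_on hf.integrableOn_Ioc hg.integrableOn measurableSet_Ioc
    fun x hx => h x (abs_le.mpr ⟨by linarith [hx.1], hx.2.trans hℓ⟩)).trans ?_
  exact setIntegral_le_integral hg (Filter.Eventually.of_forall hg0)

theorem integral_exp_neg_sin_sq_le {a ℓ : ℝ} (ha : 0 < a) (hℓ : ℓ ≤ Real.pi / 2) :
    ∫ x in Set.Ioc (-ℓ) ℓ, Real.exp (-a * Real.sin x ^ 2) ≤ √(Real.pi / a) * (1 + 120 / a) := by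
  have i1 := integrable_exp_neg_mul_sq ha
  have i2 := (integrable_exp_neg_mul_sq (b := a / 5) (by positivity)).const_mul (50 / a)
  refine (setIntegral_Ioc_le hℓ (by fun_prop) (i1.add i2) (fun x => ?_)
    (fun x hx => exp_neg_sin_sq_le ha hx)).trans ?_
  · simp only [Pi.add_apply]; positivity
  · simp only [Pi.add_apply]
    rw [integral_add i1 i2, integral_const_mul, integral_gaussian, integral_gaussian]
    have h1 : √(Real.pi / (a / 5)) ≤ √(Real.pi / a) * (12 / 5) := by
      rw [show Real.pi / (a / 5) = Real.pi / a * 5 by field_simp, Real.sqrt_mul (by positivity)]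
      gcongr
      rw [Real.sqrt_le_left (by norm_num)]
      norm_num
    calc _ ≤ √(Real.pi / a) + 50 / a * (√(Real.pi / a) * (12 / 5)) := by gcongr
      _ = _ := by ring

theorem integral_exp_neg_cos_sq_le {a ℓ : ℝ} (ha : 0 < a) (hℓ : ℓ ≤ Real.pi / 2) :
    ∫ x in Set.Ioc (-ℓ) ℓ, Real.exp (-a * Real.cos x ^ 2) ≤ √(Real.pi / a) * (1 + 120 / a) := by
  refine le_trans ?_ (integral_exp_neg_sin_sq_le ha le_rfl)
  have hc : Continuous fun x => Real.exp (-a * Real.cos x ^ 2) := by fun_prop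
  refine (setIntegral_mono_set (t := Set.Ioc (-(Real.pi / 2)) (Real.pi / 2)) hc.integrableOn_Ioc
    (Filter.Eventually.of_forall fun x => (Real.exp_pos _).le)
    (Set.Ioc_subset_Ioc (by linarith) hℓ).eventuallyLE).trans (le_of_eq ?_)
  have hpi := Real.pi_pos
  rw [← intervalIntegral.integral_of_le (by linarith), ← intervalIntegral.integral_of_le (by linarith)]
  have hp : Function.Periodic (fun x => Real.exp (-a * Real.cos x ^ 2)) Real.pi := fun x => by
    simp [Real.cos_add_pi]
  have h1 := hp.intervalIntegral_add_eq (-(Real.pi / 2)) (-(Real.pi / 2) + Real.pi / 2)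
  have h2 := intervalIntegral.integral_comp_add_right (a := -(Real.pi / 2)) (b := Real.pi / 2)
    (fun x => Real.exp (-a * Real.cos x ^ 2)) (Real.pi / 2)
  simp only [Real.cos_add_pi_div_two, neg_sq] at h2
  rw [h2]
  rw [show -(Real.pi / 2) + Real.pi = Real.pi / 2 by ring,
    show -(Real.pi / 2) + Real.pi / 2 + Real.pi = Real.pi / 2 + Real.pi / 2 by ring] at h1
  exact h1

theorem integral_pow_mul_exp_neg_sin_sq_le (m : ℕ) {a ℓ : ℝ} (ha : 0 < a) (hℓ : ℓ ≤ Real.pi / 2) :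
    ∫ x in Set.Ioc (-ℓ) ℓ, x ^ (2 * m) * Real.exp (-a * Real.sin x ^ 2)
      ≤ m.factorial * (5 / a) ^ m * (3 * √(Real.pi / a)) := by
  have i2 := (integrable_exp_neg_mul_sq (b := a / 5) (by positivity)).const_mul
    (m.factorial / (a / 5) ^ m)
  refine (setIntegral_Ioc_le hℓ (by fun_prop) i2 (fun x => by positivity) (fun x hx => ?_)).trans ?_
  · rw [pow_mul]
    refine le_trans ?_ (pow_mul_exp_neg_le m (by positivity) (sq_nonneg x))
    refine mul_le_mul_of_nonneg_left (Real.exp_le_exp.mpr ?_) (by positivity)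
    have := two_fifths_mul_sq_le_sin_sq hx
    nlinarith
  · rw [integral_const_mul, integral_gaussian]
    have h1 : √(Real.pi / (a / 5)) ≤ 3 * √(Real.pi / a) := by
      rw [show Real.pi / (a / 5) = 5 * (Real.pi / a) by field_simp, Real.sqrt_mul (by positivity)]
      gcongr
      rw [Real.sqrt_le_left (by norm_num)]
      norm_num
    rw [div_eq_mul_inv, ← inv_pow, inv_div]
    gcongr

theorem integral_exp_neg_cos_sq_le_exp {a ℓ : ℝ} (ha : 0 < a) (hℓ : ℓ ≤ Real.pi / 4) (h0 : 0 < ℓ) :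
    ∫ x in Set.Ioc (-ℓ) ℓ, Real.exp (-a * Real.cos x ^ 2) ≤ 2 * Real.exp (-(a / 2)) := by
  have h : ∀ x ∈ Set.Ioc (-ℓ) ℓ, Real.exp (-a * Real.cos x ^ 2) ≤ Real.exp (-(a / 2)) := fun x hx => by
    rw [Real.exp_le_exp]
    have h1 : 1 / 2 ≤ Real.cos x ^ 2 := by
      have h2 : Real.cos (Real.pi / 4) ≤ Real.cos x := by
        rw [← Real.cos_abs x]
        exact Real.cos_le_cos_of_nonneg_of_le_pi (abs_nonneg _) (by linarith [Real.pi_pos])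
          ((abs_le.mpr ⟨hx.1.le, hx.2⟩).trans hℓ)
      rw [Real.cos_pi_div_four] at h2
      have h3 := pow_le_pow_left₀ (by positivity) h2 2
      rw [div_pow, Real.sq_sqrt (by norm_num)] at h3
      linarith
    nlinarith
  have hc : Continuous fun x => Real.exp (-a * Real.cos x ^ 2) := by fun_prop
  refine (setIntegral_mono_on hc.integrableOn_Ioc (by simp) measurableSet_Ioc h).trans ?_
  rw [setIntegral_const]
  simp only [measureReal_def, Real.volume_Ioc, smul_eq_mul]
  rw [ENNReal.toReal_ofReal (by linarith)]
  gcongr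
  linarith [Real.pi_lt_d2]

theorem boxLen_le {N : ℕ} (j : Fin N) : boxLen j ≤ Real.pi / 2 := by
  have := Real.pi_pos
  unfold boxLen
  split_ifs <;> linarith

/-- The one-dimensional Gaussian-like factor controlling the characteristic function near `0`. -/
noncomputable def nearFactor {N : ℕ} (b : Fin N → ℝ) (j : Fin N) (x : ℝ) : ℝ :=
  Real.exp (-(N / 2 * (1 - 4 * b j ^ 2)) * Real.sin x ^ 2)

theorem nearFactor_nonneg {N : ℕ} (b : Fin N → ℝ) (j : Fin N) (x : ℝ) : 0 ≤ nearFactor b j x :=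
  (Real.exp_pos _).le

theorem integral_prod_le {N : ℕ} {f : Fin N → ℝ → ℝ} (hf : ∀ j x, 0 ≤ f j x) {z : ℝ}
    {c ρ : Fin N → ℝ}
    (h : ∀ j, ∫ x in Set.Ioc (-boxLen j) (boxLen j), f j x ≤ z * Real.exp (c j) * ρ j) :
    ∫ θ, ∏ j, f j (θ j) ∂boxMeasure N ≤ z ^ N * Real.exp (∑ j, c j) * ∏ j, ρ j := by
  rw [boxMeasure, integral_fintype_prod_eq_prod]
  refine (Finset.prod_le_prod (fun j _ => integral_nonneg (hf j)) fun j _ => h j).trans_eq ?_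
  rw [Finset.prod_mul_distrib, Finset.prod_mul_distrib, Real.exp_sum]
  simp

theorem near_rate_ge {N : ℕ} {b : ℝ} (hb : |b| ≤ 1 / 4) :
    3 * (N : ℝ) / 8 ≤ N / 2 * (1 - 4 * b ^ 2) := by
  have h1 : b ^ 2 ≤ (1 / 4) ^ 2 := sq_le_sq' (by linarith [abs_le.mp hb]) (abs_le.mp hb).2
  nlinarith [(Nat.cast_nonneg N : (0 : ℝ) ≤ N)]

theorem sqrt_near_rate_le {N : ℕ} (hN : 0 < N) {b : ℝ} (hb : |b| ≤ 1 / 4) :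
    √(Real.pi / (N / 2 * (1 - 4 * b ^ 2))) ≤ √(2 * Real.pi / N) * Real.exp (4 * b ^ 2) := by
  have hN' : (0 : ℝ) < N := by exact_mod_cast hN
  have h1 : b ^ 2 ≤ (1 / 4) ^ 2 := sq_le_sq' (by linarith [abs_le.mp hb]) (abs_le.mp hb).2
  have h2 : 0 < 1 - 4 * b ^ 2 := by nlinarith
  have h3 : 1 ≤ (1 - 4 * b ^ 2) * Real.exp (4 * b ^ 2) ^ 2 := by
    rw [← Real.exp_nat_mul]
    have := Real.add_one_le_exp (((2 : ℕ) : ℝ) * (4 * b ^ 2))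
    push_cast at this ⊢
    nlinarith [sq_nonneg b, mul_nonneg (sq_nonneg b) (sub_nonneg.2 h1)]
  rw [Real.sqrt_le_left (by positivity), mul_pow, Real.sq_sqrt (by positivity),
    div_le_iff₀ (by positivity)]
  have : 2 * Real.pi / N * Real.exp (4 * b ^ 2) ^ 2 * (N / 2 * (1 - 4 * b ^ 2))
    = Real.pi * ((1 - 4 * b ^ 2) * Real.exp (4 * b ^ 2) ^ 2) := by field_simp
  rw [this]
  exact le_mul_of_one_le_right Real.pi_pos.le h3

theorem near_bound_le {N : ℕ} (hN : 0 < N) {b : ℝ} (hb : |b| ≤ 1 / 4) :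
    √(Real.pi / (N / 2 * (1 - 4 * b ^ 2))) * (1 + 120 / (N / 2 * (1 - 4 * b ^ 2)))
      ≤ √(2 * Real.pi / N) * Real.exp (4 * b ^ 2 + 320 / N) := by
  have hN' : (0 : ℝ) < N := by exact_mod_cast hN
  have h1 := near_rate_ge (N := N) hb
  rw [Real.exp_add, ← mul_assoc]
  have h0 : 0 < (N : ℝ) / 2 * (1 - 4 * b ^ 2) := by linarith
  refine mul_le_mul (sqrt_near_rate_le hN hb) ?_ (by positivity) (by positivity)
  have h2 := Real.add_one_le_exp (320 / (N : ℝ))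
  refine le_trans ?_ h2
  rw [add_comm]
  refine add_le_add_left ?_ _
  rw [div_le_div_iff₀ h0 hN']
  linarith

theorem sum_near_exponent_le {N : ℕ} (hN : 0 < N) {b : Fin N → ℝ} {B : ℝ}
    (hB : ∑ j, b j ^ 2 ≤ B) : ∑ j, (4 * b j ^ 2 + 320 / (N : ℝ)) ≤ 4 * B + 320 := by
  have hN' : (0 : ℝ) < N := by exact_mod_cast hN
  rw [Finset.sum_add_distrib, ← Finset.mul_sum, Finset.sum_const, Finset.card_univ,
    Fintype.card_fin, nsmul_eq_mul, mul_div_cancel₀ _ hN'.ne']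
  linarith

theorem integral_nearFactor_le {N : ℕ} (hN : 0 < N) {b : Fin N → ℝ} (hb : ∀ j, |b j| ≤ 1 / 4)
    (j : Fin N) : ∫ x in Set.Ioc (-boxLen j) (boxLen j), nearFactor b j x
      ≤ √(2 * Real.pi / N) * Real.exp (4 * b j ^ 2 + 320 / N) := by
  have hN' : (0 : ℝ) < N := by exact_mod_cast hN
  have h1 := near_rate_ge (N := N) (hb j)
  exact (integral_exp_neg_sin_sq_le (by linarith) (boxLen_le j)).trans (near_bound_le hN (hb j))

theorem integral_prod_nearFactor_le {N : ℕ} (hN : 0 < N) {b : Fin N → ℝ}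
    (hb : ∀ j, |b j| ≤ 1 / 4) {B : ℝ} (hB : ∑ j, b j ^ 2 ≤ B) :
    ∫ θ, ∏ j, nearFactor b j (θ j) ∂boxMeasure N
      ≤ √(2 * Real.pi / N) ^ N * Real.exp (4 * B + 320) := by
  refine (integral_prod_le (z := √(2 * Real.pi / N)) (ρ := fun _ => 1) (nearFactor_nonneg b)
    (fun j => by rw [mul_one]; exact integral_nearFactor_le hN hb j)).trans ?_
  rw [Finset.prod_const_one, mul_one]
  gcongr
  exact sum_near_exponent_le hN hB

theorem integral_pow_mul_prod_nearFactor_le {N : ℕ} (m : ℕ) (hN : 0 < N) {b : Fin N → ℝ}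
    (hb : ∀ j, |b j| ≤ 1 / 4) {B : ℝ} (hB : ∑ j, b j ^ 2 ≤ B) (i : Fin N) :
    ∫ θ, θ i ^ (2 * m) * ∏ j, nearFactor b j (θ j) ∂boxMeasure N
      ≤ √(2 * Real.pi / N) ^ N * Real.exp (4 * B + 320) * (3 * m.factorial * (14 / N) ^ m) := by
  have hN' : (0 : ℝ) < N := by exact_mod_cast hN
  have h := integral_prod_le (f := fun j x => (if j = i then x ^ (2 * m) else 1) * nearFactor b j x)
    (c := fun j => 4 * b j ^ 2 + 320 / (N : ℝ)) (z := √(2 * Real.pi / N))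
    (ρ := fun j => if j = i then 3 * m.factorial * (14 / (N : ℝ)) ^ m else 1) (fun j x => by
      refine mul_nonneg ?_ (nearFactor_nonneg b j x)
      split_ifs
      · rw [pow_mul]; positivity
      · norm_num) (fun j => by
      by_cases hj : j = i
      · simp only [hj, if_true]
        have h1 := near_rate_ge (N := N) (hb i)
        have h0 : 0 < (N : ℝ) / 2 * (1 - 4 * b i ^ 2) := by linarith
        refine (integral_pow_mul_exp_neg_sin_sq_le m (by linarith) (boxLen_le i)).trans ?_
        have h2 := sqrt_near_rate_le hN (hb i)
        have h3 : Real.exp (4 * b i ^ 2) ≤ Real.exp (4 * b i ^ 2 + 320 / N) := by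
          rw [Real.exp_le_exp]; linarith [show 0 ≤ 320 / (N : ℝ) by positivity]
        have h4 : 5 / ((N : ℝ) / 2 * (1 - 4 * b i ^ 2)) ≤ 14 / N := by
          rw [div_le_div_iff₀ h0 hN']; linarith
        calc _ ≤ m.factorial * (14 / N) ^ m
              * (3 * (√(2 * Real.pi / N) * Real.exp (4 * b i ^ 2 + 320 / N))) := by
              gcongr
              exact h2.trans (by gcongr)
          _ = _ := by ring
      · simp only [hj, if_false, mul_one, one_mul]
        exact integral_nearFactor_le hN hb j)
  simp only [Finset.prod_mul_distrib, Finset.prod_ite_eq', Finset.mem_univ, if_true] at h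
  refine h.trans ?_
  gcongr
  exact sum_near_exponent_le hN hB

theorem integral_prod_cos_le {N : ℕ} (hN : 0 < N) {b : Fin N → ℝ}
    (hb : ∀ j, |b j| ≤ 1 / 4) {B : ℝ} (hB : ∑ j, b j ^ 2 ≤ B) :
    ∫ θ, ∏ j, Real.exp (-(N / 2 * (1 - 4 * b j ^ 2)) * Real.cos (θ j) ^ 2) ∂boxMeasure N
      ≤ √(2 * Real.pi / N) ^ N * Real.exp (4 * B + 320) * (114 / N) := by
  have hN' : (0 : ℝ) < N := by exact_mod_cast hN
  have h := integral_prod_le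
    (f := fun j x => Real.exp (-(N / 2 * (1 - 4 * b j ^ 2)) * Real.cos x ^ 2))
    (c := fun j => 4 * b j ^ 2 + 320 / (N : ℝ)) (z := √(2 * Real.pi / N))
    (ρ := fun j => if j = (⟨0, hN⟩ : Fin N) then 114 / (N : ℝ) else 1)
    (fun j x => (Real.exp_pos _).le) (fun j => by
      have h1 := near_rate_ge (N := N) (hb j)
      have h0 : 0 < (N : ℝ) / 2 * (1 - 4 * b j ^ 2) := by linarith
      by_cases hj : j = ⟨0, hN⟩
      · have h2 : boxLen j = Real.pi / 4 := by simp [boxLen, hj]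
        rw [if_pos hj]
        refine (integral_exp_neg_cos_sq_le_exp h0 h2.le (boxLen_pos j)).trans ?_
        have h3 : Real.exp (-(N / 2 * (1 - 4 * b j ^ 2) / 2)) ≤ 57 / (N : ℝ) ^ 2 := by
          have h4 := Real.pow_div_factorial_le_exp (3 * (N : ℝ) / 16) (by positivity) 2
          have h5 : Real.exp (-(N / 2 * (1 - 4 * b j ^ 2) / 2)) ≤ Real.exp (-(3 * (N : ℝ) / 16)) := by
            rw [Real.exp_le_exp]; linarith
          refine h5.trans ?_
          rw [Real.exp_neg, inv_le_comm₀ (Real.exp_pos _) (by positivity), inv_div]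
          refine le_trans ?_ h4
          simp only [Nat.factorial]
          push_cast
          rw [div_le_div_iff₀ (by norm_num) (by norm_num)]
          nlinarith [sq_nonneg (N : ℝ)]
        have h6 : 1 / (N : ℝ) ≤ √(2 * Real.pi / N) := by
          apply Real.le_sqrt_of_sq_le
          have h7 : (1 : ℝ) ≤ N := by exact_mod_cast hN
          rw [div_pow, one_pow, div_le_div_iff₀ (by positivity) hN']
          nlinarith [Real.pi_gt_three, mul_le_mul_of_nonneg_left h7 hN'.le, mul_pos hN' hN']
        have h8 : 1 ≤ Real.exp (4 * b j ^ 2 + 320 / (N : ℝ)) := Real.one_le_exp (by positivity)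
        calc 2 * Real.exp (-(N / 2 * (1 - 4 * b j ^ 2) / 2)) ≤ 2 * (57 / (N : ℝ) ^ 2) := by gcongr
          _ = 1 / N * 1 * (114 / N) := by ring
          _ ≤ _ := by gcongr
      · simp only [hj, if_false, mul_one]
        exact (integral_exp_neg_cos_sq_le h0 (boxLen_le j)).trans (near_bound_le hN (hb j)))
  simp only [Finset.prod_ite_eq', Finset.mem_univ, if_true] at h
  refine h.trans ?_
  gcongr
  exact sum_near_exponent_le hN hB

theorem far_bound_le {N : ℕ} (hN : 16 ≤ N) :
    √(Real.pi / (N / 16)) * (1 + 120 / (N / 16)) ≤ √(2 * Real.pi / N) * Real.exp 6 := by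
  have hN' : (16 : ℝ) ≤ N := by exact_mod_cast hN
  have h1 : √(Real.pi / (N / 16)) ≤ √(2 * Real.pi / N) * 3 := by
    rw [Real.sqrt_le_left (by positivity), mul_pow, Real.sq_sqrt (by positivity)]
    rw [div_le_iff₀ (by positivity)]
    have : 2 * Real.pi / N * 3 ^ 2 * (N / 16) = Real.pi * (9 / 8) := by field_simp; norm_num
    rw [this]
    linarith [Real.pi_pos]
  have h2 : 120 / ((N : ℝ) / 16) ≤ 120 := by
    rw [div_le_iff₀ (by positivity)]; linarith
  have h3 : (363 : ℝ) ≤ Real.exp 6 := by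
    have h4 := Real.exp_one_gt_d9
    have h5 : Real.exp 6 = Real.exp 1 ^ 6 := by rw [← Real.exp_nat_mul]; norm_num
    rw [h5]
    calc (363 : ℝ) ≤ 2.7 ^ 6 := by norm_num
      _ ≤ _ := by gcongr; linarith
  calc _ ≤ √(2 * Real.pi / N) * 3 * (1 + 120) := by gcongr
    _ = √(2 * Real.pi / N) * 363 := by ring
    _ ≤ _ := by gcongr

theorem integral_prod_far_le {N : ℕ} (hN : 16 ≤ N) {f : ℝ → ℝ} (h : ∀ ℓ ≤ Real.pi / 2,
      ∫ x in Set.Ioc (-ℓ) ℓ, Real.exp (-(N / 16) * f x ^ 2)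
        ≤ √(Real.pi / (N / 16)) * (1 + 120 / (N / 16))) :
    ∫ θ, ∏ j, Real.exp (-(N / 16) * f (θ j) ^ 2) ∂boxMeasure N
      ≤ √(2 * Real.pi / N) ^ N * Real.exp (6 * N) := by
  refine (integral_prod_le (f := fun _ x => Real.exp (-(N / 16) * f x ^ 2)) (ρ := fun _ => 1)
    (c := fun _ => 6) (z := √(2 * Real.pi / N))
    (fun j x => (Real.exp_pos _).le) (fun j => ?_)).trans (le_of_eq ?_)
  · rw [mul_one]
    exact (h _ (boxLen_le j)).trans (far_bound_le hN)
  · simp [mul_comm]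

theorem boxMeasure_eq_restrict (N : ℕ) : boxMeasure N
    = (volume : Measure (Fin N → ℝ)).restrict
      (Set.univ.pi fun j => Set.Ioc (-boxLen j) (boxLen j)) := by
  rw [boxMeasure, volume_pi, Measure.restrict_pi_pi]

theorem integrable_boxMeasure {E : Type*} [NormedAddCommGroup E] {N : ℕ} {f : (Fin N → ℝ) → E}
    (hf : Continuous f) : Integrable f (boxMeasure N) := by
  rw [boxMeasure_eq_restrict]
  have h := hf.continuousOn.integrableOn_compact (μ := volume)
    (isCompact_Icc (a := fun j : Fin N => -boxLen j) (b := fun j => boxLen j))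
  refine h.mono_set fun θ hθ => ?_
  exact ⟨fun j => (hθ j trivial).1.le, fun j => (hθ j trivial).2⟩

/-- The part of the box close to the saddle point `0`. -/
def nearSet (N : ℕ) : Set (Fin N → ℝ) :=
  {θ | ∑ j, Real.sin (θ j) ^ 2 ≤ 112 ∧ ∀ j, |θ j| ≤ 1 / 4}

/-- The constant in the bound of `charFn` near the saddle points. -/
noncomputable def nearConst (B : ℝ) : ℝ := Real.exp (112 ^ 2 + 2 * 112 + 4 * B * 112)

theorem norm_charFn_le_of_mem_nearSet {N : ℕ} {b : Fin N → ℝ} {B : ℝ} (hB : ∑ j, b j ^ 2 ≤ B)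
    (s : Fin N → ℤ) {θ : Fin N → ℝ} (hθ : ∑ j, Real.sin (θ j) ^ 2 ≤ 112) :
    ‖charFn b s θ‖ ≤ nearConst B * ∏ j, nearFactor b j (θ j) :=
  (isAngleWeight_sin θ).norm_charFn_le_near hB hθ s

/-- A dominating function for `charFn` off `nearSet`. -/
noncomputable def farBound (B : ℝ) {N : ℕ} (b : Fin N → ℝ) (θ : Fin N → ℝ) : ℝ :=
  nearConst B * (∑ i, 4096 * (θ i ^ (2 * 3) * ∏ j, nearFactor b j (θ j)))
  + nearConst B * ∏ j, Real.exp (-(N / 2 * (1 - 4 * b j ^ 2)) * Real.cos (θ j) ^ 2)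
  + Real.exp (-(N / 16 * 112)) * (∏ j, Real.exp (-(N / 16) * Real.sin (θ j) ^ 2))
  + Real.exp (-(N / 16 * 112)) * (∏ j, Real.exp (-(N / 16) * Real.cos (θ j) ^ 2))

theorem continuous_farBound (B : ℝ) {N : ℕ} (b : Fin N → ℝ) : Continuous (farBound B b) := by
  unfold farBound nearFactor; fun_prop

theorem farBound_nonneg (B : ℝ) {N : ℕ} (b : Fin N → ℝ) (θ : Fin N → ℝ) : 0 ≤ farBound B b θ := by
  have h : 0 ≤ ∑ i, 4096 * (θ i ^ (2 * 3) * ∏ j, nearFactor b j (θ j)) :=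
    Finset.sum_nonneg fun i _ => by
      rw [pow_mul]
      unfold nearFactor
      positivity
  unfold farBound nearConst
  positivity

theorem norm_charFn_le_farBound {N : ℕ} (hN : 16 ≤ N) {b : Fin N → ℝ} (hb : ∀ j, |b j| ≤ 1 / 4)
    {B : ℝ} (hB : ∑ j, b j ^ 2 ≤ B) (s : Fin N → ℤ) {θ : Fin N → ℝ} (hθ : θ ∉ nearSet N) :
    ‖charFn b s θ‖ ≤ farBound B b θ := by
  have hp : 0 ≤ ∏ j, nearFactor b j (θ j) := Finset.prod_nonneg fun j _ => nearFactor_nonneg b j _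
  have hC : 0 ≤ nearConst B := (Real.exp_pos _).le
  have p1 : 0 ≤ nearConst B * (∑ i, 4096 * (θ i ^ (2 * 3) * ∏ j, nearFactor b j (θ j))) := by
    refine mul_nonneg hC (Finset.sum_nonneg fun i _ => ?_)
    rw [pow_mul]; positivity
  have p2 : 0 ≤ nearConst B * ∏ j, Real.exp (-(N / 2 * (1 - 4 * b j ^ 2)) * Real.cos (θ j) ^ 2) := by
    positivity
  have p3 : 0 ≤ Real.exp (-(N / 16 * 112)) * (∏ j, Real.exp (-(N / 16) * Real.sin (θ j) ^ 2)) := by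
    positivity
  have p4 : 0 ≤ Real.exp (-(N / 16 * 112)) * (∏ j, Real.exp (-(N / 16) * Real.cos (θ j) ^ 2)) := by
    positivity
  have hsum : ∑ j, Real.sin (θ j) ^ 2 + ∑ j, Real.cos (θ j) ^ 2 = N := by
    rw [← Finset.sum_add_distrib]; simp
  unfold farBound
  by_cases h1 : ∑ j, Real.sin (θ j) ^ 2 ≤ 112
  · have h2 : ∃ i, 1 / 4 < |θ i| := by
      by_contra! h
      exact hθ ⟨h1, h⟩
    obtain ⟨i, hi⟩ := h2
    have h3 : 1 ≤ 4096 * θ i ^ (2 * 3) := by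
      have := pow_le_pow_left₀ (by norm_num) hi.le (2 * 3)
      rw [Even.pow_abs (by decide)] at this
      have h5 : (1 / 4 : ℝ) ^ (2 * 3) = 1 / 4096 := by norm_num
      rw [h5] at this
      exact le_of_eq_of_le (by norm_num) (mul_le_mul_of_nonneg_left this (by norm_num : (0 : ℝ) ≤ 4096))
    have h4 : ∏ j, nearFactor b j (θ j) ≤ ∑ i, 4096 * (θ i ^ (2 * 3) * ∏ j, nearFactor b j (θ j)) := by
      refine le_trans ?_ (Finset.single_le_sum (fun i _ => ?_) (Finset.mem_univ i))
      · rw [← mul_assoc]; exact le_mul_of_one_le_left hp h3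
      · rw [pow_mul]; positivity
    have := (norm_charFn_le_of_mem_nearSet hB s h1).trans (mul_le_mul_of_nonneg_left h4 hC)
    linarith
  · by_cases h2 : ∑ j, Real.cos (θ j) ^ 2 ≤ 112
    · have : ‖charFn b s θ‖ ≤
        nearConst B * ∏ j, Real.exp (-(N / 2 * (1 - 4 * b j ^ 2)) * Real.cos (θ j) ^ 2) :=
        (isAngleWeight_cos θ).norm_charFn_le_near hB h2 s
      linarith
    · rcases le_total (∑ j, Real.sin (θ j) ^ 2) (N / 2) with h3 | h3
      · have := (isAngleWeight_sin θ).norm_charFn_le_far hb (by omega) (not_le.1 h1).le h3 s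
        linarith
      · have := (isAngleWeight_cos θ).norm_charFn_le_far hb (by omega) (not_le.1 h2).le (by linarith) s
        linarith

theorem integral_farBound_le (B : ℝ) : ∃ C, 0 < C ∧ ∀ {N : ℕ}, 16 ≤ N → ∀ {b : Fin N → ℝ},
    (∀ j, |b j| ≤ 1 / 4) → ∑ j, b j ^ 2 ≤ B →
      ∫ θ, farBound B b θ ∂boxMeasure N ≤ C / N * √(2 * Real.pi / N) ^ N := by
  refine ⟨nearConst B * Real.exp (4 * B + 320) * (4096 * (18 * 14 ^ 3) + 114) + 2,
    by unfold nearConst; positivity, fun {N} hN {b} hb hB => ?_⟩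
  have hN' : (16 : ℝ) ≤ N := by exact_mod_cast hN
  have hN0 : 0 < N := by omega
  have c1 : Continuous fun θ : Fin N → ℝ =>
    (∑ i, 4096 * (θ i ^ (2 * 3) * ∏ j, nearFactor b j (θ j))) := by unfold nearFactor; fun_prop
  unfold farBound
  rw [integral_add (integrable_boxMeasure (by fun_prop)) (integrable_boxMeasure (by fun_prop)),
    integral_add (integrable_boxMeasure (by fun_prop)) (integrable_boxMeasure (by fun_prop)),
    integral_add (integrable_boxMeasure (by fun_prop)) (integrable_boxMeasure (by fun_prop)),
    integral_const_mul, integral_const_mul, integral_const_mul, integral_const_mul,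
    integral_finsetSum _ (fun i _ => integrable_boxMeasure (by unfold nearFactor; fun_prop))]
  simp only [integral_const_mul]
  set Z := √(2 * Real.pi / N) ^ N with hZ
  have hZ0 : 0 < Z := by positivity
  have hC : 0 ≤ nearConst B := (Real.exp_pos _).le
  have e1 : ∑ i : Fin N, 4096 * ∫ θ, θ i ^ (2 * 3) * ∏ j, nearFactor b j (θ j) ∂boxMeasure N
      ≤ Z * Real.exp (4 * B + 320) * (4096 * (18 * 14 ^ 3)) / N := by
    refine (Finset.sum_le_sum fun i _ => mul_le_mul_of_nonneg_left
      (integral_pow_mul_prod_nearFactor_le 3 hN0 hb hB i) (by norm_num)).trans ?_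
    rw [Finset.sum_const, Finset.card_univ, Fintype.card_fin, nsmul_eq_mul, ← hZ]
    simp only [Nat.factorial]
    push_cast
    have : (N : ℝ) * (4096 * (Z * Real.exp (4 * B + 320) * (3 * 6
        * (14 / N) ^ 3))) = Z * Real.exp (4 * B + 320) * (4096 * (18 * 14 ^ 3)) / N * (1 / N) := by
      field_simp
      ring
    rw [this]
    refine mul_le_of_le_one_right (by positivity) ?_
    rw [div_le_one (by positivity)]
    linarith
  have e2 := integral_prod_cos_le hN0 hb hB
  have e3 := integral_prod_far_le hN (f := Real.sin)
    fun ℓ hℓ => integral_exp_neg_sin_sq_le (by positivity) hℓ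
  have e4 := integral_prod_far_le hN (f := Real.cos)
    fun ℓ hℓ => integral_exp_neg_cos_sq_le (by positivity) hℓ
  rw [← hZ] at e2 e3 e4
  have e5 : Real.exp (-(N / 16 * 112)) * (Z * Real.exp (6 * N)) ≤ Z / N := by
    have : Real.exp (-(N / 16 * 112 : ℝ)) * (Z * Real.exp (6 * N)) = Z * Real.exp (-N) := by
      rw [mul_left_comm, ← Real.exp_add]; ring_nf
    rw [this, Real.exp_neg, div_eq_mul_inv]
    gcongr
    linarith [Real.add_one_le_exp (N : ℝ)]
  calc _ ≤ nearConst B * (Z * Real.exp (4 * B + 320) * (4096 * (18 * 14 ^ 3)) / N)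
        + nearConst B * (Z * Real.exp (4 * B + 320) * (114 / N))
        + Real.exp (-(N / 16 * 112)) * (Z * Real.exp (6 * N))
        + Real.exp (-(N / 16 * 112)) * (Z * Real.exp (6 * N)) := by gcongr
    _ ≤ nearConst B * (Z * Real.exp (4 * B + 320) * (4096 * (18 * 14 ^ 3)) / N)
        + nearConst B * (Z * Real.exp (4 * B + 320) * (114 / N)) + Z / N + Z / N := by gcongr
    _ = _ := by ring

theorem integral_norm_charFn_le (B : ℝ) : ∃ C, 0 < C ∧ ∀ {N : ℕ}, 16 ≤ N → ∀ {b : Fin N → ℝ},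
    (∀ j, |b j| ≤ 1 / 4) → ∑ j, b j ^ 2 ≤ B → ∀ s : Fin N → ℤ,
      ∫ θ, ‖charFn b s θ‖ ∂boxMeasure N ≤ C * √(2 * Real.pi / N) ^ N := by
  obtain ⟨C, hC, h⟩ := integral_farBound_le B
  refine ⟨nearConst B * Real.exp (4 * B + 320) + C, by unfold nearConst; positivity,
    fun {N} hN {b} hb hB s => ?_⟩
  have hN0 : 0 < N := by omega
  have hN' : (1 : ℝ) ≤ N := by exact_mod_cast hN0
  have c1 : Continuous fun θ : Fin N → ℝ => ∏ j, nearFactor b j (θ j) := by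
    unfold nearFactor; fun_prop
  have c2 := continuous_farBound B b
  have h1 : ∀ θ, ‖charFn b s θ‖ ≤ nearConst B * ∏ j, nearFactor b j (θ j) + farBound B b θ := by
    intro θ
    by_cases hθ : θ ∈ nearSet N
    · have := norm_charFn_le_of_mem_nearSet hB s hθ.1
      linarith [farBound_nonneg B b θ]
    · have := norm_charFn_le_farBound hN hb hB s hθ
      have h2 : 0 ≤ nearConst B * ∏ j, nearFactor b j (θ j) := by
        unfold nearConst nearFactor; positivity
      linarith
  refine (integral_mono (integrable_boxMeasure (continuous_charFn b s).norm)
    (integrable_boxMeasure (by fun_prop)) h1).trans ?_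
  rw [integral_add (integrable_boxMeasure (by fun_prop)) (integrable_boxMeasure c2),
    integral_const_mul]
  have h2 := integral_prod_nearFactor_le hN0 hb hB
  have h3 := h hN hb hB
  have h4 : C / N ≤ C := div_le_self hC.le hN'
  have h5 : 0 ≤ nearConst B := (Real.exp_pos _).le
  calc _ ≤ nearConst B * (√(2 * Real.pi / N) ^ N * Real.exp (4 * B + 320))
        + C * √(2 * Real.pi / N) ^ N := by
        gcongr
        exact h3.trans (by gcongr)
    _ = _ := by ring

theorem tan_le_add_cube {x : ℝ} (h0 : 0 ≤ x) (h1 : x ≤ 1) : Real.tan x ≤ x + x ^ 3 := by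
  have hx2 : x ^ 2 ≤ 1 := pow_le_one₀ h0 h1
  have h2 := Real.one_sub_sq_div_two_le_cos (x := x)
  have h3 : 0 < Real.cos x := by nlinarith
  rw [Real.tan_eq_sin_div_cos, div_le_iff₀ h3]
  have h4 := Real.sin_le h0
  have h5 : (x + x ^ 3) * (1 - x ^ 2 / 2) ≤ (x + x ^ 3) * Real.cos x :=
    mul_le_mul_of_nonneg_left h2 (by positivity)
  have h6 : x ≤ (x + x ^ 3) * (1 - x ^ 2 / 2) := by
    have : 0 ≤ x ^ 3 * (1 - x ^ 2) := mul_nonneg (by positivity) (by linarith)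
    nlinarith
  linarith

theorem arctan_le_self_of_nonneg {x : ℝ} (h0 : 0 ≤ x) : Real.arctan x ≤ x := by
  rcases h0.eq_or_lt with h | h
  · rw [← h]; simp
  · have h1 := Real.arctan_pos.mpr h
    have h2 := Real.lt_tan h1 (Real.arctan_lt_pi_div_two x)
    rw [Real.tan_arctan] at h2
    exact h2.le

theorem sub_cube_le_arctan {x : ℝ} (h0 : 0 ≤ x) (h1 : x ≤ 1) : x - x ^ 3 ≤ Real.arctan x := by
  have hx2 : x ^ 2 ≤ 1 := pow_le_one₀ h0 h1
  have h2 : 0 ≤ x - x ^ 3 := by nlinarith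
  have h3 : x - x ^ 3 ≤ x := by have : 0 ≤ x ^ 3 := by positivity
                                linarith
  have h4 := tan_le_add_cube h2 (h3.trans h1)
  have h5 : (x - x ^ 3) ^ 3 ≤ x ^ 3 := pow_le_pow_left₀ h2 h3 3
  have h6 : Real.arctan (Real.tan (x - x ^ 3)) = x - x ^ 3 :=
    Real.arctan_tan (by linarith [Real.pi_gt_three]) (by linarith [Real.pi_gt_three])
  rw [← h6]
  exact Real.arctan_strictMono.monotone (by linarith)

theorem abs_arctan_mul_tan_sub_le {t x : ℝ} (ht : |t| ≤ 1) (hx : |x| ≤ 1 / 2) :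
    |Real.arctan (t * Real.tan x) - t * x| ≤ 2 * |t| * |x| ^ 3 := by
  have key : ∀ t x : ℝ, 0 ≤ t → t ≤ 1 → 0 ≤ x → x ≤ 1 / 2 →
      |Real.arctan (t * Real.tan x) - t * x| ≤ 2 * t * x ^ 3 := fun t x t0 t1 x0 x1 => by
    have h1 := tan_le_add_cube x0 (by linarith)
    have h2 : x ≤ Real.tan x := Real.le_tan x0 (by linarith [Real.pi_gt_three])
    have h3 : x ^ 2 ≤ (1 / 2) ^ 2 := pow_le_pow_left₀ x0 x1 2
    have h4 : Real.tan x ≤ 5 / 4 * x := by nlinarith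
    have y0 : 0 ≤ t * Real.tan x := mul_nonneg t0 (x0.trans h2)
    have y1 : t * Real.tan x ≤ 1 := mul_le_one₀ t1 (x0.trans h2) (by linarith)
    have h5 := arctan_le_self_of_nonneg y0
    have h6 := sub_cube_le_arctan y0 y1
    have h7 : (t * Real.tan x) ^ 3 ≤ 2 * t * x ^ 3 := by
      calc (t * Real.tan x) ^ 3 ≤ (t * (5 / 4 * x)) ^ 3 := by gcongr
        _ = t ^ 2 * (t * ((125 / 64) * x ^ 3)) := by ring
        _ ≤ 1 * (t * ((125 / 64) * x ^ 3)) := by gcongr; exact pow_le_one₀ t0 t1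
        _ ≤ 2 * t * x ^ 3 := by nlinarith [mul_nonneg t0 (pow_nonneg x0 3)]
    have h8 : t * Real.tan x ≤ t * (x + x ^ 3) := mul_le_mul_of_nonneg_left h1 t0
    have h9 : t * x ≤ t * Real.tan x := mul_le_mul_of_nonneg_left h2 t0
    have h10 : 0 ≤ t * x ^ 3 := by positivity
    rw [abs_le]
    constructor <;> nlinarith
  have e := key |t| |x| (abs_nonneg _) ht (abs_nonneg _) hx
  rcases abs_choice t with h | h <;> rcases abs_choice x with h' | h' <;>
    rw [h, h'] at e ⊢
  · exact e
  · rw [← abs_neg]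
    simp only [Real.tan_neg, mul_neg, Real.arctan_neg] at e
    convert e using 2; ring
  · rw [← abs_neg]
    simp only [neg_mul, Real.arctan_neg] at e
    convert e using 2
    · ring
  · simp only [Real.tan_neg, mul_neg, neg_mul, neg_neg] at e ⊢
    exact e

theorem abs_tanh_sub_le (x : ℝ) : |Real.tanh x - x| ≤ |x| ^ 3 := by
  have key : ∀ x : ℝ, 0 ≤ x → |Real.tanh x - x| ≤ x ^ 3 := fun x h0 => by
    have hc := Real.cosh_pos x
    have hmono : MonotoneOn (fun y => y * Real.cosh y - Real.sinh y) (Set.Ici 0) := by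
      refine monotoneOn_of_deriv_nonneg (convex_Ici 0) (by fun_prop) (by fun_prop) fun y hy => ?_
      rw [interior_Ici] at hy
      have hd : HasDerivAt (fun y => y * Real.cosh y - Real.sinh y)
          (1 * Real.cosh y + y * Real.sinh y - Real.cosh y) y :=
        ((hasDerivAt_id y).mul (Real.hasDerivAt_cosh y)).sub (Real.hasDerivAt_sinh y)
      rw [hd.deriv]
      have := mul_nonneg (le_of_lt hy) (Real.sinh_nonneg_iff.mpr (le_of_lt hy))
      linarith
    have h1 := hmono Set.self_mem_Ici h0 h0
    simp only [Real.sinh_zero, zero_mul, sub_zero] at h1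
    have h2 : Real.tanh x ≤ x := by
      rw [Real.tanh_eq_sinh_div_cosh, div_le_iff₀ hc]; linarith
    have h3 : x - x ^ 3 ≤ Real.tanh x := by
      rw [Real.tanh_eq_sinh_div_cosh, le_div_iff₀ hc]
      have h4 : (1 - x ^ 2) * Real.cosh x ≤ 1 := by
        rcases le_total (1 - x ^ 2) 0 with h | h
        · nlinarith
        · have := one_sub_sq_mul_cosh_sq_le x
          nlinarith [Real.one_le_cosh x]
      have h5 := Real.self_le_sinh_iff.mpr h0
      calc (x - x ^ 3) * Real.cosh x = x * ((1 - x ^ 2) * Real.cosh x) := by ring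
        _ ≤ x * 1 := by gcongr
        _ ≤ Real.sinh x := by linarith
    rw [abs_le]
    constructor <;> linarith
  have e := key |x| (abs_nonneg _)
  rcases abs_choice x with h | h <;> rw [h] at e ⊢
  · exact e
  · rw [Real.tanh_neg] at e
    rw [← abs_neg]; convert e using 2; ring

theorem abs_tanh_le (x : ℝ) : |Real.tanh x| ≤ |x| := by
  rw [Real.tanh_eq_sinh_div_cosh, abs_div, abs_of_pos (Real.cosh_pos x),
    div_le_iff₀ (Real.cosh_pos x)]
  have key : ∀ x : ℝ, 0 ≤ x → Real.sinh x ≤ x * Real.cosh x := fun x h0 => by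
    have hmono : MonotoneOn (fun y => y * Real.cosh y - Real.sinh y) (Set.Ici 0) := by
      refine monotoneOn_of_deriv_nonneg (convex_Ici 0) (by fun_prop) (by fun_prop) fun y hy => ?_
      rw [interior_Ici] at hy
      have hd : HasDerivAt (fun y => y * Real.cosh y - Real.sinh y)
          (1 * Real.cosh y + y * Real.sinh y - Real.cosh y) y :=
        ((hasDerivAt_id y).mul (Real.hasDerivAt_cosh y)).sub (Real.hasDerivAt_sinh y)
      rw [hd.deriv]
      have := mul_nonneg (le_of_lt hy) (Real.sinh_nonneg_iff.mpr (le_of_lt hy))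
      linarith
    have h1 := hmono Set.self_mem_Ici h0 h0
    simp only [Real.sinh_zero, zero_mul, sub_zero] at h1
    linarith
  have e := key |x| (abs_nonneg _)
  rw [← Real.cosh_abs, Real.abs_sinh]
  exact e

/-- The deviation of the argument of `cosh (β + i x)` from its linear part, `t = tanh β`. -/
noncomputable def phaseErr (t x : ℝ) : ℝ :=
  if |x| ≤ 1 / 2 then Real.arctan (t * Real.tan x) - t * x else 0

theorem phaseErr_neg (t x : ℝ) : phaseErr t (-x) = -phaseErr t x := by
  unfold phaseErr
  rw [abs_neg]
  split_ifs
  · rw [Real.tan_neg, mul_neg, Real.arctan_neg]; ring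
  · simp

theorem abs_phaseErr_le {t : ℝ} (ht : |t| ≤ 1) (x : ℝ) : |phaseErr t x| ≤ 2 * |t| * |x| ^ 3 := by
  unfold phaseErr
  split_ifs with h
  · exact abs_arctan_mul_tan_sub_le ht h
  · rw [abs_zero]; positivity

theorem abs_phaseErr_le_one {t : ℝ} (ht : |t| ≤ 1) (x : ℝ) : |phaseErr t x| ≤ 1 := by
  by_cases h : |x| ≤ 1 / 2
  · refine (abs_phaseErr_le ht x).trans ?_
    calc 2 * |t| * |x| ^ 3 ≤ 2 * 1 * (1 / 2) ^ 3 := by gcongr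
      _ ≤ 1 := by norm_num
  · rw [phaseErr, if_neg h, abs_zero]; norm_num

theorem measurable_phaseErr (t : ℝ) : Measurable (phaseErr t) := by
  unfold phaseErr
  have h : Measurable Real.tan := by
    have : Real.tan = fun x => Real.sin x / Real.cos x := funext Real.tan_eq_sin_div_cos
    rw [this]
    exact Real.measurable_sin.div Real.measurable_cos
  refine Measurable.ite (measurableSet_le measurable_id.abs measurable_const) ?_ measurable_const
  exact (Real.measurable_arctan.comp (h.const_mul t)).sub (measurable_id.const_mul t)

theorem cosh_div_eq {β x : ℝ} (hx : |x| ≤ 1 / 2) :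
    Complex.cosh ((β : ℂ) + x * Complex.I) / Complex.cosh (β : ℂ)
      = ‖Complex.cosh ((β : ℂ) + x * Complex.I) / Complex.cosh (β : ℂ)‖
        * Complex.exp ((phaseErr (Real.tanh β) x + Real.tanh β * x : ℝ) * Complex.I) := by
  have hc : 0 < Real.cos x := by
    have := abs_le.mp hx
    exact Real.cos_pos_of_mem_Ioo ⟨by linarith [Real.pi_gt_three], by linarith [Real.pi_gt_three]⟩
  have hβ := Real.cosh_pos β
  have e1 : Complex.cosh ((β : ℂ) + x * Complex.I) / Complex.cosh (β : ℂ)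
      = (Real.cos x : ℂ) * (1 + (Real.tanh β * Real.tan x : ℝ) * Complex.I) := by
    rw [Complex.cosh_add, Complex.cosh_mul_I, Complex.sinh_mul_I, ← Complex.ofReal_cosh,
      ← Complex.ofReal_sinh, ← Complex.ofReal_cos, ← Complex.ofReal_sin,
      Real.tanh_eq_sinh_div_cosh, Real.tan_eq_sin_div_cos]
    have h1 : Complex.cosh (β : ℂ) ≠ 0 := by
      rw [← Complex.ofReal_cosh]; exact_mod_cast hβ.ne'
    have h2 : Complex.cos (x : ℂ) ≠ 0 := by
      rw [← Complex.ofReal_cos]; exact_mod_cast hc.ne'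
    push_cast
    field_simp
  have e2 : phaseErr (Real.tanh β) x + Real.tanh β * x
      = Real.arctan (Real.tanh β * Real.tan x) := by
    rw [phaseErr, if_pos hx]; ring
  rw [e2, e1]
  set y := Real.tanh β * Real.tan x
  have e3 : (1 + (y : ℂ) * Complex.I) = (√(1 + y ^ 2) : ℝ) * Complex.exp (Real.arctan y * Complex.I) := by
    have hs : 0 < √(1 + y ^ 2) := Real.sqrt_pos.mpr (by positivity)
    rw [Complex.exp_mul_I, ← Complex.ofReal_cos, ← Complex.ofReal_sin, Real.cos_arctan,
      Real.sin_arctan]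
    have h1 : ((√(1 + y ^ 2) : ℝ) : ℂ) ≠ 0 := by exact_mod_cast hs.ne'
    push_cast
    field_simp
  rw [e3, norm_mul, norm_mul, Complex.norm_exp_ofReal_mul_I, mul_one, Complex.norm_real,
    Complex.norm_real, Real.norm_of_nonneg hc.le, Real.norm_of_nonneg (Real.sqrt_nonneg _)]
  push_cast
  ring

/-- The discrepancy between `s` and the linear part of the argument of the tilted
characteristic function. -/
noncomputable def drift {N : ℕ} (b : Fin N → ℝ) (s : Fin N → ℤ) (j : Fin N) : ℝ :=
  s j - ∑ e : Edge N, Real.tanh (b e.1.1 + b e.1.2) * inc e j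

/-- The sum of the nonlinear parts of the arguments of the factors of `charFn`. -/
noncomputable def cubicPhase {N : ℕ} (b : Fin N → ℝ) (θ : Fin N → ℝ) : ℝ :=
  ∑ e : Edge N, phaseErr (Real.tanh (b e.1.1 + b e.1.2)) (θ e.1.1 + θ e.1.2)

theorem sum_drift_mul {N : ℕ} (b : Fin N → ℝ) (s : Fin N → ℤ) (θ : Fin N → ℝ) :
    ∑ j, drift b s j * θ j = ∑ j, (s j : ℝ) * θ j
      - ∑ e : Edge N, Real.tanh (b e.1.1 + b e.1.2) * (θ e.1.1 + θ e.1.2) := by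
  simp only [drift, sub_mul, Finset.sum_sub_distrib, Finset.sum_mul]
  rw [Finset.sum_comm]
  congr 1
  refine Finset.sum_congr rfl fun e _ => ?_
  rw [← sum_mul_inc e θ, Finset.mul_sum]
  exact Finset.sum_congr rfl fun v _ => by ring

theorem charFn_eq_norm_mul_exp {N : ℕ} (b : Fin N → ℝ) (s : Fin N → ℤ) {θ : Fin N → ℝ}
    (hθ : ∀ j, |θ j| ≤ 1 / 4) :
    charFn b s θ = ‖charFn b s θ‖
      * Complex.exp ((cubicPhase b θ - ∑ j, drift b s j * θ j : ℝ) * Complex.I) := by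
  have h : ∀ e : Edge N, |θ e.1.1 + θ e.1.2| ≤ 1 / 2 := fun e =>
    (abs_add_le _ _).trans (by linarith [hθ e.1.1, hθ e.1.2])
  rw [norm_charFn]
  conv_lhs => rw [charFn]
  rw [Finset.prod_congr rfl fun e _ => cosh_div_eq (β := b e.1.1 + b e.1.2) (h e),
    Finset.prod_mul_distrib, ← Complex.exp_sum, mul_assoc, ← Complex.exp_add]
  have h2 : cubicPhase b θ - ∑ j, drift b s j * θ j
      = ∑ e : Edge N, (phaseErr (Real.tanh (b e.1.1 + b e.1.2)) (θ e.1.1 + θ e.1.2)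
        + Real.tanh (b e.1.1 + b e.1.2) * (θ e.1.1 + θ e.1.2)) + -∑ j, (s j : ℝ) * θ j := by
    rw [sum_drift_mul, cubicPhase, Finset.sum_add_distrib]; ring
  rw [h2]
  simp only [Complex.ofReal_add, Complex.ofReal_sum, add_mul, Finset.sum_mul, Complex.ofReal_neg,
    Complex.ofReal_prod]

theorem sub_sq_div_two_le_re_charFn {N : ℕ} (b : Fin N → ℝ) (s : Fin N → ℤ) {θ : Fin N → ℝ}
    (hθ : ∀ j, |θ j| ≤ 1 / 4) :
    ‖charFn b s θ‖ - ‖charFn b s θ‖ * (cubicPhase b θ - ∑ j, drift b s j * θ j) ^ 2 / 2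
      ≤ (charFn b s θ).re := by
  conv_rhs => rw [charFn_eq_norm_mul_exp b s hθ]
  rw [Complex.re_ofReal_mul, Complex.exp_ofReal_mul_I_re]
  have := Real.one_sub_sq_div_two_le_cos (x := cubicPhase b θ - ∑ j, drift b s j * θ j)
  nlinarith [norm_nonneg (charFn b s θ)]

/-- A lower bound for the modulus of the characteristic function, cut off away from `0`. -/
noncomputable def cosProd {N : ℕ} (θ : Fin N → ℝ) : ℝ :=
  if ∀ j, |θ j| ≤ 1 / 4 then ∏ e : Edge N, |Real.cos (θ e.1.1 + θ e.1.2)| else 0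

theorem cosProd_le_norm_charFn {N : ℕ} (b : Fin N → ℝ) (s : Fin N → ℤ) (θ : Fin N → ℝ) :
    cosProd θ ≤ ‖charFn b s θ‖ := by
  unfold cosProd
  split_ifs with h
  · rw [norm_charFn]
    exact Finset.prod_le_prod (fun _ _ => abs_nonneg _) fun e _ => abs_cos_le_norm_cosh_div _ _
  · exact norm_nonneg _

theorem re_charFn_ge {N : ℕ} (hN : 16 ≤ N) {b : Fin N → ℝ} (hb : ∀ j, |b j| ≤ 1 / 4) {B : ℝ}
    (hB : ∑ j, b j ^ 2 ≤ B) (s : Fin N → ℤ) (θ : Fin N → ℝ) :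
    cosProd θ - 2 * farBound B b θ - nearConst B
      * ((cubicPhase b θ ^ 2 + (∑ j, drift b s j * θ j) ^ 2) * ∏ j, nearFactor b j (θ j))
      ≤ (charFn b s θ).re := by
  have hf := farBound_nonneg B b θ
  have h1 := cosProd_le_norm_charFn b s θ
  have hp : 0 ≤ ∏ j, nearFactor b j (θ j) := Finset.prod_nonneg fun j _ => nearFactor_nonneg b j _
  have hC : 0 ≤ nearConst B := (Real.exp_pos _).le
  have h0 : 0 ≤ cubicPhase b θ ^ 2 + (∑ j, drift b s j * θ j) ^ 2 := by positivity
  by_cases hθ : θ ∈ nearSet N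
  · have h2 := sub_sq_div_two_le_re_charFn b s hθ.2
    have h3 := norm_charFn_le_of_mem_nearSet hB s hθ.1
    have h4 : (cubicPhase b θ - ∑ j, drift b s j * θ j) ^ 2 / 2
        ≤ cubicPhase b θ ^ 2 + (∑ j, drift b s j * θ j) ^ 2 := by
      nlinarith [sq_nonneg (cubicPhase b θ + ∑ j, drift b s j * θ j)]
    have h5 : ‖charFn b s θ‖ * (cubicPhase b θ - ∑ j, drift b s j * θ j) ^ 2 / 2
        ≤ (nearConst B * ∏ j, nearFactor b j (θ j))
          * (cubicPhase b θ ^ 2 + (∑ j, drift b s j * θ j) ^ 2) := by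
      rw [mul_div_assoc]
      exact mul_le_mul h3 h4 (by positivity) (by positivity)
    nlinarith
  · have h2 := norm_charFn_le_farBound hN hb hB s hθ
    have h3 := (abs_le.mp (Complex.abs_re_le_norm (charFn b s θ))).1
    have : 0 ≤ nearConst B
      * ((cubicPhase b θ ^ 2 + (∑ j, drift b s j * θ j) ^ 2) * ∏ j, nearFactor b j (θ j)) := by
      positivity
    linarith

theorem sum_inc_mul {N : ℕ} (b : Fin N → ℝ) (j : Fin N) :
    ∑ e : Edge N, (b e.1.1 + b e.1.2) * inc e j = (N - 2) * b j + ∑ k, b k := by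
  have h := sum_edge_symm (N := N)
    (fun i k => (b i + b k) * ((if i = j then 1 else 0) + (if k = j then 1 else 0)))
    (fun i k => by ring)
  have h2 : ∀ e : Edge N, (b e.1.1 + b e.1.2) * (inc e j : ℝ) = (b e.1.1 + b e.1.2)
    * ((if e.1.1 = j then 1 else 0) + (if e.1.2 = j then 1 else 0)) := fun e => by
      simp [inc]
  rw [Finset.sum_congr rfl fun e _ => h2 e, h]
  have h3 : ∀ f : Fin N → Fin N → ℝ, ∑ i, ∑ k, (if i = j then f i k else 0) = ∑ k, f j k :=
    fun f => by rw [Finset.sum_comm]; simp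
  simp only [mul_add, Finset.sum_add_distrib, mul_ite, mul_one, mul_zero, h3,
    Finset.sum_ite_eq', Finset.mem_univ, if_true, Finset.sum_const, Finset.card_univ,
    Fintype.card_fin, nsmul_eq_mul]
  ring

theorem inc_nonneg {N : ℕ} (e : Edge N) (j : Fin N) : 0 ≤ inc e j := by
  unfold inc; split_ifs <;> norm_num

theorem sum_drift_sq_le {N : ℕ} {b : Fin N → ℝ} {s : Fin N → ℤ}
    (hs : ∀ j, (s j : ℝ) = N * b j + ∑ k, b k) :
    ∑ j, drift b s j ^ 2 ≤ 8 * ∑ j, b j ^ 2 + 128 * (N ^ 2 * ∑ j, b j ^ 6) := by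
  have e1 : ∀ j, drift b s j = 2 * b j + ∑ e : Edge N,
      (b e.1.1 + b e.1.2 - Real.tanh (b e.1.1 + b e.1.2)) * inc e j := fun j => by
    have := sum_inc_mul b j
    rw [drift, hs]
    simp only [sub_mul, Finset.sum_sub_distrib]
    rw [this]; ring
  have e2 : ∀ j, drift b s j ^ 2 ≤ 8 * b j ^ 2
      + 2 * (N * ∑ e : Edge N, (b e.1.1 + b e.1.2) ^ 6 * (inc e j : ℝ)) := fun j => by
    have h1 : (∑ e : Edge N, (b e.1.1 + b e.1.2 - Real.tanh (b e.1.1 + b e.1.2)) * inc e j) ^ 2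
        ≤ N * ∑ e : Edge N, (b e.1.1 + b e.1.2) ^ 6 * (inc e j : ℝ) := by
      have hcs := Finset.sum_mul_sq_le_sq_mul_sq (Finset.univ : Finset (Edge N))
        (fun e => √(inc e j : ℝ))
        (fun e => (b e.1.1 + b e.1.2 - Real.tanh (b e.1.1 + b e.1.2)) * √(inc e j : ℝ))
      have hi : ∀ e : Edge N, (0 : ℝ) ≤ inc e j := fun e => by exact_mod_cast inc_nonneg e j
      have h2 : ∑ e : Edge N, √(inc e j : ℝ) ^ 2 ≤ N := by
        simp only [fun e => Real.sq_sqrt (hi e)]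
        have := sum_inc (N := N) j
        have h3 : (∑ e : Edge N, (inc e j : ℝ)) = N - 1 := by exact_mod_cast this
        linarith
      have h3 : ∀ e : Edge N,
          ((b e.1.1 + b e.1.2 - Real.tanh (b e.1.1 + b e.1.2)) * √(inc e j : ℝ)) ^ 2
            ≤ (b e.1.1 + b e.1.2) ^ 6 * (inc e j : ℝ) := fun e => by
        rw [mul_pow, Real.sq_sqrt (hi e)]
        refine mul_le_mul_of_nonneg_right ?_ (hi e)
        have := abs_tanh_sub_le (b e.1.1 + b e.1.2)
        rw [abs_sub_comm] at this
        have h4 := pow_le_pow_left₀ (abs_nonneg _) this 2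
        rw [sq_abs, ← pow_mul, Even.pow_abs (by decide)] at h4
        exact h4
      have h5 : ∀ e : Edge N, √(inc e j : ℝ)
          * ((b e.1.1 + b e.1.2 - Real.tanh (b e.1.1 + b e.1.2)) * √(inc e j : ℝ))
          = (b e.1.1 + b e.1.2 - Real.tanh (b e.1.1 + b e.1.2)) * inc e j := fun e => by
        rw [mul_left_comm, Real.mul_self_sqrt (hi e)]
      simp only [h5] at hcs
      refine hcs.trans (mul_le_mul h2 (Finset.sum_le_sum fun e _ => h3 e)
        (Finset.sum_nonneg fun e _ => sq_nonneg _) (Nat.cast_nonneg N))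
    rw [e1 j]
    refine add_sq_le.trans ?_
    nlinarith
  refine (Finset.sum_le_sum fun j _ => e2 j).trans ?_
  rw [Finset.sum_add_distrib, ← Finset.mul_sum, ← Finset.mul_sum, ← Finset.mul_sum,
    Finset.sum_comm]
  have e3 : ∀ e : Edge N, ∑ j, (b e.1.1 + b e.1.2) ^ 6 * (inc e j : ℝ)
      ≤ 64 * (b e.1.1 ^ 6 + b e.1.2 ^ 6) := fun e => by
    have h := sum_mul_inc e fun _ => (b e.1.1 + b e.1.2) ^ 6
    rw [h]
    have := Even.add_pow_le (n := 6) (a := b e.1.1) (b := b e.1.2) (by decide)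
    norm_num at this
    linarith
  have e4 : ∑ e : Edge N, ∑ j, (b e.1.1 + b e.1.2) ^ 6 * (inc e j : ℝ) ≤ 64 * (N * ∑ j, b j ^ 6) := by
    refine (Finset.sum_le_sum fun e _ => e3 e).trans ?_
    rw [← Finset.mul_sum]
    exact mul_le_mul_of_nonneg_left (sum_edge_add_le (fun j => b j ^ 6) fun j => by positivity) (by norm_num)
  have := mul_le_mul_of_nonneg_left e4 (Nat.cast_nonneg N : (0 : ℝ) ≤ N)
  nlinarith

/-- Change the sign of the coordinates in `T`. -/
def flipSign {N : ℕ} (T : Finset (Fin N)) (θ : Fin N → ℝ) (j : Fin N) : ℝ :=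
  if j ∈ T then -θ j else θ j

theorem measurePreserving_flipSign {N : ℕ} (T : Finset (Fin N)) :
    MeasurePreserving (flipSign T) (boxMeasure N) (boxMeasure N) := by
  have h : boxMeasure N = Measure.pi fun j : Fin N =>
      volume.restrict (Set.Icc (-boxLen j) (boxLen j)) := by
    unfold boxMeasure
    congr 1
    ext1 j
    exact Measure.restrict_congr_set Ioc_ae_eq_Icc
  have h2 : flipSign T = fun (θ : Fin N → ℝ) j => (fun x => if j ∈ T then -x else x) (θ j) := rfl
  rw [h, h2]
  refine measurePreserving_pi (fun j : Fin N => volume.restrict (Set.Icc (-boxLen j) (boxLen j)))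
    (fun j : Fin N => volume.restrict (Set.Icc (-boxLen j) (boxLen j)))
    (f := fun j x => if j ∈ T then -x else x) fun j => ?_
  by_cases hj : j ∈ T
  · simp only [hj, if_true]
    have := (Measure.measurePreserving_neg (volume : Measure ℝ)).restrict_preimage
      (measurableSet_Icc (a := -boxLen j) (b := boxLen j))
    convert this using 2
    rw [Set.neg_preimage, Set.neg_Icc, neg_neg]
  · simp only [hj, if_false]
    exact MeasurePreserving.id _

theorem integral_eq_zero_of_flipSign {N : ℕ} (T : Finset (Fin N)) {F : (Fin N → ℝ) → ℝ}
    (hm : Measurable F) (hF : ∀ θ, F (flipSign T θ) = -F θ) : ∫ θ, F θ ∂boxMeasure N = 0 := by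
  have h := measurePreserving_flipSign T
  have h1 := integral_map (μ := boxMeasure N) h.measurable.aemeasurable (f := F) hm.aestronglyMeasurable
  rw [h.map_eq] at h1
  simp only [hF, integral_neg] at h1
  linarith

theorem nearFactor_neg {N : ℕ} (b : Fin N → ℝ) (j : Fin N) (x : ℝ) :
    nearFactor b j (-x) = nearFactor b j x := by
  unfold nearFactor; rw [Real.sin_neg, neg_sq]

theorem prod_nearFactor_flipSign {N : ℕ} (b : Fin N → ℝ) (T : Finset (Fin N)) (θ : Fin N → ℝ) :
    ∏ j, nearFactor b j (flipSign T θ j) = ∏ j, nearFactor b j (θ j) := by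
  refine Finset.prod_congr rfl fun j _ => ?_
  unfold flipSign
  split_ifs
  · exact nearFactor_neg b j _
  · rfl

theorem measurable_phaseErr_edge {N : ℕ} (t : ℝ) (e : Edge N) :
    Measurable fun θ : Fin N → ℝ => phaseErr t (θ e.1.1 + θ e.1.2) :=
  (measurable_phaseErr t).comp (by fun_prop)

theorem abs_tanh_le_one (x : ℝ) : |Real.tanh x| ≤ 1 := by
  rw [Real.tanh_eq_sinh_div_cosh, abs_div, abs_of_pos (Real.cosh_pos x),
    div_le_one (Real.cosh_pos x), abs_le]
  have h1 := Real.cosh_add_sinh x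
  have h2 := Real.cosh_sub_sinh x
  constructor <;> linarith [Real.exp_pos x, Real.exp_pos (-x)]

theorem integrable_phaseErr_mul {N : ℕ} (b : Fin N → ℝ) {t t' : ℝ} (ht : |t| ≤ 1) (ht' : |t'| ≤ 1)
    (e e' : Edge N) : Integrable (fun θ : Fin N → ℝ => phaseErr t (θ e.1.1 + θ e.1.2)
      * phaseErr t' (θ e'.1.1 + θ e'.1.2) * ∏ j, nearFactor b j (θ j)) (boxMeasure N) := by
  have c1 : Continuous fun θ : Fin N → ℝ => ∏ j, nearFactor b j (θ j) := by
    unfold nearFactor; fun_prop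
  refine (integrable_boxMeasure c1).mono' (((measurable_phaseErr_edge t e).mul
    (measurable_phaseErr_edge t' e')).mul c1.measurable).aestronglyMeasurable
    (Filter.Eventually.of_forall fun θ => ?_)
  have hp : 0 ≤ ∏ j, nearFactor b j (θ j) := Finset.prod_nonneg fun j _ => nearFactor_nonneg b j _
  rw [norm_mul, norm_mul, Real.norm_of_nonneg hp]
  refine mul_le_of_le_one_left hp (mul_le_one₀ ?_ (norm_nonneg _) ?_)
  · exact abs_phaseErr_le_one ht _
  · exact abs_phaseErr_le_one ht' _

theorem integral_phaseErr_mul_le {N : ℕ} (b : Fin N → ℝ) {t t' : ℝ} (ht : |t| ≤ 1) (ht' : |t'| ≤ 1)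
    (e e' : Edge N) :
    ∫ θ, phaseErr t (θ e.1.1 + θ e.1.2) * phaseErr t' (θ e'.1.1 + θ e'.1.2)
        * ∏ j, nearFactor b j (θ j) ∂boxMeasure N
      ≤ (∑ v, (inc e v : ℝ) * inc e' v) * (
        ((∫ θ, phaseErr t (θ e.1.1 + θ e.1.2) ^ 2 * ∏ j, nearFactor b j (θ j) ∂boxMeasure N)
        + ∫ θ, phaseErr t' (θ e'.1.1 + θ e'.1.2) ^ 2 * ∏ j, nearFactor b j (θ j) ∂boxMeasure N)
          / 2) := by
  have c1 : Continuous fun θ : Fin N → ℝ => ∏ j, nearFactor b j (θ j) := by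
    unfold nearFactor; fun_prop
  have hp : ∀ θ : Fin N → ℝ, 0 ≤ ∏ j, nearFactor b j (θ j) := fun θ =>
    Finset.prod_nonneg fun j _ => nearFactor_nonneg b j _
  have hI : ∀ t (e : Edge N), 0 ≤ ∫ θ, phaseErr t (θ e.1.1 + θ e.1.2) ^ 2
      * ∏ j, nearFactor b j (θ j) ∂boxMeasure N := fun t e =>
    integral_nonneg fun θ => mul_nonneg (sq_nonneg _) (hp θ)
  have hi : ∀ (e : Edge N) v, (0 : ℝ) ≤ inc e v := fun e v => by exact_mod_cast inc_nonneg e v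
  by_cases hd : e'.1.1 ∉ ({e.1.1, e.1.2} : Finset (Fin N)) ∧ e'.1.2 ∉ ({e.1.1, e.1.2} : Finset (Fin N))
  · rw [integral_eq_zero_of_flipSign {e.1.1, e.1.2} (F := fun θ => phaseErr t (θ e.1.1 + θ e.1.2)
      * phaseErr t' (θ e'.1.1 + θ e'.1.2) * ∏ j, nearFactor b j (θ j))
      (((measurable_phaseErr_edge t e).mul
      (measurable_phaseErr_edge t' e')).mul c1.measurable) fun θ => ?_]
    · have := hI t e
      have := hI t' e'
      exact mul_nonneg (Finset.sum_nonneg fun v _ => mul_nonneg (hi e v) (hi e' v)) (by positivity)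
    · rw [prod_nearFactor_flipSign]
      simp only [flipSign, hd.1, hd.2, if_false, Finset.mem_insert, Finset.mem_singleton, true_or,
        or_true, if_true]
      rw [← neg_add, phaseErr_neg]
      ring
  · have h1 : 1 ≤ ∑ v, (inc e v : ℝ) * inc e' v := by
      have key : ∃ v, 1 ≤ inc e v * inc e' v := by
        rw [not_and_or, not_not, not_not] at hd
        rcases hd with h | h
        · refine ⟨e'.1.1, ?_⟩
          simp only [Finset.mem_insert, Finset.mem_singleton] at h
          have h2 : 1 ≤ inc e e'.1.1 := by
            rcases h with h | h <;> rw [h] <;> unfold inc <;> split_ifs <;> simp_all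
          have h3 : 1 ≤ inc e' e'.1.1 := by unfold inc; split_ifs <;> simp_all
          nlinarith
        · refine ⟨e'.1.2, ?_⟩
          simp only [Finset.mem_insert, Finset.mem_singleton] at h
          have h2 : 1 ≤ inc e e'.1.2 := by
            rcases h with h | h <;> rw [h] <;> unfold inc <;> split_ifs <;> simp_all
          have h3 : 1 ≤ inc e' e'.1.2 := by unfold inc; split_ifs <;> simp_all
          nlinarith
      obtain ⟨v, hv⟩ := key
      have h4 : (1 : ℝ) ≤ (inc e v : ℝ) * inc e' v := by exact_mod_cast hv
      exact h4.trans (Finset.single_le_sum (f := fun v => (inc e v : ℝ) * inc e' v)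
        (fun v _ => mul_nonneg (hi e v) (hi e' v)) (Finset.mem_univ v))
    refine le_trans ?_ (le_mul_of_one_le_left (by linarith [hI t e, hI t' e']) h1)
    have i1 := integrable_phaseErr_mul b ht ht e e
    have i2 := integrable_phaseErr_mul b ht' ht' e' e'
    simp only [← sq] at i1 i2
    rw [← integral_add i1 i2, ← integral_div]
    refine integral_mono (integrable_phaseErr_mul b ht ht' e e') ((i1.add i2).div_const 2) fun θ => ?_
    rw [← add_mul, mul_div_right_comm]
    refine mul_le_mul_of_nonneg_right ?_ (hp θ)
    nlinarith [sq_nonneg (phaseErr t (θ e.1.1 + θ e.1.2) - phaseErr t' (θ e'.1.1 + θ e'.1.2))]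

theorem integral_phaseErr_sq_le {N : ℕ} (hN : 0 < N) {b : Fin N → ℝ} (hb : ∀ j, |b j| ≤ 1 / 4)
    {B : ℝ} (hB : ∑ j, b j ^ 2 ≤ B) {t : ℝ} (ht : |t| ≤ 1) (e : Edge N) :
    ∫ θ, phaseErr t (θ e.1.1 + θ e.1.2) ^ 2 * ∏ j, nearFactor b j (θ j) ∂boxMeasure N
      ≤ t ^ 2 * (256 * (√(2 * Real.pi / N) ^ N * Real.exp (4 * B + 320) * (18 * (14 / N) ^ 3))) := by
  have hp : ∀ θ : Fin N → ℝ, 0 ≤ ∏ j, nearFactor b j (θ j) := fun θ =>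
    Finset.prod_nonneg fun j _ => nearFactor_nonneg b j _
  have i1 := integrable_phaseErr_mul b ht ht e e
  simp only [← sq] at i1
  have c : ∀ i : Fin N, Integrable (fun θ : Fin N → ℝ => θ i ^ (2 * 3) * ∏ j, nearFactor b j (θ j))
      (boxMeasure N) := fun i => integrable_boxMeasure (by unfold nearFactor; fun_prop)
  have h1 : ∀ θ : Fin N → ℝ, phaseErr t (θ e.1.1 + θ e.1.2) ^ 2 * ∏ j, nearFactor b j (θ j)
      ≤ t ^ 2 * (128 * (θ e.1.1 ^ (2 * 3) * ∏ j, nearFactor b j (θ j)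
        + θ e.1.2 ^ (2 * 3) * ∏ j, nearFactor b j (θ j))) := fun θ => by
    rw [← add_mul, ← mul_assoc, ← mul_assoc]
    refine mul_le_mul_of_nonneg_right ?_ (hp θ)
    have h := pow_le_pow_left₀ (abs_nonneg _) (abs_phaseErr_le ht (θ e.1.1 + θ e.1.2)) 2
    rw [sq_abs, mul_pow, mul_pow, sq_abs, ← pow_mul, Even.pow_abs (by decide)] at h
    have h2 := Even.add_pow_le (n := 6) (a := θ e.1.1) (b := θ e.1.2) (by decide)
    norm_num at h h2 ⊢
    nlinarith [sq_nonneg t]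
  refine (integral_mono i1 (((c e.1.1).add (c e.1.2)).const_mul 128 |>.const_mul _) h1).trans ?_
  simp only [Pi.add_apply]
  rw [integral_const_mul, integral_const_mul, integral_add (c _) (c _)]
  have m1 := integral_pow_mul_prod_nearFactor_le 3 hN hb hB e.1.1
  have m2 := integral_pow_mul_prod_nearFactor_le 3 hN hb hB e.1.2
  have f3 : (3 * (Nat.factorial 3 : ℕ) : ℝ) = 18 := by norm_num [Nat.factorial]
  rw [f3] at m1 m2
  refine mul_le_mul_of_nonneg_left ?_ (sq_nonneg t)
  linarith

theorem integral_cubicPhase_sq_le {N : ℕ} (hN : 0 < N) {b : Fin N → ℝ} (hb : ∀ j, |b j| ≤ 1 / 4)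
    {B : ℝ} (hB : ∑ j, b j ^ 2 ≤ B) :
    Integrable (fun θ => cubicPhase b θ ^ 2 * ∏ j, nearFactor b j (θ j)) (boxMeasure N) ∧
    ∫ θ, cubicPhase b θ ^ 2 * ∏ j, nearFactor b j (θ j) ∂boxMeasure N
      ≤ 4 * B * 256 * Real.exp (4 * B + 320) * 18 * 14 ^ 3 / N * √(2 * Real.pi / N) ^ N := by
  have hN' : (0 : ℝ) < N := by exact_mod_cast hN
  set τ : Edge N → ℝ := fun e => Real.tanh (b e.1.1 + b e.1.2) with hτ
  have hτ1 : ∀ e, |τ e| ≤ 1 := fun e => abs_tanh_le_one _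
  set G : (Fin N → ℝ) → ℝ := fun θ => ∏ j, nearFactor b j (θ j) with hG
  set A : Edge N → (Fin N → ℝ) → ℝ := fun e θ => phaseErr (τ e) (θ e.1.1 + θ e.1.2) with hA
  have hexp : ∀ θ, cubicPhase b θ ^ 2 * G θ = ∑ e, ∑ e', A e θ * A e' θ * G θ := fun θ => by
    rw [cubicPhase, sq, Finset.sum_mul_sum]
    simp only [Finset.sum_mul]
    rfl
  have h_int : ∀ e e', Integrable (fun θ => A e θ * A e' θ * G θ) (boxMeasure N) := fun e e' =>
    integrable_phaseErr_mul b (hτ1 e) (hτ1 e') e e'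
  have hfun : (fun θ => cubicPhase b θ ^ 2 * G θ) = fun θ => ∑ e, ∑ e', A e θ * A e' θ * G θ :=
    funext hexp
  change Integrable (fun θ => cubicPhase b θ ^ 2 * G θ) _ ∧ ∫ θ, cubicPhase b θ ^ 2 * G θ ∂_ ≤ _
  rw [hfun]
  refine ⟨integrable_finsetSum _ fun e _ => integrable_finsetSum _ fun e' _ => h_int e e', ?_⟩
  rw [integral_finsetSum _ fun e _ => integrable_finsetSum _ fun e' _ => h_int e e']
  simp only [fun e => integral_finsetSum (μ := boxMeasure N) Finset.univ
    (f := fun e' θ => A e θ * A e' θ * G θ) fun e' _ => h_int e e']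
  set I : Edge N → ℝ := fun e => ∫ θ, A e θ ^ 2 * G θ ∂boxMeasure N with hI
  have hI0 : ∀ e, 0 ≤ I e := fun e => integral_nonneg fun θ =>
    mul_nonneg (sq_nonneg _) (Finset.prod_nonneg fun j _ => nearFactor_nonneg b j _)
  have s1 : ∑ e, ∑ e', ∫ θ, A e θ * A e' θ * G θ ∂boxMeasure N
      ≤ ∑ e, ∑ e', (∑ v, (inc e v : ℝ) * inc e' v) * ((I e + I e') / 2) :=
    Finset.sum_le_sum fun e _ => Finset.sum_le_sum fun e' _ =>
      integral_phaseErr_mul_le b (hτ1 e) (hτ1 e') e e'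
  have s2 : ∀ e : Edge N, ∑ e', ∑ v, (inc e v : ℝ) * inc e' v = 2 * (N - 1) := fun e => by
    rw [Finset.sum_comm]
    have h2 : ∀ v : Fin N, ∑ e', (inc e v : ℝ) * inc e' v = (N - 1) * inc e v := fun v => by
      rw [← Finset.mul_sum]
      have := sum_inc (N := N) v
      have h3 : (∑ e : Edge N, (inc e v : ℝ)) = N - 1 := by exact_mod_cast this
      rw [h3]; ring
    simp only [h2]
    rw [sum_mul_inc e fun _ => ((N : ℝ) - 1)]
    ring
  have s3 : ∑ e, ∑ e', (∑ v, (inc e v : ℝ) * inc e' v) * ((I e + I e') / 2)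
      = 2 * (N - 1) * ∑ e, I e := by
    have h1 : ∀ e e' : Edge N, (∑ v, (inc e v : ℝ) * inc e' v) * ((I e + I e') / 2)
        = (∑ v, (inc e v : ℝ) * inc e' v) * (I e / 2)
          + (∑ v, (inc e' v : ℝ) * inc e v) * (I e' / 2) := fun e e' => by
      simp only [mul_comm (inc e' _ : ℝ)]; ring
    simp only [h1, Finset.sum_add_distrib]
    rw [Finset.sum_comm (f := fun e e' => (∑ v, (inc e' v : ℝ) * inc e v) * (I e' / 2))]
    simp only [← Finset.sum_mul, s2]
    rw [Finset.mul_sum, ← Finset.sum_add_distrib]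
    exact Finset.sum_congr rfl fun e _ => by ring
  rw [s3] at s1
  refine s1.trans ?_
  set W := 256 * (√(2 * Real.pi / N) ^ N * Real.exp (4 * B + 320) * (18 * (14 / (N : ℝ)) ^ 3)) with hW
  have hW0 : 0 ≤ W := by positivity
  have s4 : ∑ e, I e ≤ (2 * N * B) * W := by
    calc ∑ e, I e ≤ ∑ e : Edge N, (b e.1.1 + b e.1.2) ^ 2 * W := Finset.sum_le_sum fun e _ => by
          refine (integral_phaseErr_sq_le hN hb hB (hτ1 e) e).trans ?_
          refine mul_le_mul_of_nonneg_right ?_ hW0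
          exact sq_le_sq.mpr (abs_tanh_le _)
      _ ≤ (2 * N * B) * W := by
          rw [← Finset.sum_mul, sum_edge_add_sq]
          refine mul_le_mul_of_nonneg_right ?_ hW0
          have h1 : (∑ j, b j) ^ 2 ≤ N * ∑ j, b j ^ 2 := by
            have := sq_sum_le_card_mul_sum_sq (s := (Finset.univ : Finset (Fin N))) (f := b)
            simpa using this
          have h2 : 0 ≤ ∑ j, b j ^ 2 := Finset.sum_nonneg fun j _ => sq_nonneg _
          nlinarith
  have hB0 : 0 ≤ B := le_trans (Finset.sum_nonneg fun j _ => sq_nonneg _) hB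
  calc 2 * (N - 1) * ∑ e, I e ≤ 2 * N * ((2 * N * B) * W) := by
        refine mul_le_mul (by linarith) s4 (Finset.sum_nonneg fun e _ => hI0 e) (by positivity)
    _ = _ := by rw [hW]; field_simp; ring

theorem integral_drift_sq_le {N : ℕ} (hN : 0 < N) {b : Fin N → ℝ} (hb : ∀ j, |b j| ≤ 1 / 4)
    {B : ℝ} (hB : ∑ j, b j ^ 2 ≤ B) (r : Fin N → ℝ) :
    ∫ θ, (∑ j, r j * θ j) ^ 2 * ∏ j, nearFactor b j (θ j) ∂boxMeasure N
      ≤ (∑ j, r j ^ 2) * Real.exp (4 * B + 320) * 42 / N * √(2 * Real.pi / N) ^ N := by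
  have hexp : ∀ θ : Fin N → ℝ, (∑ j, r j * θ j) ^ 2 * ∏ j, nearFactor b j (θ j)
      = ∑ j, ∑ k, r j * r k * (θ j * θ k * ∏ j, nearFactor b j (θ j)) := fun θ => by
    rw [sq, Finset.sum_mul_sum]
    simp only [Finset.sum_mul]
    exact Finset.sum_congr rfl fun j _ => Finset.sum_congr rfl fun k _ => by ring
  simp only [hexp]
  have h_int : ∀ j k, Integrable (fun θ : Fin N → ℝ =>
      r j * r k * (θ j * θ k * ∏ j, nearFactor b j (θ j))) (boxMeasure N) := fun j k =>
    integrable_boxMeasure (by unfold nearFactor; fun_prop)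
  rw [integral_finsetSum _ fun e _ => integrable_finsetSum _ fun e' _ => h_int e e']
  have h1 : ∀ j, ∫ θ : Fin N → ℝ, ∑ k, r j * r k * (θ j * θ k * ∏ j, nearFactor b j (θ j))
        ∂boxMeasure N
      = r j ^ 2 * ∫ θ, θ j ^ (2 * 1) * ∏ j, nearFactor b j (θ j) ∂boxMeasure N := fun j => by
    rw [integral_finsetSum _ fun k _ => h_int j k, Finset.sum_eq_single j]
    · rw [integral_const_mul]
      congr 1
      · ring
      · simp only [mul_one, sq]
    · intro k _ hk
      refine integral_eq_zero_of_flipSign {k} ?_ fun θ => ?_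
      · exact Continuous.measurable (by unfold nearFactor; fun_prop)
      · rw [prod_nearFactor_flipSign]
        have : j ≠ k := hk.symm
        simp only [flipSign, Finset.mem_singleton, this, if_false, if_true]
        ring
    · intro h; exact absurd (Finset.mem_univ j) h
  simp only [h1]
  refine (Finset.sum_le_sum fun j _ => mul_le_mul_of_nonneg_left
    (integral_pow_mul_prod_nearFactor_le 1 hN hb hB j) (sq_nonneg _)).trans (le_of_eq ?_)
  rw [← Finset.sum_mul]
  simp only [Nat.factorial, pow_one]
  push_cast
  ring

theorem exp_neg_le_one_sub {y : ℝ} (h1 : y ≤ 1 / 2) :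
    Real.exp (-(y + 2 * y ^ 2)) ≤ 1 - y := by
  have h2 := Real.add_one_le_exp (y + 2 * y ^ 2)
  rw [Real.exp_neg, inv_le_iff_one_le_mul₀ (Real.exp_pos _)]
  have h3 : 1 ≤ (1 - y) * (y + 2 * y ^ 2 + 1) := by nlinarith [mul_nonneg (sq_nonneg y) (by linarith : 0 ≤ 1 - 2 * y)]
  exact h3.trans (mul_le_mul_of_nonneg_left h2 (by linarith))

theorem exp_neg_le_abs_cos {x : ℝ} (hx : |x| ≤ 1 / 2) :
    Real.exp (-(x ^ 2 / 2 + x ^ 4 / 2)) ≤ |Real.cos x| := by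
  have h1 := Real.one_sub_sq_div_two_le_cos (x := x)
  have h2 : x ^ 2 ≤ (1 / 2) ^ 2 := sq_le_sq' (by linarith [abs_le.mp hx]) (abs_le.mp hx).2
  have h3 := exp_neg_le_one_sub (y := x ^ 2 / 2) (by linarith)
  have h4 : x ^ 2 / 2 + 2 * (x ^ 2 / 2) ^ 2 = x ^ 2 / 2 + x ^ 4 / 2 := by ring
  rw [h4] at h3
  exact h3.trans (h1.trans (le_abs_self _))

/-- The truncated one-dimensional factor bounding `cosProd` from below. -/
noncomputable def cutGauss (N : ℕ) (x : ℝ) : ℝ :=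
  if |x| ≤ 1 / 4 then Real.exp (-(N / 2 * x ^ 2 + 4 * N * x ^ 4)) else 0

theorem cutGauss_nonneg (N : ℕ) (x : ℝ) : 0 ≤ cutGauss N x := by
  unfold cutGauss; split_ifs <;> positivity

theorem cutGauss_neg (N : ℕ) (x : ℝ) : cutGauss N (-x) = cutGauss N x := by
  unfold cutGauss; rw [abs_neg, Even.neg_pow (by decide), Even.neg_pow (by decide)]

theorem measurable_cutGauss (N : ℕ) : Measurable (cutGauss N) := by
  unfold cutGauss
  exact Measurable.ite (measurableSet_le measurable_id.abs measurable_const) (by fun_prop)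
    measurable_const

theorem cutGauss_le (N : ℕ) (x : ℝ) : cutGauss N x ≤ Real.exp (-(N / 2) * x ^ 2) := by
  unfold cutGauss
  split_ifs
  · rw [Real.exp_le_exp]
    have : 0 ≤ 4 * (N : ℝ) * x ^ 4 := by positivity
    linarith
  · positivity

theorem cosProd_ge {N : ℕ} (θ : Fin N → ℝ) :
    Real.exp (-9) * ((10 - (∑ j, θ j) ^ 2 / 2) * ∏ j, cutGauss N (θ j)) ≤ cosProd θ := by
  unfold cosProd
  split_ifs with h
  · have h1 : ∏ e : Edge N, Real.exp (-((θ e.1.1 + θ e.1.2) ^ 2 / 2 + (θ e.1.1 + θ e.1.2) ^ 4 / 2))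
        ≤ ∏ e : Edge N, |Real.cos (θ e.1.1 + θ e.1.2)| :=
      Finset.prod_le_prod (fun _ _ => (Real.exp_pos _).le) fun e _ => exp_neg_le_abs_cos
        ((abs_add_le _ _).trans (by linarith [h e.1.1, h e.1.2]))
    refine le_trans ?_ h1
    rw [← Real.exp_sum]
    have h2 : ∏ j, cutGauss N (θ j) = Real.exp (∑ j, -(N / 2 * θ j ^ 2 + 4 * N * θ j ^ 4)) := by
      rw [Real.exp_sum]
      exact Finset.prod_congr rfl fun j _ => by rw [cutGauss, if_pos (h j)]
    have h3 : Real.exp (-9) * (10 - (∑ j, θ j) ^ 2 / 2) ≤ Real.exp (-((∑ j, θ j) ^ 2 / 2)) := by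
      have := Real.add_one_le_exp (9 - (∑ j, θ j) ^ 2 / 2)
      calc _ ≤ Real.exp (-9) * Real.exp (9 - (∑ j, θ j) ^ 2 / 2) := by gcongr; linarith
        _ = _ := by rw [← Real.exp_add]; ring_nf
    rw [h2, ← mul_assoc]
    refine (mul_le_mul_of_nonneg_right h3 (Real.exp_pos _).le).trans ?_
    rw [← Real.exp_add, Real.exp_le_exp, Finset.sum_neg_distrib, Finset.sum_neg_distrib,
      Finset.sum_add_distrib, Finset.sum_add_distrib, ← Finset.sum_div, ← Finset.sum_div,
      sum_edge_add_sq, ← Finset.mul_sum, ← Finset.mul_sum]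
    have h4 : ∑ e : Edge N, (θ e.1.1 + θ e.1.2) ^ 4 ≤ 8 * (N * ∑ j, θ j ^ 4) := by
      refine le_trans ?_ (mul_le_mul_of_nonneg_left
        (sum_edge_add_le (fun j => θ j ^ 4) fun j => by positivity) (by norm_num))
      rw [Finset.mul_sum]
      refine Finset.sum_le_sum fun e _ => ?_
      have := Even.add_pow_le (n := 4) (a := θ e.1.1) (b := θ e.1.2) (by decide)
      norm_num at this
      linarith
    have h5 : 0 ≤ ∑ j, θ j ^ 2 := Finset.sum_nonneg fun j _ => sq_nonneg _
    nlinarith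
  · push Not at h
    obtain ⟨i, hi⟩ := h
    have : ∏ j, cutGauss N (θ j) = 0 := Finset.prod_eq_zero (Finset.mem_univ i) (by
      rw [cutGauss, if_neg (not_le.2 hi)])
    rw [this]; simp

theorem integrable_cosProd (N : ℕ) : Integrable (cosProd (N := N)) (boxMeasure N) := by
  have hm : Measurable (cosProd (N := N)) := by
    unfold cosProd
    refine Measurable.ite ?_ (Continuous.measurable (by fun_prop)) measurable_const
    have : {θ : Fin N → ℝ | ∀ j, |θ j| ≤ 1 / 4} = ⋂ j, {θ | |θ j| ≤ 1 / 4} := by ext; simp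
    rw [this]
    exact MeasurableSet.iInter fun j => measurableSet_le (measurable_pi_apply j).abs measurable_const
  refine Integrable.of_bound hm.aestronglyMeasurable 1 (Filter.Eventually.of_forall fun θ => ?_)
  unfold cosProd
  split_ifs
  · rw [Real.norm_of_nonneg (Finset.prod_nonneg fun _ _ => abs_nonneg _)]
    exact Finset.prod_le_one (fun _ _ => abs_nonneg _) fun _ _ => Real.abs_cos_le_one _
  · simp

theorem integrable_pow_mul_exp_neg {c : ℝ} (hc : 0 < c) (m : ℕ) :
    Integrable (fun x : ℝ => x ^ m * Real.exp (-c * x ^ 2)) := by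
  have h := integrable_rpow_mul_exp_neg_mul_sq hc (s := m) (by linarith [Nat.cast_nonneg (α := ℝ) m])
  simpa only [Real.rpow_natCast] using h

theorem integrable_pow_mul_cutGauss {N : ℕ} (hN : 0 < N) (m : ℕ) :
    Integrable (fun x : ℝ => x ^ m * cutGauss N x) := by
  have hN' : (0 : ℝ) < N := by exact_mod_cast hN
  refine (integrable_pow_mul_exp_neg (c := N / 2) (by positivity) m).mono
    ((measurable_id.pow_const m).mul (measurable_cutGauss N)).aestronglyMeasurable
    (Filter.Eventually.of_forall fun x => ?_)
  rw [norm_mul, norm_mul, Real.norm_of_nonneg (cutGauss_nonneg N x), Real.norm_of_nonneg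
    (Real.exp_pos _).le]
  exact mul_le_mul_of_nonneg_left (cutGauss_le N x) (norm_nonneg _)

theorem setIntegral_pow_mul_cutGauss {N : ℕ} (m : ℕ) (j : Fin N) :
    ∫ x in Set.Ioc (-boxLen j) (boxLen j), x ^ m * cutGauss N x = ∫ x, x ^ m * cutGauss N x := by
  refine setIntegral_eq_integral_of_forall_compl_eq_zero fun x hx => ?_
  have h1 : 1 / 4 < boxLen j := by
    have := Real.pi_gt_three
    unfold boxLen; split_ifs <;> linarith
  have h2 : ¬ |x| ≤ 1 / 4 := fun h => by
    have := abs_le.mp h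
    exact hx ⟨by linarith, by linarith⟩
  rw [cutGauss, if_neg h2, mul_zero]

theorem sqrt_four_pi_div_le {N : ℕ} (hN : 0 < N) :
    √(Real.pi / (N / 4)) ≤ √(2 * Real.pi / N) * (3 / 2) := by
  have hN' : (0 : ℝ) < N := by exact_mod_cast hN
  rw [Real.sqrt_le_left (by positivity), mul_pow, Real.sq_sqrt (by positivity)]
  have e1 : Real.pi / (N / 4) = Real.pi / N * 4 := by field_simp
  have e2 : 2 * Real.pi / N * (3 / 2) ^ 2 = Real.pi / N * (9 / 2) := by ring
  rw [e1, e2]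
  exact mul_le_mul_of_nonneg_left (by norm_num) (by positivity)

theorem integral_sq_mul_cutGauss_le {N : ℕ} (hN : 0 < N) :
    ∫ x, x ^ 2 * cutGauss N x ≤ 6 / N * √(2 * Real.pi / N) := by
  have hN' : (0 : ℝ) < N := by exact_mod_cast hN
  calc ∫ x, x ^ 2 * cutGauss N x ≤ ∫ x, 4 / N * Real.exp (-(N / 4) * x ^ 2) := by
        refine integral_mono (integrable_pow_mul_cutGauss hN 2)
          ((integrable_exp_neg_mul_sq (by positivity)).const_mul _) fun x => ?_
        have h := pow_mul_exp_neg_le 1 (c := N / 4) (y := x ^ 2) (by positivity) (sq_nonneg x)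
        have h2 := mul_le_mul_of_nonneg_left (cutGauss_le N x) (sq_nonneg x)
        simp only [pow_one, Nat.factorial] at h
        refine h2.trans (le_trans (le_of_eq ?_) (h.trans (le_of_eq ?_)))
        · ring_nf
        · norm_num
    _ = 4 / N * √(Real.pi / (N / 4)) := by rw [integral_const_mul, integral_gaussian]
    _ ≤ 4 / N * (√(2 * Real.pi / N) * (3 / 2)) := by gcongr; exact sqrt_four_pi_div_le hN
    _ = _ := by ring

theorem integral_cutGauss_ge {N : ℕ} (hN : 64 ≤ N) :
    √(2 * Real.pi / N) * (1 - 384 / N) ≤ ∫ x, cutGauss N x := by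
  have hN0 : 0 < N := by omega
  have hN' : (64 : ℝ) ≤ N := by exact_mod_cast hN
  have h1 : ∀ x : ℝ, Real.exp (-(N / 2) * x ^ 2) - 256 / N * Real.exp (-(N / 4) * x ^ 2)
      ≤ cutGauss N x := fun x => by
    have h2 : Real.exp (-(N / 2) * x ^ 2) * (1 - 8 * N * x ^ 4) ≤ cutGauss N x := by
      unfold cutGauss
      split_ifs with h
      · have h3 : -(N / 2 * x ^ 2 + 4 * N * x ^ 4) = -((N : ℝ) / 2) * x ^ 2 + -(4 * N * x ^ 4) := by ring
        rw [h3, Real.exp_add]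
        refine mul_le_mul_of_nonneg_left ?_ (Real.exp_pos _).le
        have := Real.add_one_le_exp (-(4 * (N : ℝ) * x ^ 4))
        have : 0 ≤ (N : ℝ) * x ^ 4 := by positivity
        linarith
      · refine mul_nonpos_of_nonneg_of_nonpos (Real.exp_pos _).le ?_
        have h4 := pow_le_pow_left₀ (by norm_num) (not_le.1 h).le 4
        rw [Even.pow_abs (by decide)] at h4
        norm_num at h4
        nlinarith
    have h := pow_mul_exp_neg_le 2 (c := N / 4) (y := x ^ 2) (by positivity) (sq_nonneg x)
    have h5 : 8 * (N : ℝ) * ((x ^ 2) ^ 2 * Real.exp (-(2 * (N / 4)) * x ^ 2))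
        ≤ 256 / N * Real.exp (-(N / 4) * x ^ 2) := by
      refine (mul_le_mul_of_nonneg_left h (by positivity)).trans (le_of_eq ?_)
      simp only [Nat.factorial]
      push_cast
      field_simp
      ring
    have h6 : -(2 * ((N : ℝ) / 4)) * x ^ 2 = -(N / 2) * x ^ 2 := by ring
    rw [h6] at h5
    nlinarith
  have i1 : Integrable fun x : ℝ => Real.exp (-((N : ℝ) / 2) * x ^ 2) :=
    integrable_exp_neg_mul_sq (by positivity)
  have i2 : Integrable fun x : ℝ => 256 / (N : ℝ) * Real.exp (-(N / 4) * x ^ 2) :=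
    (integrable_exp_neg_mul_sq (by positivity)).const_mul _
  have i3 := integrable_pow_mul_cutGauss hN0 0
  simp only [pow_zero, one_mul] at i3
  refine le_trans ?_ (integral_mono (i1.sub i2) i3 h1)
  rw [integral_sub' i1 i2, integral_const_mul, integral_gaussian, integral_gaussian]
  have e1 : Real.pi / ((N : ℝ) / 2) = 2 * Real.pi / N := by field_simp
  have h7 := mul_le_mul_of_nonneg_left (sqrt_four_pi_div_le hN0) (by positivity : 0 ≤ 256 / (N : ℝ))
  rw [e1]
  have e2 : √(2 * Real.pi / N) * (1 - 384 / N)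
    = √(2 * Real.pi / N) - 256 / N * (√(2 * Real.pi / N) * (3 / 2)) := by ring
  rw [e2]
  linarith

theorem integral_cosProd_ge {N : ℕ} (hN : 768 ≤ N) :
    Real.exp (-777) * √(2 * Real.pi / N) ^ N ≤ ∫ θ, cosProd θ ∂boxMeasure N := by
  have hN0 : 0 < N := by omega
  have hN' : (768 : ℝ) ≤ N := by exact_mod_cast hN
  set z := √(2 * Real.pi / N) with hz
  have hz0 : 0 < z := by positivity
  set I0 := ∫ x, cutGauss N x with hI0
  set I2 := ∫ x, x ^ 2 * cutGauss N x with hI2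
  have h384 : 384 / (N : ℝ) ≤ 1 / 2 := by rw [div_le_iff₀ (by positivity)]; linarith
  have hI0z : z * (1 - 384 / N) ≤ I0 := integral_cutGauss_ge (by omega)
  have hI0h : z / 2 ≤ I0 := le_trans (by nlinarith) hI0z
  have hI0p : 0 < I0 := by linarith
  have hI2z : I2 ≤ 12 / N * I0 := by
    refine (integral_sq_mul_cutGauss_le hN0).trans ?_
    have h1 : 12 / (N : ℝ) * (z / 2) ≤ 12 / N * I0 := mul_le_mul_of_nonneg_left hI0h (by positivity)
    have h2 : 6 / (N : ℝ) * z = 12 / N * (z / 2) := by ring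
    rw [← hz, h2]
    exact h1
  have hG : Measurable fun θ : Fin N → ℝ => ∏ j, cutGauss N (θ j) :=
    Finset.measurable_prod _ fun j _ => (measurable_cutGauss N).comp (measurable_pi_apply j)
  have hG0 : ∀ θ : Fin N → ℝ, 0 ≤ ∏ j, cutGauss N (θ j) := fun θ =>
    Finset.prod_nonneg fun j _ => cutGauss_nonneg N _
  have hG1 : ∀ θ : Fin N → ℝ, ∏ j, cutGauss N (θ j) ≤ 1 := fun θ =>
    Finset.prod_le_one (fun j _ => cutGauss_nonneg N _) fun j _ =>
      (cutGauss_le N _).trans (Real.exp_le_one_iff.mpr (by nlinarith [sq_nonneg (θ j)]))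
  have h_int : ∀ f : (Fin N → ℝ) → ℝ, Continuous f →
      Integrable (fun θ => f θ * ∏ j, cutGauss N (θ j)) (boxMeasure N) := fun f hf => by
    refine (integrable_boxMeasure hf.norm).mono' (hf.measurable.mul hG).aestronglyMeasurable
      (Filter.Eventually.of_forall fun θ => ?_)
    rw [norm_mul, Real.norm_of_nonneg (hG0 θ)]
    exact mul_le_of_le_one_right (norm_nonneg _) (hG1 θ)
  have m0 : ∫ θ : Fin N → ℝ, ∏ j, cutGauss N (θ j) ∂boxMeasure N = I0 ^ N := by
    rw [boxMeasure, integral_fintype_prod_eq_prod]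
    have : ∀ j : Fin N, ∫ x in Set.Ioc (-boxLen j) (boxLen j), cutGauss N x = I0 := fun j => by
      have := setIntegral_pow_mul_cutGauss 0 j
      simpa only [pow_zero, one_mul] using this
    simp [this]
  have m2 : ∀ i, ∫ θ : Fin N → ℝ, θ i ^ 2 * ∏ j, cutGauss N (θ j) ∂boxMeasure N ≤ 12 / N * I0 ^ N := by
    intro i
    have h1 : ∀ θ : Fin N → ℝ, θ i ^ 2 * ∏ j, cutGauss N (θ j)
        = ∏ j, (if j = i then θ j ^ 2 * cutGauss N (θ j) else cutGauss N (θ j)) := fun θ => by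
      have : ∀ j, (if j = i then θ j ^ 2 * cutGauss N (θ j) else cutGauss N (θ j))
          = (if j = i then θ j ^ 2 else 1) * cutGauss N (θ j) := fun j => by split_ifs <;> simp
      simp only [this]
      rw [Finset.prod_mul_distrib, Finset.prod_ite_eq']
      simp
    simp only [h1]
    rw [boxMeasure, integral_fintype_prod_eq_prod
      (f := fun j x => if j = i then x ^ 2 * cutGauss N x else cutGauss N x)]
    have h2 : ∀ j : Fin N, ∫ x in Set.Ioc (-boxLen j) (boxLen j),
        (if j = i then x ^ 2 * cutGauss N x else cutGauss N x) = (if j = i then I2 / I0 else 1) * I0 :=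
      fun j => by
        by_cases hj : j = i
        · simp only [hj, if_true]
          rw [setIntegral_pow_mul_cutGauss, div_mul_cancel₀ _ hI0p.ne']
        · simp only [hj, if_false]
          have := setIntegral_pow_mul_cutGauss 0 j
          simpa only [pow_zero, one_mul] using this
    rw [Finset.prod_congr rfl fun j _ => h2 j, Finset.prod_mul_distrib, Finset.prod_ite_eq']
    simp only [Finset.mem_univ, if_true, Finset.prod_const, Finset.card_univ, Fintype.card_fin]
    refine mul_le_mul_of_nonneg_right ?_ (by positivity)
    rwa [div_le_iff₀ hI0p]
  have mT : ∫ θ : Fin N → ℝ, (∑ j, θ j) ^ 2 * ∏ j, cutGauss N (θ j) ∂boxMeasure N ≤ 12 * I0 ^ N := by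
    have hexp : ∀ θ : Fin N → ℝ, (∑ j, θ j) ^ 2 * ∏ j, cutGauss N (θ j)
        = ∑ j, ∑ k, θ j * θ k * ∏ j, cutGauss N (θ j) := fun θ => by
      rw [sq, Finset.sum_mul_sum]
      simp only [Finset.sum_mul]
    simp only [hexp]
    have hjk : ∀ j k, Integrable (fun θ : Fin N → ℝ => θ j * θ k * ∏ j, cutGauss N (θ j))
        (boxMeasure N) := fun j k => h_int (fun θ => θ j * θ k) (by fun_prop)
    rw [integral_finsetSum _ fun j _ => integrable_finsetSum _ fun k _ => hjk j k]
    have h1 : ∀ j, ∫ θ : Fin N → ℝ, ∑ k, θ j * θ k * ∏ j, cutGauss N (θ j) ∂boxMeasure N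
        ≤ 12 / N * I0 ^ N := fun j => by
      refine le_trans (le_of_eq ?_) (m2 j)
      rw [integral_finsetSum _ fun k _ => hjk j k, Finset.sum_eq_single j]
      · simp only [sq]
      · intro k _ hk
        refine integral_eq_zero_of_flipSign {k} ?_ fun θ => ?_
        · exact ((measurable_pi_apply j).mul (measurable_pi_apply k)).mul hG
        · have h2 : ∏ i, cutGauss N (flipSign {k} θ i) = ∏ i, cutGauss N (θ i) :=
            Finset.prod_congr rfl fun i _ => by
              unfold flipSign
              split_ifs
              · exact cutGauss_neg N _
              · rfl
          have h3 : j ≠ k := hk.symm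
          rw [h2]
          simp only [flipSign, Finset.mem_singleton, h3, if_false, if_true]
          ring
      · intro h; exact absurd (Finset.mem_univ j) h
    refine (Finset.sum_le_sum fun j _ => h1 j).trans (le_of_eq ?_)
    rw [Finset.sum_const, Finset.card_univ, Fintype.card_fin, nsmul_eq_mul]
    field_simp
  have main := integral_mono ((h_int (fun θ => 10 - (∑ j, θ j) ^ 2 / 2) (by fun_prop)).const_mul
    (Real.exp (-9))) (integrable_cosProd N) fun θ => cosProd_ge θ
  refine le_trans ?_ main
  rw [integral_const_mul]
  have e1 : ∀ θ : Fin N → ℝ, (10 - (∑ j, θ j) ^ 2 / 2) * ∏ j, cutGauss N (θ j)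
      = 10 * (∏ j, cutGauss N (θ j)) - 1 / 2 * ((∑ j, θ j) ^ 2 * ∏ j, cutGauss N (θ j)) := fun θ => by
    ring
  simp only [e1]
  rw [integral_sub (h_int (fun _ => 10) (by fun_prop))
    ((h_int (fun θ => (∑ j, θ j) ^ 2) (by fun_prop)).const_mul _), integral_const_mul,
    integral_const_mul, m0]
  have h9 : Real.exp (-768) * z ^ N ≤ I0 ^ N := by
    have h1 : Real.exp (-(768 / N)) * z ≤ I0 := by
      refine le_trans ?_ hI0z
      rw [mul_comm]
      refine mul_le_mul_of_nonneg_left ?_ hz0.le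
      refine le_trans ?_ (exp_neg_le_one_sub (y := 384 / N) h384)
      rw [Real.exp_le_exp]
      have : 0 ≤ 384 / (N : ℝ) := by positivity
      have e : 768 / (N : ℝ) = 2 * (384 / N) := by ring
      rw [e]
      nlinarith
    have h2 := pow_le_pow_left₀ (by positivity) h1 N
    rw [mul_pow, ← Real.exp_nat_mul] at h2
    have e : (N : ℝ) * -(768 / N) = -768 := by field_simp
    rwa [e] at h2
  have h10 : Real.exp (-777) * z ^ N = Real.exp (-9) * (Real.exp (-768) * z ^ N) := by
    rw [← mul_assoc, ← Real.exp_add]; norm_num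
  rw [h10]
  refine mul_le_mul_of_nonneg_left ?_ (Real.exp_pos _).le
  have : 0 ≤ I0 ^ N := by positivity
  linarith

theorem sum_sq_pow_three_le {N : ℕ} (b : Fin N → ℝ) :
    (∑ j, b j ^ 2) ^ 3 ≤ N ^ 2 * ∑ j, b j ^ 6 := by
  have h := pow_sum_le_card_mul_sum_pow (s := Finset.univ) (f := fun j => b j ^ 2)
    (fun j _ => sq_nonneg _) 2
  simpa [← pow_mul] using h

theorem integral_re_charFn_ge (K : ℝ) : ∃ c, 0 < c ∧ ∃ N₀ : ℕ, ∀ {N : ℕ}, N₀ ≤ N →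
    ∀ {b : Fin N → ℝ} {s : Fin N → ℤ}, (∀ j, (s j : ℝ) = N * b j + ∑ k, b k) →
      N ^ 2 * ∑ j, b j ^ 6 ≤ K →
      c * √(2 * Real.pi / N) ^ N ≤ ∫ θ, (charFn b s θ).re ∂boxMeasure N := by
  set B := max K 1 with hBdef
  have hB0 : 0 ≤ B := le_trans zero_le_one (le_max_right _ _)
  obtain ⟨C, hC, hfar⟩ := integral_farBound_le B
  set M := 2 * C + nearConst B * (4 * B * 256 * Real.exp (4 * B + 320) * 18 * 14 ^ 3
    + (8 * B + 128 * B) * Real.exp (4 * B + 320) * 42) with hM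
  obtain ⟨N₁, hN₁⟩ := exists_nat_ge (max (M / (Real.exp (-777) / 2)) (64 * B))
  refine ⟨Real.exp (-777) / 2, by positivity, N₁ + 4096, fun {N} hN {b s} hs h6 => ?_⟩
  have hNr : (4096 : ℝ) ≤ N := by exact_mod_cast (by omega : 4096 ≤ N)
  have hN1 : (N₁ : ℝ) ≤ N := by exact_mod_cast (by omega : N₁ ≤ N)
  have hN0 : (0 : ℝ) < N := by linarith
  have h6B : N ^ 2 * ∑ j, b j ^ 6 ≤ B := h6.trans (le_max_left _ _)
  have h2 : ∑ j, b j ^ 2 ≤ B := by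
    have h := (sum_sq_pow_three_le b).trans h6B
    have hS : 0 ≤ ∑ j, b j ^ 2 := Finset.sum_nonneg fun j _ => sq_nonneg _
    have hB1 : 1 ≤ B := le_max_right _ _
    by_contra! hlt
    have : B ^ 3 < (∑ j, b j ^ 2) ^ 3 := by gcongr
    nlinarith [mul_le_mul hB1 hB1 zero_le_one hB0]
  have hb : ∀ j, |b j| ≤ 1 / 4 := fun j => by
    have h := Finset.single_le_sum (f := fun j => b j ^ 6) (fun j _ => by positivity)
      (Finset.mem_univ j)
    have h3 : N ^ 2 * b j ^ 6 ≤ B := le_trans (by gcongr) h6B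
    by_contra! hlt
    have h4 : (1 / 4 : ℝ) ^ 6 ≤ b j ^ 6 := by
      rw [← Even.pow_abs (by decide) (b j)]; gcongr
    have h5 : 64 * B ≤ N := ((le_max_right _ _).trans hN₁).trans hN1
    nlinarith
  have hpos : 0 ≤ √(2 * Real.pi / N) ^ N := by positivity
  obtain ⟨hci, hc⟩ := integral_cubicPhase_sq_le (by omega) hb h2
  have hd := integral_drift_sq_le (by omega) hb h2 (drift b s)
  have hfar' := hfar (N := N) (by omega) hb h2
  have hr : ∑ j, drift b s j ^ 2 ≤ 8 * B + 128 * B := by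
    linarith [sum_drift_sq_le hs]
  have hcos := integral_cosProd_ge (N := N) (by omega)
  have hdi : Integrable (fun θ : Fin N → ℝ => (∑ j, drift b s j * θ j) ^ 2
      * ∏ j, nearFactor b j (θ j)) (boxMeasure N) :=
    integrable_boxMeasure (by unfold nearFactor; fun_prop)
  have hfi : Integrable (farBound B b) (boxMeasure N) :=
    integrable_boxMeasure (continuous_farBound B b)
  have hre : Integrable (fun θ => (charFn b s θ).re) (boxMeasure N) :=
    integrable_boxMeasure (Complex.continuous_re.comp (continuous_charFn b s))
  have hle := integral_mono (((integrable_cosProd N).sub (hfi.const_mul 2)).sub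
    ((hci.add hdi).const_mul (nearConst B))) hre (fun θ => by
      simp only [Pi.sub_apply, Pi.add_apply]
      rw [← add_mul]
      exact re_charFn_ge (by omega) hb h2 s θ)
  refine le_trans ?_ hle
  have e : ∫ θ, (((cosProd - fun θ => 2 * farBound B b θ) - fun θ : Fin N → ℝ => nearConst B
      * ((fun θ : Fin N → ℝ => cubicPhase b θ ^ 2 * ∏ j, nearFactor b j (θ j))
        + fun θ : Fin N → ℝ => (∑ j, drift b s j * θ j) ^ 2 * ∏ j, nearFactor b j (θ j)) θ)
        : (Fin N → ℝ) → ℝ) θ ∂boxMeasure N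
      = ∫ θ, cosProd θ ∂boxMeasure N - 2 * ∫ θ, farBound B b θ ∂boxMeasure N
        - nearConst B * (∫ θ, cubicPhase b θ ^ 2 * ∏ j, nearFactor b j (θ j) ∂boxMeasure N
          + ∫ θ, (∑ j, drift b s j * θ j) ^ 2 * ∏ j, nearFactor b j (θ j) ∂boxMeasure N) := by
    rw [integral_sub' ((integrable_cosProd N).sub (hfi.const_mul 2))
      ((hci.add hdi).const_mul (nearConst B)), integral_sub' (integrable_cosProd N)
      (hfi.const_mul 2), integral_const_mul, integral_const_mul, integral_add' hci hdi]
  rw [e]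
  set Z := √(2 * Real.pi / N) ^ N with hZ
  have hn : 0 ≤ nearConst B := (Real.exp_pos _).le
  have hd' := hd.trans (by gcongr : _ ≤ (8 * B + 128 * B) * Real.exp (4 * B + 320) * 42 / N * Z)
  have h1 := mul_le_mul_of_nonneg_left (add_le_add hc hd') hn
  have hMN : M / N * Z ≤ Real.exp (-777) / 2 * Z := by
    refine mul_le_mul_of_nonneg_right ?_ hpos
    rw [div_le_iff₀ hN0, mul_comm, ← div_le_iff₀ (by positivity)]
    exact ((le_max_left _ _).trans hN₁).trans hN1
  have e2 : M / N * Z = 2 * (C / N * Z) + nearConst B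
      * (4 * B * 256 * Real.exp (4 * B + 320) * 18 * 14 ^ 3 / N * Z
        + (8 * B + 128 * B) * Real.exp (4 * B + 320) * 42 / N * Z) := by
    rw [hM]; ring
  linarith

theorem prod_two_mul_boxLen {N : ℕ} (hN : 0 < N) :
    ∏ j : Fin N, 2 * boxLen j = Real.pi ^ N / 2 := by
  obtain ⟨m, rfl⟩ := Nat.exists_eq_succ_of_ne_zero hN.ne'
  rw [Fin.prod_univ_succ]
  simp [boxLen]
  field_simp
  ring

theorem sqrt_pow_mul_prod_boxLen {N : ℕ} (hN : 0 < N) :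
    2 * √(2 * Real.pi / N) ^ N = 4 * √(2 / (Real.pi * N)) ^ N * ∏ j : Fin N, 2 * boxLen j := by
  have h : √(2 * Real.pi / N) = √(2 / (Real.pi * N)) * Real.pi := by
    rw [show 2 * Real.pi / N = 2 / (Real.pi * N) * Real.pi ^ 2 by field_simp,
      Real.sqrt_mul (by positivity), Real.sqrt_sq Real.pi_pos.le]
  rw [prod_two_mul_boxLen hN, h, mul_pow]
  ring

/-- The Fourier representation of `signCount` in real form. -/
theorem signCount_fourier_re {N : ℕ} (hN : 0 < N) (b : Fin N → ℝ) (s : Fin N → ℤ)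
    (h1 : ∀ j, ∃ m : ℤ, s j = (N : ℤ) - 1 + 2 * m)
    (h2 : ∃ m : ℤ, ∑ j, s j = 2 * (N.choose 2 : ℤ) + 4 * m) :
    (signCount s : ℝ) / 2 ^ (N.choose 2) * ∏ j : Fin N, 2 * boxLen j
      = Real.exp (-(∑ j, (s j : ℝ) * b j)) * (∏ e : Edge N, Real.cosh (b e.1.1 + b e.1.2))
        * ∫ θ, (charFn b s θ).re ∂boxMeasure N := by
  have h := signCount_fourier hN b s h1 h2
  have hr : ∫ θ, (charFn b s θ).re ∂boxMeasure N = (∫ θ, charFn b s θ ∂boxMeasure N).re :=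
    integral_re (integrable_boxMeasure (continuous_charFn b s))
  have e1 : Complex.exp (-(∑ j, (s j : ℝ) * b j : ℝ))
        * ∏ e : Edge N, Complex.cosh ((b e.1.1 + b e.1.2 : ℝ) : ℂ)
      = ((Real.exp (-(∑ j, (s j : ℝ) * b j)) * ∏ e : Edge N, Real.cosh (b e.1.1 + b e.1.2) : ℝ) : ℂ) := by
    push_cast
    rfl
  rw [e1] at h
  have e2 : (signCount s : ℂ) / 2 ^ (N.choose 2) * ∏ j : Fin N, 2 * (boxLen j : ℂ)
      = (((signCount s : ℝ) / 2 ^ (N.choose 2) * ∏ j : Fin N, 2 * boxLen j : ℝ) : ℂ) := by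
    push_cast; rfl
  rw [e2] at h
  have h' := congrArg Complex.re h
  rw [Complex.ofReal_re, Complex.re_ofReal_mul] at h'
  rw [hr, h']

theorem signCount_le {B : ℝ} : ∃ C, 0 < C ∧ ∀ {N : ℕ}, 16 ≤ N → ∀ {b : Fin N → ℝ},
    (∀ j, |b j| ≤ 1 / 4) → ∑ j, b j ^ 2 ≤ B → ∀ s : Fin N → ℤ,
    (∀ j, ∃ m : ℤ, s j = (N : ℤ) - 1 + 2 * m) →
    (∃ m : ℤ, ∑ j, s j = 2 * (N.choose 2 : ℤ) + 4 * m) →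
    (signCount s : ℝ) / 2 ^ (N.choose 2) ≤ C * √(2 / (Real.pi * N)) ^ N
      * Real.exp ((N * ∑ j, b j ^ 2 + (∑ j, b j) ^ 2) / 2 - ∑ j, (s j : ℝ) * b j) := by
  obtain ⟨C, hC, h⟩ := integral_norm_charFn_le B
  refine ⟨2 * C, by positivity, fun {N} hN {b} hb hB s h1 h2 => ?_⟩
  have hN0 : 0 < N := by omega
  have hp : 0 < ∏ j : Fin N, 2 * boxLen j :=
    Finset.prod_pos fun j _ => mul_pos two_pos (boxLen_pos j)
  rw [← mul_le_mul_iff_left₀ hp, signCount_fourier_re hN0 b s h1 h2]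
  have hI : ∫ θ, (charFn b s θ).re ∂boxMeasure N ≤ C * √(2 * Real.pi / N) ^ N := by
    refine le_trans (integral_mono ?_ ?_ fun θ => Complex.re_le_norm _) (h hN hb hB s)
    · exact integrable_boxMeasure (Complex.continuous_re.comp (continuous_charFn b s))
    · exact integrable_boxMeasure (continuous_charFn b s).norm
  have hcosh : ∏ e : Edge N, Real.cosh (b e.1.1 + b e.1.2)
      ≤ Real.exp ((N * ∑ j, b j ^ 2 + (∑ j, b j) ^ 2) / 2) := by
    calc _ ≤ ∏ e : Edge N, Real.exp ((b e.1.1 + b e.1.2) ^ 2 / 2) :=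
          Finset.prod_le_prod (fun e _ => (Real.cosh_pos _).le) fun e _ => Real.cosh_le_exp_half_sq _
      _ = Real.exp (((N - 2) * ∑ j, b j ^ 2 + (∑ j, b j) ^ 2) / 2) := by
          rw [← Real.exp_sum, ← Finset.sum_div, sum_edge_add_sq]
      _ ≤ _ := Real.exp_le_exp.mpr (by
          have : 0 ≤ ∑ j, b j ^ 2 := Finset.sum_nonneg fun j _ => sq_nonneg _
          linarith)
  have e3 := sqrt_pow_mul_prod_boxLen hN0
  have hpos : 0 ≤ ∏ e : Edge N, Real.cosh (b e.1.1 + b e.1.2) :=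
    Finset.prod_nonneg fun e _ => (Real.cosh_pos _).le
  calc _ ≤ Real.exp (-(∑ j, (s j : ℝ) * b j))
        * Real.exp ((N * ∑ j, b j ^ 2 + (∑ j, b j) ^ 2) / 2) * (C * √(2 * Real.pi / N) ^ N) :=
        (mul_le_mul_of_nonneg_left hI (by positivity)).trans (by gcongr)
    _ = C / 2 * (2 * √(2 * Real.pi / N) ^ N)
        * Real.exp ((N * ∑ j, b j ^ 2 + (∑ j, b j) ^ 2) / 2 - ∑ j, (s j : ℝ) * b j) := by
        rw [sub_eq_add_neg, Real.exp_add]; ring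
    _ = _ := by rw [e3]; ring

theorem exp_half_sq_sub_le_cosh (x : ℝ) : Real.exp (x ^ 2 / 2 - x ^ 4 / 8) ≤ Real.cosh x := by
  have h1 : 1 + x ^ 2 / 2 ≤ Real.cosh x := by
    have h := Real.cosh_two_mul (x / 2)
    rw [mul_div_cancel₀ x two_ne_zero, Real.cosh_sq] at h
    have h2 : (x / 2) ^ 2 ≤ Real.sinh (x / 2) ^ 2 := by
      rcases le_total 0 (x / 2) with hx | hx
      · exact pow_le_pow_left₀ hx (Real.self_le_sinh_iff.mpr hx) 2
      · have h3 := Real.sinh_le_self_iff.mpr hx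
        nlinarith
    linarith
  refine le_trans ?_ h1
  have hy : 0 ≤ x ^ 2 / 2 := by positivity
  rw [← Real.le_log_iff_exp_le (by positivity)]
  refine le_trans ?_ (Real.le_log_one_add_of_nonneg hy)
  rw [le_div_iff₀ (by positivity)]
  nlinarith [pow_nonneg hy 3]

theorem sum_sub_sq_add_sq_le {N : ℕ} (hN : 0 < N) (s : Fin N → ℝ) (v : ℝ) :
    ((∑ j, s j) / (2 * N)) ^ 2 / 2 + (∑ j, (s j - (∑ j, s j) / (2 * N)) ^ 2) / (2 * N)
      ≤ v ^ 2 / 2 + (∑ j, (s j - v) ^ 2) / (2 * N) := by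
  have hN' : (0 : ℝ) < N := by exact_mod_cast hN
  have e : ∀ u : ℝ, ∑ j, (s j - u) ^ 2 = ∑ j, s j ^ 2 - 2 * u * ∑ j, s j + N * u ^ 2 := fun u => by
    simp only [sub_sq, Finset.sum_add_distrib, Finset.sum_sub_distrib, Finset.sum_const,
      Finset.card_univ, Fintype.card_fin, nsmul_eq_mul, Finset.mul_sum]
    congr 2
    exact Finset.sum_congr rfl fun j _ => by ring
  rw [e, e]
  set S := ∑ j, s j
  have h : v ^ 2 / 2 + (∑ j, s j ^ 2 - 2 * v * S + N * v ^ 2) / (2 * N)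
      - ((S / (2 * N)) ^ 2 / 2 + (∑ j, s j ^ 2 - 2 * (S / (2 * N)) * S + N * (S / (2 * N)) ^ 2) / (2 * N))
      = (v - S / (2 * N)) ^ 2 := by field_simp; ring
  nlinarith [sq_nonneg (v - S / (2 * N))]

theorem signCount_ge (K : ℝ) (hK : 0 ≤ K) : ∃ c, 0 < c ∧ ∃ N₀ : ℕ, ∀ {N : ℕ}, N₀ ≤ N → ∀ s : Fin N → ℤ,
    (∀ j, ∃ m : ℤ, s j = (N : ℤ) - 1 + 2 * m) →
    (∃ m : ℤ, ∑ j, s j = 2 * (N.choose 2 : ℤ) + 4 * m) →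
    ∑ j, (s j : ℝ) ^ 6 ≤ K * N ^ 4 → ∀ v : ℝ,
    c * √(2 / (Real.pi * N)) ^ N * Real.exp (-(v ^ 2 / 2 + (∑ j, ((s j : ℝ) - v) ^ 2) / (2 * N)))
      ≤ (signCount s : ℝ) / 2 ^ (N.choose 2) := by
  obtain ⟨c, hc, N₁, h⟩ := integral_re_charFn_ge (64 * K)
  set B := 64 * K + 1
  refine ⟨2 * c * Real.exp (-(2 * B)), by positivity, N₁ + 16, fun {N} hN s h1 h2 h6 v => ?_⟩
  have hN0 : 0 < N := by omega
  have hN' : (0 : ℝ) < N := by exact_mod_cast hN0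
  set w := (∑ j, (s j : ℝ)) / (2 * N) with hw
  set b : Fin N → ℝ := fun j => ((s j : ℝ) - w) / N with hbdef
  have hsum : ∑ j, b j = w := by
    rw [hbdef, ← Finset.sum_div, Finset.sum_sub_distrib, Finset.sum_const, Finset.card_univ,
      Fintype.card_fin, nsmul_eq_mul, div_eq_iff hN'.ne']
    rw [hw]; field_simp; ring
  have hsb : ∀ j, (s j : ℝ) = N * b j + ∑ k, b k := fun j => by
    rw [hsum, hbdef]; field_simp; ring
  have hw6 : N * w ^ 6 ≤ ∑ j, (s j : ℝ) ^ 6 := by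
    have i1 := sq_sum_le_card_mul_sum_sq (s := Finset.univ) (f := fun j => (s j : ℝ))
    rw [Finset.card_univ, Fintype.card_fin] at i1
    have i2 := pow_le_pow_left₀ (sq_nonneg _) i1 3
    have i3 := sum_sq_pow_three_le (fun j => (s j : ℝ))
    rw [mul_pow] at i2
    have i4 : ((∑ j, (s j : ℝ)) ^ 2) ^ 3 ≤ N ^ 3 * (N ^ 2 * ∑ j, (s j : ℝ) ^ 6) :=
      i2.trans (mul_le_mul_of_nonneg_left i3 (by positivity))
    have i5 : 0 ≤ ∑ j, (s j : ℝ) ^ 6 := Finset.sum_nonneg fun j _ => by positivity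
    calc (N : ℝ) * w ^ 6 = ((∑ j, (s j : ℝ)) ^ 2) ^ 3 / (64 * N ^ 5) := by
          rw [hw]; field_simp; norm_num
      _ ≤ N ^ 3 * (N ^ 2 * ∑ j, (s j : ℝ) ^ 6) / (64 * N ^ 5) := by gcongr
      _ = (∑ j, (s j : ℝ) ^ 6) / 64 := by field_simp
      _ ≤ _ := by linarith
  have hb6 : N ^ 2 * ∑ j, b j ^ 6 ≤ 64 * K := by
    have i1 : ∀ j, ((s j : ℝ) - w) ^ 6 ≤ 32 * ((s j : ℝ) ^ 6 + w ^ 6) := fun j => by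
      have := Even.add_pow_le (n := 6) (by decide) (a := (s j : ℝ)) (b := -w)
      rw [Even.neg_pow (by decide)] at this
      norm_num at this
      linarith
    have i2 := Finset.sum_le_sum fun j (_ : j ∈ Finset.univ) => i1 j
    rw [← Finset.mul_sum, Finset.sum_add_distrib, Finset.sum_const, Finset.card_univ,
      Fintype.card_fin, nsmul_eq_mul] at i2
    have i3 : (N : ℝ) ^ 2 * ∑ j, b j ^ 6 = (∑ j, ((s j : ℝ) - w) ^ 6) / N ^ 4 := by
      simp only [hbdef, div_pow, ← Finset.sum_div]
      field_simp
    rw [i3, div_le_iff₀ (by positivity)]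
    linarith
  have hS2 : 0 ≤ ∑ j, b j ^ 2 := Finset.sum_nonneg fun j _ => sq_nonneg _
  have h2b : ∑ j, b j ^ 2 ≤ B := by
    have h := (sum_sq_pow_three_le b).trans hb6
    by_contra! hlt
    have i1 : B ^ 3 < (∑ j, b j ^ 2) ^ 3 := by gcongr
    have i2 : 1 ≤ B := by simp only [B]; linarith
    have i3 : 64 * K = B - 1 := by simp [B]
    nlinarith [mul_le_mul i2 i2 zero_le_one (by linarith)]
  have h4b : N * ∑ j, b j ^ 4 ≤ B := by
    have i1 := Finset.sum_mul_sq_le_sq_mul_sq Finset.univ b (fun j => b j ^ 3)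
    simp only [← pow_succ', ← pow_mul] at i1
    norm_num at i1
    refine abs_le_of_sq_le_sq' ?_ (by positivity) |>.2
    calc ((N : ℝ) * ∑ j, b j ^ 4) ^ 2 = N ^ 2 * (∑ j, b j ^ 4) ^ 2 := mul_pow _ _ _
      _ ≤ N ^ 2 * ((∑ j, b j ^ 2) * ∑ j, b j ^ 6) := by gcongr
      _ = (∑ j, b j ^ 2) * (N ^ 2 * ∑ j, b j ^ 6) := by ring
      _ ≤ B * B := by
        have i6 : 0 ≤ N ^ 2 * ∑ j, b j ^ 6 :=
          mul_nonneg (by positivity) (Finset.sum_nonneg fun j _ => by positivity)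
        exact mul_le_mul h2b (by simp only [B]; linarith) i6 (by positivity)
      _ = B ^ 2 := (sq B).symm
  have hcosh : Real.exp ((N * ∑ j, b j ^ 2 + w ^ 2) / 2 - 2 * B)
      ≤ ∏ e : Edge N, Real.cosh (b e.1.1 + b e.1.2) := by
    have i1 : ∑ e : Edge N, (b e.1.1 + b e.1.2) ^ 4 ≤ 8 * (N * ∑ j, b j ^ 4) := by
      calc _ ≤ ∑ e : Edge N, 8 * (b e.1.1 ^ 4 + b e.1.2 ^ 4) := Finset.sum_le_sum fun e _ => by
            have := Even.add_pow_le (n := 4) (by decide) (a := b e.1.1) (b := b e.1.2)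
            norm_num at this
            exact this
        _ ≤ _ := by
            rw [← Finset.mul_sum]
            have := sum_edge_add_le (fun j => b j ^ 4) (fun j => by positivity)
            linarith
    have i2 : ∑ e : Edge N, ((b e.1.1 + b e.1.2) ^ 2 / 2 - (b e.1.1 + b e.1.2) ^ 4 / 8)
        = ((N - 2) * ∑ j, b j ^ 2 + w ^ 2) / 2 - (∑ e : Edge N, (b e.1.1 + b e.1.2) ^ 4) / 8 := by
      rw [Finset.sum_sub_distrib, ← Finset.sum_div, ← Finset.sum_div, sum_edge_add_sq, hsum]
    calc _ ≤ Real.exp (∑ e : Edge N, ((b e.1.1 + b e.1.2) ^ 2 / 2 - (b e.1.1 + b e.1.2) ^ 4 / 8)) := by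
          rw [i2]; exact Real.exp_le_exp.mpr (by linarith)
      _ ≤ _ := by
          rw [Real.exp_sum]
          exact Finset.prod_le_prod (fun e _ => (Real.exp_pos _).le)
            fun e _ => exp_half_sq_sub_le_cosh _
  have hp : 0 < ∏ j : Fin N, 2 * boxLen j :=
    Finset.prod_pos fun j _ => mul_pos two_pos (boxLen_pos j)
  rw [← mul_le_mul_iff_left₀ hp, signCount_fourier_re hN0 b s h1 h2]
  have hI := h (by omega) hsb hb6
  have e3 := sqrt_pow_mul_prod_boxLen hN0
  have hexp : -(v ^ 2 / 2 + (∑ j, ((s j : ℝ) - v) ^ 2) / (2 * N))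
      ≤ -(∑ j, (s j : ℝ) * b j) + (N * ∑ j, b j ^ 2 + w ^ 2) / 2 := by
    have i1 : ∑ j, (s j : ℝ) * b j = N * ∑ j, b j ^ 2 + w ^ 2 := by
      rw [Finset.mul_sum, sq w]
      nth_rewrite 2 [← hsum]
      rw [Finset.mul_sum, ← Finset.sum_add_distrib]
      refine Finset.sum_congr rfl fun j _ => ?_
      rw [hsb j, hsum]
      ring
    have i2 : N * ∑ j, b j ^ 2 = (∑ j, ((s j : ℝ) - w) ^ 2) / N := by
      simp only [hbdef, div_pow, ← Finset.sum_div]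
      field_simp
    have i3 := sum_sub_sq_add_sq_le hN0 (fun j => (s j : ℝ)) v
    rw [← hw] at i3
    rw [i1, i2]
    have i4 : (∑ j, ((s j : ℝ) - w) ^ 2) / (2 * N) = (∑ j, ((s j : ℝ) - w) ^ 2) / N / 2 := by
      field_simp
    linarith
  calc _ = 2 * c * Real.exp (-(2 * B)) * √(2 / (Real.pi * N)) ^ N
        * (∏ j : Fin N, 2 * boxLen j)
        * Real.exp (-(v ^ 2 / 2 + (∑ j, ((s j : ℝ) - v) ^ 2) / (2 * N))) := by ring
    _ = c * √(2 * Real.pi / N) ^ N * Real.exp (-(2 * B))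
        * Real.exp (-(v ^ 2 / 2 + (∑ j, ((s j : ℝ) - v) ^ 2) / (2 * N))) := by
        linear_combination (-1 / 2) * (c * Real.exp (-(2 * B))
          * Real.exp (-(v ^ 2 / 2 + (∑ j, ((s j : ℝ) - v) ^ 2) / (2 * N)))) * e3
    _ ≤ c * √(2 * Real.pi / N) ^ N * Real.exp (-(2 * B))
        * Real.exp (-(∑ j, (s j : ℝ) * b j) + (N * ∑ j, b j ^ 2 + w ^ 2) / 2) := by gcongr
    _ = Real.exp (-(∑ j, (s j : ℝ) * b j)) * Real.exp ((N * ∑ j, b j ^ 2 + w ^ 2) / 2 - 2 * B)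
        * (c * √(2 * Real.pi / N) ^ N) := by
        rw [Real.exp_add, sub_eq_add_neg, Real.exp_add]; ring
    _ ≤ _ := by gcongr

theorem continuous_gaussianPDFReal : Continuous (gaussianPDFReal 0 1) := by
  unfold gaussianPDFReal; fun_prop

theorem gaussTail_eq_integral (t : ℝ) : gaussTail t = ∫ x in Set.Ioi t, gaussianPDFReal 0 1 x := by
  have h : (gaussianReal 0 1) {x | t ≤ x} = (gaussianReal 0 1) (Set.Ioi t) := by
    have := nullSingletonClass_gaussianReal (μ := 0) (v := 1) one_ne_zero
    exact (Ioi_ae_eq_Ici (μ := gaussianReal 0 1) (a := t)).symm.measure_eq ▸ rfl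
  rw [gaussTail, h, gaussianReal_apply_eq_integral 0 one_ne_zero, ENNReal.toReal_ofReal]
  exact setIntegral_nonneg measurableSet_Ioi fun x _ => gaussianPDFReal_nonneg 0 1 x

theorem gaussTail_pos (t : ℝ) : 0 < gaussTail t := by
  rw [gaussTail_eq_integral]
  rw [setIntegral_pos_iff_support_of_nonneg_ae]
  · have : Function.support (gaussianPDFReal 0 1) = Set.univ := by
      ext x; simp [(gaussianPDFReal_pos 0 1 x one_ne_zero).ne']
    simp [this]
  · exact Filter.Eventually.of_forall fun x => gaussianPDFReal_nonneg 0 1 x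
  · exact (integrable_gaussianPDFReal 0 1).integrableOn

theorem gaussTail_le_one (t : ℝ) : gaussTail t ≤ 1 := measureReal_le_one

theorem gaussTail_antitone : Antitone gaussTail := fun a b h => by
  refine ENNReal.toReal_mono (measure_ne_top _ _) (measure_mono fun x hx => ?_)
  exact h.trans hx

theorem hasDerivAt_gaussTail (t : ℝ) : HasDerivAt gaussTail (-gaussianPDFReal 0 1 t) t := by
  have hi : ∀ u, IntegrableOn (gaussianPDFReal 0 1) (Set.Ioi u) := fun u =>
    (integrable_gaussianPDFReal 0 1).integrableOn
  have h : gaussTail = fun u => gaussTail 0 - ∫ x in (0 : ℝ)..u, gaussianPDFReal 0 1 x := by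
    ext u
    rw [gaussTail_eq_integral, gaussTail_eq_integral,
      ← intervalIntegral.integral_interval_add_Ioi (hi 0) (hi u)]
    ring
  rw [h]
  exact (continuous_gaussianPDFReal.integral_hasStrictDerivAt 0 t).hasDerivAt.const_sub _

/-- Monotonicity of the Gaussian hazard rate, in multiplied-out form. -/
theorem gaussianPDFReal_mul_gaussTail_le {x y : ℝ} (h : x ≤ y) :
    gaussianPDFReal 0 1 x * gaussTail y ≤ gaussianPDFReal 0 1 y * gaussTail x := by
  have key : ∀ z, gaussTail z = ∫ u in Set.Ioi (0 : ℝ), gaussianPDFReal 0 1 (u + z) := fun z => by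
    have h := (measurePreserving_add_right volume z).setIntegral_preimage_emb
      (measurableEmbedding_addRight z) (gaussianPDFReal 0 1) (Set.Ioi z)
    rw [gaussTail_eq_integral, ← h]
    simp
  rw [key, key, ← integral_const_mul, ← integral_const_mul]
  refine setIntegral_mono_on ?_ ?_ measurableSet_Ioi fun u hu => ?_
  · exact (((integrable_gaussianPDFReal 0 1).comp_add_right y).const_mul _).integrableOn
  · exact (((integrable_gaussianPDFReal 0 1).comp_add_right x).const_mul _).integrableOn
  · simp only [gaussianPDFReal, sub_zero, NNReal.coe_one, mul_one]
    have hu' : 0 < u := hu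
    have : Real.exp (-x ^ 2 / 2) * Real.exp (-(u + y) ^ 2 / 2)
        ≤ Real.exp (-y ^ 2 / 2) * Real.exp (-(u + x) ^ 2 / 2) := by
      rw [← Real.exp_add, ← Real.exp_add]
      exact Real.exp_le_exp.mpr (by nlinarith)
    have h2 : 0 ≤ (√(2 * Real.pi))⁻¹ ^ 2 := by positivity
    calc _ = (√(2 * Real.pi))⁻¹ ^ 2 * (Real.exp (-x ^ 2 / 2) * Real.exp (-(u + y) ^ 2 / 2)) := by ring
      _ ≤ (√(2 * Real.pi))⁻¹ ^ 2 * (Real.exp (-y ^ 2 / 2) * Real.exp (-(u + x) ^ 2 / 2)) := by gcongr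
      _ = _ := by ring

theorem concaveOn_log_gaussTail : ConcaveOn ℝ Set.univ fun t => Real.log (gaussTail t) := by
  have hd : ∀ t, HasDerivAt (fun t => Real.log (gaussTail t)) (-gaussianPDFReal 0 1 t / gaussTail t) t :=
    fun t => (hasDerivAt_gaussTail t).log (gaussTail_pos t).ne'
  refine Antitone.concaveOn_univ_of_deriv (fun t => (hd t).differentiableAt) fun x y h => ?_
  rw [(hd x).deriv, (hd y).deriv, neg_div, neg_div, neg_le_neg_iff,
    div_le_div_iff₀ (gaussTail_pos x) (gaussTail_pos y)]
  exact gaussianPDFReal_mul_gaussTail_le h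

/-- The exponent `F1` attains its supremum at a bounded point and decays quadratically from it. -/
theorem exists_F1_maximizer {γ : ℝ} (hγ : |γ| ≤ 1) : ∃ α₀ : ℝ,
    α₀ ^ 2 ≤ -Real.log (gaussTail √2) ∧ ⨆ α, F1 γ α = F1 γ α₀ ∧
      ∀ α, F1 γ α ≤ F1 γ α₀ - (α - α₀) ^ 2 := by
  set A := -Real.log (gaussTail √2) with hA
  have hA0 : 0 ≤ A := by
    have := Real.log_nonpos (gaussTail_pos √2).le (gaussTail_le_one √2)
    linarith
  have hcont : Continuous (F1 γ) := by
    have : Continuous gaussTail :=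
      continuous_iff_continuousAt.mpr fun t => (hasDerivAt_gaussTail t).continuousAt
    unfold F1
    refine (by fun_prop : Continuous fun α : ℝ => Real.log 2 - α ^ 2).add ?_
    exact (this.comp (by fun_prop)).log fun α => (gaussTail_pos _).ne'
  have hle : ∀ α, F1 γ α ≤ Real.log 2 - α ^ 2 := fun α => by
    have := Real.log_nonpos (gaussTail_pos ((γ + α) * √2)).le (gaussTail_le_one _)
    unfold F1; linarith
  have h0 : Real.log 2 - A ≤ F1 γ 0 := by
    have h1 : gaussTail √2 ≤ gaussTail ((γ + 0) * √2) := gaussTail_antitone (by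
      have := (abs_le.mp hγ).2
      nlinarith [Real.sqrt_nonneg 2])
    have := Real.log_le_log (gaussTail_pos _) h1
    unfold F1; linarith
  obtain ⟨α₀, hmem, hmax⟩ := (isCompact_Icc (a := -√A) (b := √A)).exists_isMaxOn
    ⟨0, by simp⟩ hcont.continuousOn
  have hmax' : ∀ α, F1 γ α ≤ F1 γ α₀ := fun α => by
    by_cases h : α ∈ Set.Icc (-√A) √A
    · exact hmax h
    · have h2 : A < α ^ 2 := by
        by_contra! h3
        exact h (abs_le.mp (Real.abs_le_sqrt h3))
      have h3 : F1 γ 0 ≤ F1 γ α₀ := hmax (by simp)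
      linarith [hle α]
  refine ⟨α₀, ?_, ?_, fun α => ?_⟩
  · have := sq_le_sq' hmem.1 hmem.2
    rwa [Real.sq_sqrt hA0] at this
  · exact le_antisymm (ciSup_le hmax') (le_ciSup (f := F1 γ) ⟨F1 γ α₀, by rintro _ ⟨α, rfl⟩; exact hmax' α⟩ α₀)
  · have hconc : ∀ l : ℝ, 0 < l → l < 1 →
        F1 γ α + (1 - l) * (α - α₀) ^ 2 ≤ F1 γ α₀ := fun l hl0 hl1 => by
      have h1 := concaveOn_log_gaussTail.2 (Set.mem_univ ((γ + α₀) * √2))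
        (Set.mem_univ ((γ + α) * √2)) (by linarith : 0 ≤ 1 - l) hl0.le (by ring)
      have h2 := hmax' ((1 - l) * α₀ + l * α)
      have e : (1 - l) • ((γ + α₀) * √2) + l • ((γ + α) * √2)
          = (γ + ((1 - l) * α₀ + l * α)) * √2 := by simp only [smul_eq_mul]; ring
      rw [e] at h1
      simp only [smul_eq_mul] at h1
      unfold F1 at h2 ⊢
      set p := Real.log (gaussTail ((γ + α₀) * √2))
      set q := Real.log (gaussTail ((γ + α) * √2))
      refine le_of_mul_le_mul_left ?_ hl0
      nlinarith
    have hlim : Filter.Tendsto (fun l : ℝ => F1 γ α + (1 - l) * (α - α₀) ^ 2)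
        (nhdsWithin 0 (Set.Ioi 0)) (nhds (F1 γ α + (1 - 0) * (α - α₀) ^ 2)) := by
      refine Filter.Tendsto.mono_left (Continuous.tendsto (by fun_prop) 0) nhdsWithin_le_nhds
    have := le_of_tendsto hlim (by
      filter_upwards [Ioo_mem_nhdsGT (zero_lt_one' ℝ)] with l hl using hconc l hl.1 hl.2)
    linarith

theorem integral_Ioi_comp_add_right {f : ℝ → ℝ} (a z : ℝ) :
    ∫ x in Set.Ioi a, f (x + z) = ∫ x in Set.Ioi (a + z), f x := by
  have h := (measurePreserving_add_right volume z).setIntegral_preimage_emb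
    (measurableEmbedding_addRight z) f (Set.Ioi (a + z))
  rw [← h]
  simp

theorem integral_Ioi_exp_neg_sq {v : ℝ} (hv : 0 < v) (a w : ℝ) :
    ∫ x in Set.Ioi a, Real.exp (-(x - w) ^ 2 / (2 * v)) = √(2 * Real.pi * v) * gaussTail ((a - w) / √v) := by
  have hs : 0 < √v := Real.sqrt_pos.mpr hv
  have h1 := integral_Ioi_comp_add_right (f := fun x => Real.exp (-(x - w) ^ 2 / (2 * v))) (a - w) w
  have h2 := integral_comp_mul_right_Ioi (fun x => Real.exp (-x ^ 2 / (2 * v))) ((a - w) / √v) hs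
  simp only [sub_add_cancel, add_sub_cancel_right] at h1
  rw [div_mul_cancel₀ _ hs.ne'] at h2
  rw [← h1, gaussTail_eq_integral]
  have h3 : ∀ x, gaussianPDFReal 0 1 x = (√(2 * Real.pi))⁻¹ * Real.exp (-(x * √v) ^ 2 / (2 * v)) := fun x => by
    rw [gaussianPDFReal, mul_pow, Real.sq_sqrt hv.le]
    simp only [sub_zero, NNReal.coe_one, mul_one]
    congr 2
    field_simp
  simp only [h3]
  rw [integral_const_mul, h2, smul_eq_mul, Real.sqrt_mul (by positivity)]
  have : √(2 * Real.pi) ≠ 0 := by positivity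
  field_simp

theorem integrable_exp_neg_sub_sq {v : ℝ} (hv : 0 < v) (w : ℝ) :
    Integrable fun x : ℝ => Real.exp (-(x - w) ^ 2 / (2 * v)) := by
  have h := (integrable_exp_neg_mul_sq (b := 1 / (2 * v)) (by positivity)).comp_sub_right w
  refine h.congr (Filter.Eventually.of_forall fun x => ?_)
  simp only
  congr 1; ring

theorem exp_neg_sq_le_integral {v : ℝ} (hv : 0 < v) (y : ℝ) :
    Real.exp (-y ^ 2 / (2 * v)) ≤ Real.exp (1 / (2 * v))
      * ((∫ u in (-1 : ℝ)..1, Real.exp (-(u + y) ^ 2 / (2 * v))) / 2) := by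
  have h : ∫ u in (-1 : ℝ)..1, Real.exp (-y ^ 2 / (2 * v) - 1 / (2 * v)) * (1 - u * (y / v))
      ≤ ∫ u in (-1 : ℝ)..1, Real.exp (-(u + y) ^ 2 / (2 * v)) := by
    refine intervalIntegral.integral_mono_on (by norm_num)
      (Continuous.intervalIntegrable (by fun_prop) _ _) (Continuous.intervalIntegrable (by fun_prop) _ _)
      fun u hu => ?_
    have h1 : 1 - u * (y / v) ≤ Real.exp (-(u * (y / v))) := by
      linarith [Real.add_one_le_exp (-(u * (y / v)))]
    calc _ ≤ Real.exp (-y ^ 2 / (2 * v) - 1 / (2 * v)) * Real.exp (-(u * (y / v))) := by gcongr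
      _ = Real.exp (-(1 + 2 * u * y + y ^ 2) / (2 * v)) := by
        rw [← Real.exp_add]; congr 1; field_simp; ring
      _ ≤ _ := by
        have : u ^ 2 ≤ 1 := by nlinarith [hu.1, hu.2]
        gcongr
        nlinarith
  have e : ∫ u in (-1 : ℝ)..1, Real.exp (-y ^ 2 / (2 * v) - 1 / (2 * v)) * (1 - u * (y / v))
      = 2 * Real.exp (-y ^ 2 / (2 * v) - 1 / (2 * v)) := by
    rw [intervalIntegral.integral_const_mul, intervalIntegral.integral_sub (by simp)
      (Continuous.intervalIntegrable (by fun_prop) _ _), intervalIntegral.integral_mul_const]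
    simp
    norm_num
    ring
  rw [e, Real.exp_sub] at h
  have h1 : 0 < Real.exp (1 / (2 * v)) := Real.exp_pos _
  have h2 : Real.exp (-y ^ 2 / (2 * v)) / Real.exp (1 / (2 * v))
      ≤ (∫ u in (-1 : ℝ)..1, Real.exp (-(u + y) ^ 2 / (2 * v))) / 2 := by linarith
  rwa [div_le_iff₀ h1, mul_comm (_ / 2)] at h2

theorem integral_exp_neg_mul_sq_le {p q : ℝ} (y : ℝ) (hp : q ≤ p - 2 * p ^ 2) (hq : 0 ≤ p) :
    (∫ u in (-1 : ℝ)..1, Real.exp (-(p * (u + y) ^ 2))) / 2 ≤ Real.exp (-(q * y ^ 2)) := by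
  set a := -(2 * p * y) with ha
  have h : ∫ u in (-1 : ℝ)..1, Real.exp (-(p * (u + y) ^ 2))
      ≤ ∫ u in (-1 : ℝ)..1, Real.exp (-(p * y ^ 2)) * ((1 + u) / 2 * Real.exp a + (1 - u) / 2 * Real.exp (-a)) := by
    refine intervalIntegral.integral_mono_on (by norm_num)
      (Continuous.intervalIntegrable (by fun_prop) _ _) (Continuous.intervalIntegrable (by fun_prop) _ _)
      fun u hu => ?_
    have h1 := convexOn_exp.2 (Set.mem_univ a) (Set.mem_univ (-a))
      (by linarith [hu.1] : 0 ≤ (1 + u) / 2) (by linarith [hu.2] : 0 ≤ (1 - u) / 2) (by ring)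
    simp only [smul_eq_mul] at h1
    refine le_trans ?_ (mul_le_mul_of_nonneg_left h1 (Real.exp_pos _).le)
    rw [← Real.exp_add]
    refine Real.exp_le_exp.mpr ?_
    rw [ha]
    nlinarith [mul_nonneg hq (sq_nonneg u)]
  have e : ∫ u in (-1 : ℝ)..1, Real.exp (-(p * y ^ 2)) * ((1 + u) / 2 * Real.exp a + (1 - u) / 2 * Real.exp (-a))
      = 2 * (Real.exp (-(p * y ^ 2)) * Real.cosh a) := by
    have e1 : ∀ u : ℝ, Real.exp (-(p * y ^ 2)) * ((1 + u) / 2 * Real.exp a + (1 - u) / 2 * Real.exp (-a))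
        = Real.exp (-(p * y ^ 2)) * Real.cosh a + u * (Real.exp (-(p * y ^ 2)) * Real.sinh a) := fun u => by
      rw [Real.cosh_eq, Real.sinh_eq]; ring
    simp only [e1]
    rw [intervalIntegral.integral_add (by simp) (Continuous.intervalIntegrable (by fun_prop) _ _),
      intervalIntegral.integral_mul_const]
    simp
    norm_num
    ring
  rw [e] at h
  have h2 : Real.exp (-(p * y ^ 2)) * Real.cosh a ≤ Real.exp (-(q * y ^ 2)) := by
    calc _ ≤ Real.exp (-(p * y ^ 2)) * Real.exp (a ^ 2 / 2) := by
          gcongr; exact Real.cosh_le_exp_half_sq a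
      _ = Real.exp (-(p - 2 * p ^ 2) * y ^ 2) := by
          rw [← Real.exp_add, ha]; congr 1; ring
      _ ≤ _ := Real.exp_le_exp.mpr (by nlinarith [mul_le_mul_of_nonneg_right hp (sq_nonneg y)])
  linarith

theorem sum_integral_cells {f : ℝ → ℝ} (hf : Continuous f) (a : ℝ) (m : ℕ) :
    ∑ i ∈ Finset.range m, ∫ u in (-1 : ℝ)..1, f (u + (a + 1 + 2 * i)) = ∫ x in a..(a + 2 * m), f x := by
  have h := intervalIntegral.sum_integral_adjacent_intervals (μ := volume) (f := f) (n := m)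
    (a := fun i : ℕ => a + 2 * (i : ℝ)) (fun i _ => hf.intervalIntegrable _ _)
  simp only [Nat.cast_zero, mul_zero, add_zero] at h
  rw [← h]
  refine Finset.sum_congr rfl fun i _ => ?_
  rw [intervalIntegral.integral_comp_add_right]
  congr 1 <;> push_cast <;> ring

theorem sum_exp_neg_sq_le {v : ℝ} (hv : 0 < v) (t w : ℝ) (m : ℕ) :
    ∑ i ∈ Finset.range m, Real.exp (-(t + 2 * i - w) ^ 2 / (2 * v))
      ≤ Real.exp (1 / (2 * v)) * (√(2 * Real.pi * v) / 2 * gaussTail ((t - 1 - w) / √v)) := by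
  have hc := sum_integral_cells (f := fun x => Real.exp (-(x - w) ^ 2 / (2 * v))) (by fun_prop) (t - 1) m
  have h1 : ∫ x in (t - 1)..(t - 1 + 2 * m), Real.exp (-(x - w) ^ 2 / (2 * v))
      ≤ ∫ x in Set.Ioi (t - 1), Real.exp (-(x - w) ^ 2 / (2 * v)) := by
    rw [intervalIntegral.integral_of_le (by linarith [Nat.cast_nonneg (α := ℝ) m])]
    exact setIntegral_mono_set (integrable_exp_neg_sub_sq hv w).integrableOn
      (Filter.Eventually.of_forall fun x => (Real.exp_pos _).le)
      (Filter.Eventually.of_forall fun x hx => hx.1)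
  rw [integral_Ioi_exp_neg_sq hv] at h1
  calc _ ≤ ∑ i ∈ Finset.range m, Real.exp (1 / (2 * v)) * ((∫ u in (-1 : ℝ)..1,
        Real.exp (-(u + (t - 1 + 1 + 2 * i) - w) ^ 2 / (2 * v))) / 2) := by
        refine Finset.sum_le_sum fun i _ => (exp_neg_sq_le_integral hv _).trans_eq ?_
        congr 3
        ext u
        congr 1; ring
    _ = Real.exp (1 / (2 * v)) * ((∫ x in (t - 1)..(t - 1 + 2 * m), Real.exp (-(x - w) ^ 2 / (2 * v))) / 2) := by
        rw [← hc, ← Finset.mul_sum, ← Finset.sum_div]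
    _ ≤ _ := by
        gcongr
        linarith

theorem sum_exp_neg_sq_ge {v : ℝ} (hv : 8 ≤ v) (t w : ℝ) (m : ℕ) (hm : v ≤ t - 1 - w + 2 * m) :
    √(2 * Real.pi * v) / 2 * (gaussTail ((t - 1 - w) / √v) - 12 / v)
      ≤ ∑ i ∈ Finset.range m, Real.exp (-(t + 2 * i - w) ^ 2 / (2 * v)) := by
  have hv0 : 0 < v := by linarith
  set p := 1 / (2 * v) + 1 / v ^ 2 with hp
  have hpq : 1 / (2 * v) ≤ p - 2 * p ^ 2 := by
    have : p - 2 * p ^ 2 - 1 / (2 * v) = (v ^ 2 - 4 * v - 4) / (2 * v ^ 4) := by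
      rw [hp]; field_simp; ring
    have h2 : 0 ≤ (v ^ 2 - 4 * v - 4) / (2 * v ^ 4) := div_nonneg (by nlinarith) (by positivity)
    linarith
  have hc := sum_integral_cells (f := fun x => Real.exp (-(p * (x - w) ^ 2))) (by fun_prop) (t - 1) m
  have h1 : (∫ x in (t - 1)..(t - 1 + 2 * m), Real.exp (-(p * (x - w) ^ 2))) / 2
      ≤ ∑ i ∈ Finset.range m, Real.exp (-(t + 2 * i - w) ^ 2 / (2 * v)) := by
    rw [← hc, Finset.sum_div]
    refine Finset.sum_le_sum fun i _ => ?_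
    refine le_trans (le_of_eq ?_) ((integral_exp_neg_mul_sq_le (t + 2 * i - w) hpq (by positivity)).trans_eq ?_)
    · congr 2
      ext u
      congr 1; ring
    · congr 1; ring
  set g : ℝ → ℝ := fun x => Real.exp (-(x - w) ^ 2 / (2 * v)) with hg
  have hgi : Integrable g := integrable_exp_neg_sub_sq hv0 w
  have hle : ∀ x, (x - w) ^ 2 * g x ≤ 4 * v * Real.exp (-(x - w) ^ 2 / (2 * (2 * v))) := fun x => by
    have := pow_mul_exp_neg_le 1 (c := 1 / (4 * v)) (by positivity) (sq_nonneg (x - w))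
    simp only [pow_one, Nat.factorial_one, Nat.cast_one] at this
    calc _ = (x - w) ^ 2 * Real.exp (-(2 * (1 / (4 * v))) * (x - w) ^ 2) := by
          simp only [hg]; congr 2; field_simp; ring
      _ ≤ _ := this
      _ = _ := by
          congr 1
          · field_simp
          · congr 1; field_simp; ring
  have hi2 := (integrable_exp_neg_sub_sq (v := 2 * v) (by positivity) w).const_mul (4 * v)
  have hgi2 : Integrable fun x => (x - w) ^ 2 * g x :=
    hi2.mono' (by fun_prop) (Filter.Eventually.of_forall fun x => by
      rw [Real.norm_of_nonneg (by positivity)]; exact hle x)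
  have hq : ∫ x in Set.Ioi (t - 1), (x - w) ^ 2 * g x ≤ 6 * v * √(2 * Real.pi * v) := by
    calc _ ≤ ∫ x in Set.Ioi (t - 1), 4 * v * Real.exp (-(x - w) ^ 2 / (2 * (2 * v))) :=
          setIntegral_mono hgi2.integrableOn hi2.integrableOn hle
      _ = 4 * v * (√(2 * Real.pi * (2 * v)) * gaussTail ((t - 1 - w) / √(2 * v))) := by
          rw [integral_const_mul, integral_Ioi_exp_neg_sq (by positivity)]
      _ ≤ 4 * v * (√(2 * Real.pi * (2 * v)) * 1) := by
          gcongr; exact gaussTail_le_one _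
      _ ≤ _ := by
          rw [show 2 * Real.pi * (2 * v) = 2 * (2 * Real.pi * v) by ring, Real.sqrt_mul (by norm_num)]
          have : √2 ≤ 3 / 2 := Real.sqrt_le_iff.mpr (by norm_num)
          have h0 : 0 ≤ v * √(2 * Real.pi * v) := by positivity
          nlinarith
  set R := t - 1 + 2 * (m : ℝ) with hR
  have hAB : t - 1 ≤ R := by linarith [Nat.cast_nonneg (α := ℝ) m]
  have hFi : Integrable fun x => g x - 2 / v ^ 2 * ((x - w) ^ 2 * g x) := hgi.sub (hgi2.const_mul _)
  have hsplit := intervalIntegral.integral_interval_add_Ioi (a := t - 1) (b := R) (μ := volume)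
    hFi.integrableOn hFi.integrableOn
  have hneg : ∫ x in Set.Ioi R, (g x - 2 / v ^ 2 * ((x - w) ^ 2 * g x)) ≤ 0 := by
    refine setIntegral_nonpos measurableSet_Ioi fun x hx => ?_
    have hx' : v ≤ x - w := by
      have : R < x := hx
      linarith
    have h3 : 1 ≤ 2 / v ^ 2 * (x - w) ^ 2 := by
      rw [div_mul_eq_mul_div, le_div_iff₀ (by positivity)]
      nlinarith
    have h4 : 0 ≤ g x := (Real.exp_pos _).le
    nlinarith
  have hpos : ∫ x in (t - 1)..R, (g x - 2 / v ^ 2 * ((x - w) ^ 2 * g x))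
      ≤ ∫ x in (t - 1)..R, Real.exp (-(p * (x - w) ^ 2)) := by
    refine intervalIntegral.integral_mono_on hAB (Continuous.intervalIntegrable (by fun_prop) _ _)
      (Continuous.intervalIntegrable (by fun_prop) _ _) fun x _ => ?_
    have h3 : Real.exp (-(p * (x - w) ^ 2)) = g x * Real.exp (-(1 / v ^ 2 * (x - w) ^ 2)) := by
      rw [hg, ← Real.exp_add, hp]; congr 1; field_simp; ring
    have h4 := Real.add_one_le_exp (-(1 / v ^ 2 * (x - w) ^ 2))
    have h5 : 0 ≤ g x := (Real.exp_pos _).le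
    have h6 : 0 ≤ 1 / v ^ 2 * (x - w) ^ 2 := by positivity
    rw [h3]
    calc _ = g x * (1 - 2 * (1 / v ^ 2 * (x - w) ^ 2)) := by ring
      _ ≤ _ := by gcongr; linarith
  have hval : ∫ x in Set.Ioi (t - 1), (g x - 2 / v ^ 2 * ((x - w) ^ 2 * g x))
      = √(2 * Real.pi * v) * gaussTail ((t - 1 - w) / √v) - 2 / v ^ 2 * ∫ x in Set.Ioi (t - 1), (x - w) ^ 2 * g x := by
    rw [integral_sub hgi.integrableOn (hgi2.const_mul _).integrableOn, integral_const_mul, hg,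
      integral_Ioi_exp_neg_sq hv0]
  have h7 : 2 / v ^ 2 * ∫ x in Set.Ioi (t - 1), (x - w) ^ 2 * g x ≤ 12 / v * √(2 * Real.pi * v) := by
    calc _ ≤ 2 / v ^ 2 * (6 * v * √(2 * Real.pi * v)) := by gcongr
      _ = _ := by field_simp; ring
  nlinarith

theorem sum_pow_six_mul_exp_neg_sq_le {v : ℝ} (hv : 1 ≤ v) (t w : ℝ) (m : ℕ) :
    ∑ i ∈ Finset.range m, (t + 2 * i - w) ^ 6 * Real.exp (-(t + 2 * i - w) ^ 2 / (2 * v))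
      ≤ 1152 * v ^ 3 * √(2 * Real.pi * v) := by
  have hv0 : 0 < v := by linarith
  have hle : ∀ y : ℝ, y ^ 6 * Real.exp (-y ^ 2 / (2 * v)) ≤ 384 * v ^ 3 * Real.exp (-y ^ 2 / (2 * (2 * v))) := fun y => by
    have := pow_mul_exp_neg_le 3 (c := 1 / (4 * v)) (by positivity) (sq_nonneg y)
    calc _ = (y ^ 2) ^ 3 * Real.exp (-(2 * (1 / (4 * v))) * y ^ 2) := by
          rw [← pow_mul]; congr 2; field_simp; ring
      _ ≤ _ := this
      _ = _ := by
          congr 1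
          · norm_num [Nat.factorial]; field_simp; norm_num
          · congr 1; field_simp; ring
  calc _ ≤ ∑ i ∈ Finset.range m, 384 * v ^ 3 * Real.exp (-(t + 2 * i - w) ^ 2 / (2 * (2 * v))) :=
        Finset.sum_le_sum fun i _ => hle _
    _ ≤ 384 * v ^ 3 * (Real.exp (1 / (2 * (2 * v))) * (√(2 * Real.pi * (2 * v)) / 2 * 1)) := by
        rw [← Finset.mul_sum]
        gcongr
        refine (sum_exp_neg_sq_le (by positivity) t w m).trans ?_
        gcongr
        exact gaussTail_le_one _
    _ ≤ _ := by
        rw [show 2 * Real.pi * (2 * v) = 2 * (2 * Real.pi * v) by ring, Real.sqrt_mul (by norm_num)]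
        have h1 : √2 ≤ 2 := Real.sqrt_le_iff.mpr (by norm_num)
        have h2 : Real.exp (1 / (2 * (2 * v))) ≤ 3 := by
          have : 1 / (2 * (2 * v)) ≤ 1 := by rw [div_le_one (by positivity)]; linarith
          linarith [Real.exp_le_exp.mpr this, Real.exp_one_lt_d9]
        calc _ ≤ 384 * v ^ 3 * (3 * (2 * √(2 * Real.pi * v) / 2 * 1)) := by gcongr
          _ = _ := by ring

/-- The number of sign patterns all of whose signed degrees are at least `t`. -/
def friendlyCount (N : ℕ) (t : ℤ) : ℕ :=
  (Finset.univ.filter fun x : Edge N → Bool => ∀ v, t ≤ signSum x v).card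

theorem sum_signCount_le {N : ℕ} {t : ℤ} (S : Finset (Fin N → ℤ)) (hS : ∀ s ∈ S, ∀ v, t ≤ s v) :
    ∑ s ∈ S, signCount s ≤ friendlyCount N t := by
  unfold signCount friendlyCount
  rw [← Finset.card_biUnion]
  · refine Finset.card_le_card fun x hx => ?_
    simp only [Finset.mem_biUnion, Finset.mem_filter, Finset.mem_univ, true_and] at hx ⊢
    obtain ⟨s, hs, rfl⟩ := hx
    exact hS _ hs
  · intro s _ s' _ hne
    rw [Function.onFun, Finset.disjoint_left]
    intro x hx hx'
    simp only [Finset.mem_filter, Finset.mem_univ, true_and] at hx hx'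
    exact hne (hx.symm.trans hx')

theorem sum_piFinset_weight_ge {N : ℕ} (hN : Even N) {ι : Type*} (R : Finset ι) (σ p u : ι → ℝ)
    (hp : ∀ i ∈ R, 0 ≤ p i) (hσ : ∀ i, σ i = 1 ∨ σ i = -1) (hu : ∀ i, 0 ≤ u i) {M : ℝ} (hM : 0 < M)
    (h : N * ∑ i ∈ R, u i * p i ≤ M / 4 * ∑ i ∈ R, p i) :
    (∑ i ∈ R, p i) ^ N / 4 ≤ ∑ f ∈ (Fintype.piFinset fun _ : Fin N => R).filter
      (fun f => ∏ j, σ (f j) = 1 ∧ ∑ j, u (f j) ≤ M), ∏ j, p (f j) := by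
  classical
  set P := Fintype.piFinset fun _ : Fin N => R with hP
  set Q := ∑ i ∈ R, p i with hQ
  have hQ0 : 0 ≤ Q := Finset.sum_nonneg hp
  have hpp : ∀ f ∈ P, 0 ≤ ∏ j, p (f j) := fun f hf =>
    Finset.prod_nonneg fun j _ => hp _ (Fintype.mem_piFinset.mp hf j)
  have s1 : ∑ f ∈ P, ∏ j, p (f j) = Q ^ N := by
    rw [hP, ← Finset.prod_univ_sum (fun _ : Fin N => R) (fun _ i => p i)]
    simp [hQ]
  have s2 : ∑ f ∈ P, (∏ j, σ (f j)) * ∏ j, p (f j) = (∑ i ∈ R, σ i * p i) ^ N := by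
    simp only [← Finset.prod_mul_distrib]
    rw [hP, ← Finset.prod_univ_sum (fun _ : Fin N => R) (fun _ i => σ i * p i)]
    simp
  have s3 : ∑ f ∈ P, (∑ j, u (f j)) * ∏ j, p (f j) ≤ M / 4 * Q ^ N := by
    have e1 : ∀ k : Fin N, ∑ f ∈ P, u (f k) * ∏ j, p (f j) = (∑ i ∈ R, u i * p i) * Q ^ (N - 1) := fun k => by
      have e2 : ∀ f : Fin N → ι, u (f k) * ∏ j, p (f j) = ∏ j, (if j = k then u (f j) else 1) * p (f j) := fun f => by
        rw [Finset.prod_mul_distrib, Finset.prod_ite_eq' Finset.univ k]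
        simp
      simp only [e2]
      rw [hP, ← Finset.prod_univ_sum (fun _ : Fin N => R) (fun j i => (if j = k then u i else 1) * p i),
        ← Finset.mul_prod_erase _ _ (Finset.mem_univ k)]
      congr 1
      · simp
      · rw [Finset.prod_congr rfl (g := fun _ => Q) fun j hj => by simp [Finset.ne_of_mem_erase hj, hQ]]
        simp
    simp only [Finset.sum_mul]
    rw [Finset.sum_comm]
    simp only [e1]
    rw [Finset.sum_const, Finset.card_univ, Fintype.card_fin, nsmul_eq_mul]
    rcases Nat.eq_zero_or_pos N with rfl | hN0
    · simp; positivity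
    calc _ = (N * ∑ i ∈ R, u i * p i) * Q ^ (N - 1) := by ring
      _ ≤ (M / 4 * Q) * Q ^ (N - 1) := by gcongr
      _ = M / 4 * Q ^ N := by rw [mul_assoc, mul_pow_sub_one hN0.ne']
  have hσ' : ∀ f : Fin N → ι, ∏ j, σ (f j) = 1 ∨ ∏ j, σ (f j) = -1 := fun f => by
    refine Finset.prod_induction _ (fun x : ℝ => x = 1 ∨ x = -1) ?_ (Or.inl rfl) fun j _ => hσ _
    rintro a b (rfl | rfl) (rfl | rfl) <;> norm_num
  rw [Finset.sum_filter]
  have hpt : ∀ f ∈ P, (1 / 2 + (∏ j, σ (f j)) / 2 - (∑ j, u (f j)) / M) * ∏ j, p (f j)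
      ≤ if ∏ j, σ (f j) = 1 ∧ ∑ j, u (f j) ≤ M then ∏ j, p (f j) else 0 := fun f hf => by
    have h0 := hpp f hf
    have hu0 : 0 ≤ (∑ j, u (f j)) / M := div_nonneg (Finset.sum_nonneg fun j _ => hu _) hM.le
    split_ifs with hc
    · rw [hc.1]
      exact mul_le_of_le_one_left h0 (by linarith)
    · refine mul_nonpos_of_nonpos_of_nonneg ?_ h0
      rcases hσ' f with h1 | h1
      · have h2 : M < ∑ j, u (f j) := by
          by_contra! h3
          exact hc ⟨h1, h3⟩
        have h4 : 1 ≤ (∑ j, u (f j)) / M := by rw [le_div_iff₀ hM]; linarith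
        rw [h1]; linarith
      · rw [h1]; linarith
  refine le_trans ?_ (Finset.sum_le_sum hpt)
  have e5 : ∑ f ∈ P, (1 / 2 + (∏ j, σ (f j)) / 2 - (∑ j, u (f j)) / M) * ∏ j, p (f j)
      = (∑ f ∈ P, ∏ j, p (f j)) / 2 + (∑ f ∈ P, (∏ j, σ (f j)) * ∏ j, p (f j)) / 2
        - (∑ f ∈ P, (∑ j, u (f j)) * ∏ j, p (f j)) / M := by
    rw [Finset.sum_div, Finset.sum_div, Finset.sum_div, ← Finset.sum_add_distrib, ← Finset.sum_sub_distrib]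
    exact Finset.sum_congr rfl fun f _ => by ring
  rw [e5, s1, s2]
  have h6 : 0 ≤ (∑ i ∈ R, σ i * p i) ^ N := hN.pow_nonneg _
  have h7 : (∑ f ∈ P, (∑ j, u (f j)) * ∏ j, p (f j)) / M ≤ Q ^ N / 4 := by
    rw [div_le_iff₀ hM]; linarith
  linarith

set_option maxHeartbeats 1000000 in
theorem friendlyCount_ge {W τ : ℝ} (hW : 0 ≤ W) (hτ : 0 < τ) : ∃ c, 0 < c ∧ ∃ n₀ : ℕ, ∀ n, n₀ ≤ n →
    ∀ (z : ℤ) (w : ℝ), w ^ 2 ≤ W * n → τ ≤ gaussTail ((2 * z - w) / √(2 * n)) →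
    c * (Real.exp (-(w ^ 2 / 2)) * gaussTail ((2 * z - w) / √(2 * n)) ^ (2 * n))
      ≤ friendlyCount (2 * n) (2 * z + 1) / 2 ^ (2 * n).choose 2 := by
  set C := 32 * (1152 * (4 / τ) + W ^ 3) with hC
  have hC0 : 0 ≤ C := by positivity
  obtain ⟨c, hc, N₁, hge⟩ := signCount_ge (4 * C + 1) (by positivity)
  obtain ⟨n₁, hn₁⟩ := exists_nat_ge (24 / τ)
  refine ⟨c * Real.exp (-(24 / τ)) / 4, by positivity, N₁ + n₁ + 4, fun n hn z w hw hT => ?_⟩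
  set N := 2 * n with hN
  have hNr : (N : ℝ) = 2 * n := by rw [hN]; push_cast; ring
  rw [← hNr] at hT ⊢
  have hn1 : 24 / τ ≤ n := hn₁.trans (by exact_mod_cast (by omega : n₁ ≤ n))
  have hN8 : (8 : ℝ) ≤ N := by exact_mod_cast (by omega : 8 ≤ N)
  have hN0 : (0 : ℝ) < N := by linarith
  set T := gaussTail ((2 * z - w) / √N) with hTdef
  obtain ⟨m, hm⟩ := exists_nat_ge (N - 2 * z + w)
  set p : ℕ → ℝ := fun i => Real.exp (-((2 * z + 1 : ℝ) + 2 * i - w) ^ 2 / (2 * N)) with hp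
  set Q := ∑ i ∈ Finset.range m, p i with hQ
  have hQge : √(2 * Real.pi * N) / 2 * (T - 12 / N) ≤ Q := by
    have := sum_exp_neg_sq_ge hN8 (2 * z + 1) w m (by linarith [Nat.cast_nonneg (α := ℝ) m])
    simpa using this
  have h12 : 12 / (N : ℝ) ≤ τ / 2 := by
    rw [div_le_iff₀ hτ] at hn1
    rw [div_le_iff₀ hN0]; nlinarith
  have hQ4 : √(2 * Real.pi * N) ≤ 4 / τ * Q := by
    rw [div_mul_eq_mul_div, le_div_iff₀ hτ]
    have : √(2 * Real.pi * N) / 2 * (τ / 2) ≤ √(2 * Real.pi * N) / 2 * (T - 12 / N) := by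
      gcongr; linarith
    linarith
  have hQ0 : 0 ≤ Q := Finset.sum_nonneg fun i _ => (Real.exp_pos _).le
  set u : ℕ → ℝ := fun i => ((2 * z + 1 : ℝ) + 2 * i) ^ 6 with hu
  have hM6 : ∑ i ∈ Finset.range m, u i * p i ≤ C * N ^ 3 * Q := by
    have i1 := sum_pow_six_mul_exp_neg_sq_le (by linarith : (1 : ℝ) ≤ N) (2 * z + 1) w m
    have i2 : ∀ i, u i * p i ≤ 32 * (((2 * z + 1 : ℝ) + 2 * i - w) ^ 6 * p i) + 32 * w ^ 6 * p i := fun i => by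
      have := Even.add_pow_le (n := 6) (by decide) (a := (2 * z + 1 : ℝ) + 2 * i - w) (b := w)
      norm_num at this
      calc _ ≤ 32 * (((2 * z + 1 : ℝ) + 2 * i - w) ^ 6 + w ^ 6) * p i := by
            refine mul_le_mul_of_nonneg_right ?_ (Real.exp_pos _).le
            exact this
        _ = _ := by ring
    have i3 : w ^ 6 ≤ W ^ 3 * N ^ 3 := by
      calc w ^ 6 = (w ^ 2) ^ 3 := by ring
        _ ≤ (W * N) ^ 3 := by
          gcongr
          refine hw.trans ?_
          rw [hNr]
          have : 0 ≤ W * n := by positivity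
          linarith
        _ = _ := mul_pow _ _ _
    calc _ ≤ ∑ i ∈ Finset.range m, (32 * (((2 * z + 1 : ℝ) + 2 * i - w) ^ 6 * p i) + 32 * w ^ 6 * p i) :=
          Finset.sum_le_sum fun i _ => i2 i
      _ = 32 * ∑ i ∈ Finset.range m, ((2 * z + 1 : ℝ) + 2 * i - w) ^ 6 * p i + 32 * w ^ 6 * Q := by
          rw [Finset.sum_add_distrib, ← Finset.mul_sum, ← Finset.mul_sum]
      _ ≤ 32 * (1152 * N ^ 3 * (4 / τ * Q)) + 32 * (W ^ 3 * N ^ 3) * Q := by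
          gcongr
          exact i1.trans (by gcongr)
      _ = _ := by rw [hC]; ring
  have hkey := sum_piFinset_weight_ge (even_two_mul n) (Finset.range m) (fun i => (-1 : ℝ) ^ i) p u
    (fun i _ => (Real.exp_pos _).le) (fun i => neg_one_pow_eq_or ℝ i) (fun i => by positivity)
    (M := (4 * C + 1) * N ^ 4) (by positivity) (by
      rw [← hN, ← hQ]
      calc (N : ℝ) * ∑ i ∈ Finset.range m, u i * p i ≤ N * (C * N ^ 3 * Q) := by gcongr
        _ = 4 * C * N ^ 4 / 4 * Q := by ring
        _ ≤ _ := by gcongr; linarith)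
  rw [← hN, ← hQ] at hkey
  set G := (Fintype.piFinset fun _ : Fin N => Finset.range m).filter
      (fun f => ∏ j, (-1 : ℝ) ^ f j = 1 ∧ ∑ j, u (f j) ≤ (4 * C + 1) * N ^ 4) with hG
  set S : (Fin N → ℕ) → Fin N → ℤ := fun f j => 2 * z + 1 + 2 * f j with hS
  have hSinj : Function.Injective S := fun f g hfg => by
    ext j
    have := congrFun hfg j
    simp only [hS] at this
    omega
  have hcount := sum_signCount_le (t := 2 * z + 1) (G.image S) (fun s hs v => by
    obtain ⟨f, _, rfl⟩ := Finset.mem_image.mp hs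
    simp [hS])
  rw [Finset.sum_image fun f _ g _ h => hSinj h] at hcount
  have hterm : ∀ f ∈ G, c * √(2 / (Real.pi * N)) ^ N * Real.exp (-(w ^ 2 / 2)) * ∏ j, p (f j)
      ≤ (signCount (S f) : ℝ) / 2 ^ N.choose 2 := fun f hf => by
    obtain ⟨_, hf1, hf2⟩ := Finset.mem_filter.mp hf
    refine le_trans (le_of_eq ?_) (hge (by omega) (S f) (fun j => ⟨z + 1 + f j - n, ?_⟩) ?_ ?_ w)
    · rw [mul_assoc, ← Real.exp_sum, ← Real.exp_add]
      congr 2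
      rw [neg_add, Finset.sum_div, ← Finset.sum_neg_distrib]
      congr 1
      refine Finset.sum_congr rfl fun j _ => ?_
      simp only [hS]; push_cast; ring
    · simp only [hS, hN]; push_cast; ring
    · rw [Finset.prod_pow_eq_pow_sum] at hf1
      have hev : Even (∑ j, f j) := by
        by_contra hodd
        rw [Nat.not_even_iff_odd] at hodd
        rw [hodd.neg_one_pow] at hf1
        norm_num at hf1
      obtain ⟨r, hr⟩ := hev
      have hch : (2 * (N.choose 2 : ℤ)) = N * (N - 1) := by
        have h1 := Nat.choose_two_right N
        have h2 : 2 ∣ N * (N - 1) := (Nat.even_mul_pred_self N).two_dvd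
        have h3 : 2 * N.choose 2 = N * (N - 1) := by omega
        zify [(by omega : 1 ≤ N)] at h3
        exact h3
      have hr' : ∑ j, (f j : ℤ) = 2 * r := by rw [← Nat.cast_sum, hr]; push_cast; ring
      refine ⟨r + n * (z + 1 - n), ?_⟩
      rw [hch]
      simp only [hS, Finset.sum_add_distrib, ← Finset.mul_sum, hr', Finset.sum_const,
        Finset.card_univ, Fintype.card_fin, nsmul_eq_mul, hN]
      push_cast
      ring
    · refine le_trans (le_of_eq ?_) hf2
      simp only [hS, hu]; push_cast; rfl
  have hcount' : (∑ f ∈ G, (signCount (S f) : ℝ)) ≤ friendlyCount N (2 * z + 1) := by exact_mod_cast hcount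
  have hQN : √(2 * Real.pi * N) ^ N / 2 ^ N * (T ^ N * Real.exp (-(24 / τ))) ≤ Q ^ N := by
    have hT0 : 0 < T := hτ.trans_le hT
    set y := 12 / (N * T) with hy
    have hy1 : y ≤ 12 / (N * τ) := by rw [hy]; gcongr
    have hy2 : 12 / (N * τ) ≤ 1 / 2 := by
      rw [← div_div, div_le_iff₀ hτ]; linarith
    have hy0 : 0 ≤ y := by positivity
    have hexp : Real.exp (-(24 / τ)) ≤ (1 - y) ^ N := by
      refine le_trans ?_ (pow_le_pow_left₀ (Real.exp_pos _).le (exp_neg_le_one_sub (hy1.trans hy2)) N)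
      rw [← Real.exp_nat_mul]
      refine Real.exp_le_exp.mpr ?_
      have i1 : (N : ℝ) * y ≤ 12 / τ := by
        calc (N : ℝ) * y ≤ N * (12 / (N * τ)) := by gcongr
          _ = 12 / τ := by field_simp
      have i2 : N * (y + 2 * y ^ 2) ≤ N * (2 * y) := by
        gcongr; nlinarith [hy1.trans hy2]
      have i3 : 24 / τ = 2 * (12 / τ) := by ring
      linarith
    calc _ ≤ √(2 * Real.pi * N) ^ N / 2 ^ N * (T ^ N * (1 - y) ^ N) := by gcongr
      _ = (√(2 * Real.pi * N) / 2 * (T - 12 / N)) ^ N := by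
        rw [← div_pow, ← mul_pow, ← mul_pow]
        congr 2
        rw [hy]; field_simp
      _ ≤ Q ^ N := by
        gcongr
        exact mul_nonneg (by positivity) (by linarith)
  have hone : √(2 / (Real.pi * N)) ^ N * (√(2 * Real.pi * N) ^ N / 2 ^ N) = 1 := by
    rw [← div_pow, ← mul_pow, ← mul_div_assoc, ← Real.sqrt_mul (by positivity),
      show 2 / (Real.pi * N) * (2 * Real.pi * N) = 2 ^ 2 by field_simp,
      Real.sqrt_sq (by norm_num)]
    norm_num
  calc c * Real.exp (-(24 / τ)) / 4 * (Real.exp (-(w ^ 2 / 2)) * T ^ N)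
      = c * Real.exp (-(w ^ 2 / 2)) / 4 * (√(2 / (Real.pi * N)) ^ N
        * (√(2 * Real.pi * N) ^ N / 2 ^ N)) * (T ^ N * Real.exp (-(24 / τ))) := by rw [hone]; ring
    _ = c * √(2 / (Real.pi * N)) ^ N * Real.exp (-(w ^ 2 / 2)) * (√(2 * Real.pi * N) ^ N / 2 ^ N
        * (T ^ N * Real.exp (-(24 / τ))) / 4) := by ring
    _ ≤ c * √(2 / (Real.pi * N)) ^ N * Real.exp (-(w ^ 2 / 2)) * (Q ^ N / 4) := by gcongr
    _ ≤ c * √(2 / (Real.pi * N)) ^ N * Real.exp (-(w ^ 2 / 2)) * ∑ f ∈ G, ∏ j, p (f j) := by gcongr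
    _ = ∑ f ∈ G, c * √(2 / (Real.pi * N)) ^ N * Real.exp (-(w ^ 2 / 2)) * ∏ j, p (f j) := by
        rw [Finset.mul_sum]
    _ ≤ ∑ f ∈ G, (signCount (S f) : ℝ) / 2 ^ N.choose 2 := Finset.sum_le_sum hterm
    _ = (∑ f ∈ G, (signCount (S f) : ℝ)) / 2 ^ N.choose 2 := by rw [Finset.sum_div]
    _ ≤ _ := by gcongr

theorem prod_real_cosh_eq {N : ℕ} (c : Fin N → ℝ) :
    ∏ e : Edge N, Real.cosh (c e.1.1 + c e.1.2)
      = (∑ x : Edge N → Bool, Real.exp (∑ j, (signSum x j : ℝ) * c j)) / 2 ^ N.choose 2 := by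
  have h := prod_cosh_eq (N := N) fun j => (c j : ℂ)
  apply Complex.ofReal_injective
  push_cast
  exact h

theorem integral_exp_neg_sq_add_mul (s : ℝ) :
    ∫ x : ℝ, Real.exp (-(1 / 2) * x ^ 2 + s * x) = √(2 * Real.pi) * Real.exp (s ^ 2 / 2) := by
  have h : ∀ x : ℝ, Real.exp (-(1 / 2) * x ^ 2 + s * x)
      = Real.exp (s ^ 2 / 2) * Real.exp (-(1 / 2) * (x - s) ^ 2) := fun x => by
    rw [← Real.exp_add]; ring_nf
  simp only [h]
  rw [integral_const_mul, integral_sub_right_eq_self (fun x : ℝ => Real.exp (-(1 / 2) * x ^ 2)) s,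
    integral_gaussian, mul_comm]
  congr 2
  ring

theorem sum_exp_signSum_sq_le {N : ℕ} (hN : 2 ≤ N) :
    ∑ x : Edge N → Bool, Real.exp ((∑ j, (signSum x j : ℝ) ^ 2) / (8 * N))
      ≤ 2 ^ N.choose 2 * √2 ^ N := by
  have hN0 : (0 : ℝ) < N := by exact_mod_cast (by omega : 0 < N)
  set a := √(1 / (4 * N)) with ha
  have ha2 : a ^ 2 = 1 / (4 * N) := Real.sq_sqrt (by positivity)
  set q : ℝ → ℝ → ℝ := fun s x => Real.exp (-(1 / 2) * x ^ 2 + a * s * x) with hq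
  have h_int : ∀ s, Integrable (q s) := fun s => by
    refine Integrable.of_integral_ne_zero ?_
    rw [hq]
    simp only
    rw [integral_exp_neg_sq_add_mul]
    positivity
  have h_int' : ∀ x : Edge N → Bool, Integrable fun g : Fin N → ℝ => ∏ j, q (signSum x j) (g j) := fun x =>
    Integrable.fintype_prod fun j => h_int _
  have e1 : ∀ x : Edge N → Bool, ∫ g : Fin N → ℝ, ∏ j, q (signSum x j) (g j)
      = √(2 * Real.pi) ^ N * Real.exp ((∑ j, (signSum x j : ℝ) ^ 2) / (8 * N)) := fun x => by
    rw [integral_fintype_prod_volume_eq_prod (fun j => q (signSum x j))]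
    simp only [hq, integral_exp_neg_sq_add_mul]
    rw [Finset.prod_mul_distrib, ← Real.exp_sum]
    simp only [Finset.prod_const, Finset.card_univ, Fintype.card_fin, mul_pow, ha2]
    rw [Finset.sum_div]
    congr 2
    refine Finset.sum_congr rfl fun j _ => ?_
    field_simp; ring
  have e2 : ∀ g : Fin N → ℝ, ∑ x : Edge N → Bool, ∏ j, q (signSum x j) (g j)
      ≤ 2 ^ N.choose 2 * ∏ j, Real.exp (-(1 / 4) * g j ^ 2) := fun g => by
    have i1 : ∀ x : Edge N → Bool, ∏ j, q (signSum x j) (g j)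
        = Real.exp (-(1 / 2) * ∑ j, g j ^ 2) * Real.exp (∑ j, (signSum x j : ℝ) * (a * g j)) := fun x => by
      rw [← Real.exp_sum, ← Real.exp_add, Finset.mul_sum, ← Finset.sum_add_distrib]
      congr 1
      exact Finset.sum_congr rfl fun j _ => by ring
    have i2 := prod_real_cosh_eq fun j => a * g j
    rw [eq_div_iff (by positivity)] at i2
    simp only [i1]
    rw [← Finset.mul_sum, ← i2]
    have i3 : ∏ e : Edge N, Real.cosh (a * g e.1.1 + a * g e.1.2) ≤ Real.exp (1 / 4 * ∑ j, g j ^ 2) := by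
      calc _ ≤ ∏ e : Edge N, Real.exp ((a * g e.1.1 + a * g e.1.2) ^ 2 / 2) :=
            Finset.prod_le_prod (fun e _ => (Real.cosh_pos _).le) fun e _ => Real.cosh_le_exp_half_sq _
        _ ≤ _ := by
          rw [← Real.exp_sum, ← Finset.sum_div]
          refine Real.exp_le_exp.mpr ?_
          have h1 := sum_edge_add_sq fun j => a * g j
          have h2 : (∑ j, a * g j) ^ 2 ≤ N * ∑ j, (a * g j) ^ 2 := by
            simpa using sq_sum_le_card_mul_sum_sq (s := Finset.univ) (f := fun j => a * g j)
          have h3 : ∑ j, (a * g j) ^ 2 = 1 / (4 * N) * ∑ j, g j ^ 2 := by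
            rw [Finset.mul_sum]
            exact Finset.sum_congr rfl fun j _ => by rw [mul_pow, ha2]
          have h4 : (N : ℝ) * (1 / (4 * N) * ∑ j, g j ^ 2) = 1 / 4 * ∑ j, g j ^ 2 := by field_simp
          have h5 : 0 ≤ ∑ j, (a * g j) ^ 2 := Finset.sum_nonneg fun j _ => sq_nonneg _
          rw [h1]
          rw [← h3] at h4
          nlinarith
    calc _ ≤ Real.exp (-(1 / 2) * ∑ j, g j ^ 2) * (Real.exp (1 / 4 * ∑ j, g j ^ 2) * 2 ^ N.choose 2) := by
          gcongr
      _ = _ := by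
        rw [← mul_assoc, ← Real.exp_add, ← Real.exp_sum, ← Finset.mul_sum, mul_comm]
        congr 2; ring
  have e3 : ∫ g : Fin N → ℝ, ∏ j, Real.exp (-(1 / 4) * g j ^ 2) = √(4 * Real.pi) ^ N := by
    rw [integral_fintype_prod_volume_eq_pow (fun y : ℝ => Real.exp (-(1 / 4) * y ^ 2)), integral_gaussian,
      Fintype.card_fin]
    congr 2; ring
  have e4 : √(2 * Real.pi) ^ N * ∑ x : Edge N → Bool, Real.exp ((∑ j, (signSum x j : ℝ) ^ 2) / (8 * N))
      ≤ 2 ^ N.choose 2 * √(4 * Real.pi) ^ N := by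
    rw [Finset.mul_sum, ← e3, ← integral_const_mul]
    simp only [← e1]
    rw [← integral_finsetSum _ fun x _ => h_int' x]
    refine integral_mono_of_nonneg (ae_of_all _ fun g => Finset.sum_nonneg fun x _ =>
      Finset.prod_nonneg fun j _ => (Real.exp_pos _).le) ?_ (ae_of_all _ e2)
    refine Integrable.const_mul ?_ _
    refine Integrable.fintype_prod (f := fun _ => fun y : ℝ => Real.exp (-(1 / 4) * y ^ 2)) fun j => ?_
    exact integrable_exp_neg_mul_sq (by norm_num)
  have h4 : √(4 * Real.pi) = √(2 * Real.pi) * √2 := by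
    rw [← Real.sqrt_mul (by positivity)]; ring_nf
  rw [h4, mul_pow] at e4
  have h0 : 0 < √(2 * Real.pi) ^ N := by positivity
  refine le_of_mul_le_mul_left (e4.trans_eq ?_) h0
  ring

theorem card_signSum_sq_ge_le {N : ℕ} (hN : 2 ≤ N) (K : ℝ) :
    ((Finset.univ.filter fun x : Edge N → Bool => K * N ^ 2 < ∑ j, (signSum x j : ℝ) ^ 2).card : ℝ)
      / 2 ^ N.choose 2 ≤ Real.exp (N * (1 - K / 8)) := by
  have hN0 : (0 : ℝ) < N := by exact_mod_cast (by omega : 0 < N)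
  have h1 : ((Finset.univ.filter fun x : Edge N → Bool => K * N ^ 2 < ∑ j, (signSum x j : ℝ) ^ 2).card : ℝ)
      * Real.exp (N * K / 8) ≤ 2 ^ N.choose 2 * √2 ^ N := by
    refine le_trans ?_ (sum_exp_signSum_sq_le hN)
    rw [← nsmul_eq_mul, ← Finset.sum_const]
    refine (Finset.sum_le_sum fun x hx => ?_).trans (Finset.sum_le_sum_of_subset_of_nonneg
      (Finset.filter_subset _ _) fun x _ _ => (Real.exp_pos _).le)
    refine Real.exp_le_exp.mpr ?_
    have := (Finset.mem_filter.mp hx).2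
    rw [le_div_iff₀ (by positivity)]
    linarith [show (N : ℝ) * K / 8 * (8 * N) = K * N ^ 2 by ring]
  have h2 : √2 ^ N ≤ Real.exp N := by
    rw [← Real.exp_one_pow]
    refine pow_le_pow_left₀ (by positivity) ?_ N
    have : √2 ≤ 2 := Real.sqrt_le_iff.mpr (by norm_num)
    linarith [Real.add_one_le_exp 1]
  rw [div_le_iff₀ (by positivity), show N * (1 - K / 8) = N - N * K / 8 by ring, Real.exp_sub,
    div_mul_eq_mul_div, le_div_iff₀ (Real.exp_pos _)]
  refine h1.trans ?_
  rw [mul_comm]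
  gcongr

theorem exists_clip (y : ℝ) : ∃ b : ℝ, |b| ≤ 1 / 4 ∧ b ^ 2 ≤ y ^ 2 ∧ |b - y| ≤ 4 * y ^ 2 ∧
    (y * b - b ^ 2 / 2 = y ^ 2 / 2 ∨ 1 / 32 ≤ y * b - b ^ 2 / 2) := by
  rcases le_or_gt |y| (1 / 4) with h | h
  · exact ⟨y, h, le_rfl, by simpa using sq_nonneg y, Or.inl (by ring)⟩
  · rcases lt_abs.mp h with h | h
    · refine ⟨1 / 4, by norm_num, by nlinarith, ?_, Or.inr (by nlinarith)⟩
      rw [abs_le]; constructor <;> nlinarith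
    · refine ⟨-(1 / 4), by norm_num, by nlinarith, ?_, Or.inr (by nlinarith)⟩
      rw [abs_le]; constructor <;> nlinarith

theorem signCount_le_prod {K : ℝ} : ∃ C, 0 < C ∧ ∀ {N : ℕ}, 16 ≤ N → ∀ s : Fin N → ℤ,
    (∀ j, ∃ m : ℤ, s j = (N : ℤ) - 1 + 2 * m) → (∃ m : ℤ, ∑ j, s j = 2 * (N.choose 2 : ℤ) + 4 * m) →
    ∑ j, (s j : ℝ) ^ 2 ≤ K * N ^ 2 → ∀ k : ℝ, |(∑ j, (s j : ℝ)) / (2 * N) - k| ≤ 1 →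
    (signCount s : ℝ) / 2 ^ N.choose 2 ≤ C * (√(2 / (Real.pi * N)) ^ N * (Real.exp (-(k ^ 2 / 2)) *
      ∏ j, (Real.exp (-((s j : ℝ) - k) ^ 2 / (2 * N)) + Real.exp (-(N / 32 : ℝ))))) := by
  obtain ⟨C, hC, H⟩ := signCount_le (B := K + 1)
  set D := 2 + 4 * (K + 1) with hD
  refine ⟨C * Real.exp (D ^ 2 / 2), by positivity, fun {N} hN s h1 h2 hs k hk => ?_⟩
  have hN0 : (0 : ℝ) < N := by exact_mod_cast (by omega : 0 < N)
  have hN2 : (2 : ℝ) ≤ N := by exact_mod_cast (by omega : 2 ≤ N)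
  choose cl hcl1 hcl2 hcl3 hcl4 using exists_clip
  set d : Fin N → ℝ := fun j => s j - k with hd
  set b : Fin N → ℝ := fun j => cl (d j / N) with hb
  set w := (∑ j, (s j : ℝ)) / (2 * N) with hw
  have hsum : ∑ j, (s j : ℝ) = 2 * N * w := by rw [hw]; field_simp
  have hdsum : ∑ j, d j = 2 * N * w - N * k := by
    rw [hd, Finset.sum_sub_distrib, hsum]; simp
  have hd2 : ∑ j, d j ^ 2 ≤ (K + 1) * N ^ 2 := by
    have e1 : ∑ j, d j ^ 2 = ∑ j, (s j : ℝ) ^ 2 - 2 * k * (2 * N * w) + N * k ^ 2 := by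
      rw [← hsum, Finset.mul_sum, ← Finset.sum_sub_distrib]
      have : (N : ℝ) * k ^ 2 = ∑ _j : Fin N, k ^ 2 := by simp
      rw [this, ← Finset.sum_add_distrib]
      exact Finset.sum_congr rfl fun j _ => by rw [hd]; ring
    have e2 : k ^ 2 - 4 * k * w ≤ 2 := by
      have := sq_le_one_iff_abs_le_one (w - k) |>.mpr hk
      nlinarith [sq_nonneg (2 * w + k)]
    rw [e1]
    nlinarith
  have hdN : ∑ j, (d j / N) ^ 2 ≤ K + 1 := by
    simp only [div_pow]
    rw [← Finset.sum_div, div_le_iff₀ (by positivity)]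
    exact hd2
  have hbB : ∑ j, b j ^ 2 ≤ K + 1 := (Finset.sum_le_sum fun j _ => hcl2 _).trans hdN
  have hbk : |∑ j, b j - k| ≤ D := by
    have e1 : ∑ j, b j - k = ∑ j, (b j - d j / N) + 2 * (w - k) := by
      rw [Finset.sum_sub_distrib, ← Finset.sum_div, hdsum]
      field_simp; ring
    rw [e1, hD, add_comm]
    refine (abs_add_le _ _).trans (add_le_add ?_ ?_)
    · rw [abs_mul, abs_two]; linarith
    · refine (Finset.abs_sum_le_sum_abs _ _).trans ((Finset.sum_le_sum fun j _ => hcl3 _).trans ?_)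
      rw [← Finset.mul_sum]; linarith
  have hbk2 : (∑ j, b j - k) ^ 2 ≤ D ^ 2 := sq_le_sq' (abs_le.mp hbk).1 (abs_le.mp hbk).2
  refine (H hN (fun j => hcl1 _) hbB s h1 h2).trans ?_
  have hex : (N * ∑ j, b j ^ 2 + (∑ j, b j) ^ 2) / 2 - ∑ j, (s j : ℝ) * b j
      ≤ D ^ 2 / 2 + (-(k ^ 2 / 2) + ∑ j, -(N * (d j / N * b j - b j ^ 2 / 2))) := by
    have e1 : ∑ j, -(N * (d j / N * b j - b j ^ 2 / 2))
        = N * (∑ j, b j ^ 2) / 2 - ∑ j, (s j : ℝ) * b j + k * ∑ j, b j := by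
      rw [Finset.mul_sum, Finset.mul_sum, Finset.sum_div, ← Finset.sum_sub_distrib, ← Finset.sum_add_distrib]
      refine Finset.sum_congr rfl fun j _ => ?_
      rw [hd]; field_simp; ring
    rw [e1]
    nlinarith
  have hj : ∀ j, Real.exp (-(N * (d j / N * b j - b j ^ 2 / 2)))
      ≤ Real.exp (-((s j : ℝ) - k) ^ 2 / (2 * N)) + Real.exp (-(N / 32 : ℝ)) := fun j => by
    rcases hcl4 (d j / N) with h | h
    · refine le_trans (le_of_eq ?_) (le_add_of_nonneg_right (Real.exp_pos _).le)
      simp only [hb]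
      rw [h, hd]
      congr 1
      field_simp
    · refine le_trans (Real.exp_le_exp.mpr ?_) (le_add_of_nonneg_left (Real.exp_pos _).le)
      have := mul_le_mul_of_nonneg_left h hN0.le
      simp only [hb]
      linarith
  calc _ ≤ C * √(2 / (Real.pi * N)) ^ N * Real.exp (D ^ 2 / 2
        + (-(k ^ 2 / 2) + ∑ j, -(N * (d j / N * b j - b j ^ 2 / 2)))) := by gcongr
    _ = C * Real.exp (D ^ 2 / 2) * (√(2 / (Real.pi * N)) ^ N * (Real.exp (-(k ^ 2 / 2)) *
      ∏ j, Real.exp (-(N * (d j / N * b j - b j ^ 2 / 2))))) := by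
        rw [Real.exp_add, Real.exp_add, Real.exp_sum]; ring
    _ ≤ _ := by
        gcongr with j
        exact hj j

theorem exists_floor_near {N : ℕ} (hN : 1 ≤ N) {K : ℝ} {s : Fin N → ℤ}
    (hs : ∑ j, (s j : ℝ) ^ 2 ≤ K * N ^ 2) :
    ∃ k : ℤ, |(∑ j, (s j : ℝ)) / (2 * N) - k| ≤ 1 ∧ (k : ℝ) ^ 2 ≤ (K + 2) * N := by
  have hN1 : (1 : ℝ) ≤ N := by exact_mod_cast hN
  have hN0 : (0 : ℝ) < N := by linarith
  set w := (∑ j, (s j : ℝ)) / (2 * N) with hw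
  have h0 : 0 ≤ K * N ^ 2 := le_trans (Finset.sum_nonneg fun j _ => sq_nonneg _) hs
  have h1 : (∑ j, (s j : ℝ)) ^ 2 ≤ N * (K * N ^ 2) := by
    have : (∑ j, (s j : ℝ)) ^ 2 ≤ N * ∑ j, (s j : ℝ) ^ 2 := by
      simpa using sq_sum_le_card_mul_sum_sq (s := Finset.univ) (f := fun j => (s j : ℝ))
    exact this.trans (by gcongr)
  have h2 : w ^ 2 ≤ K * N / 4 := by
    rw [hw, div_pow, div_le_iff₀ (by positivity)]
    linarith [show K * N / 4 * (2 * (N : ℝ)) ^ 2 = N * (K * N ^ 2) by ring]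
  have h3 : 0 ≤ w - ⌊w⌋ := sub_nonneg.mpr (Int.floor_le w)
  have h4 : w - ⌊w⌋ ≤ 1 := by linarith [Int.lt_floor_add_one w]
  refine ⟨⌊w⌋, abs_le.mpr ⟨by linarith, h4⟩, ?_⟩
  have h5 : (⌊w⌋ : ℝ) ^ 2 ≤ 2 * w ^ 2 + 2 := by nlinarith [sq_nonneg (w + (w - ⌊w⌋))]
  have h6 : 0 ≤ K * N := by nlinarith
  nlinarith

theorem card_friendly_le_sum {K : ℝ} : ∃ C, 0 < C ∧ ∀ {n : ℕ}, 8 ≤ n → ∀ z : ℤ, -n ≤ z →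
    ∃ F : Finset ℤ, (∀ k ∈ F, (k : ℝ) ^ 2 ≤ (K + 2) * (2 * n : ℕ)) ∧
    ((Finset.univ.filter fun x : Edge (2 * n) → Bool => (∀ v, 2 * z + 1 ≤ signSum x v) ∧
      ∑ j, (signSum x j : ℝ) ^ 2 ≤ K * (2 * n : ℕ) ^ 2).card : ℝ) / 2 ^ (2 * n).choose 2
    ≤ C * ∑ k ∈ F, Real.exp (-((k : ℝ) ^ 2 / 2)) * (√(2 / (Real.pi * (2 * n : ℕ))) *
      ∑ i ∈ Finset.range (2 * n), (Real.exp (-((2 * z + 1 : ℝ) + 2 * i - k) ^ 2 / (2 * (2 * n : ℕ)))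
        + Real.exp (-((2 * n : ℕ) / 32 : ℝ)))) ^ (2 * n) := by
  classical
  obtain ⟨C, hC, H⟩ := signCount_le_prod (K := K)
  refine ⟨C, hC, fun {n} hn z hz => ?_⟩
  obtain ⟨N, hN⟩ : ∃ N, N = 2 * n := ⟨_, rfl⟩
  rw [← hN]
  set F := (Finset.Icc (-⌊(K + 2) * N⌋) ⌊(K + 2) * N⌋).filter fun k : ℤ => (k : ℝ) ^ 2 ≤ (K + 2) * N with hF
  refine ⟨F, fun k hk => (Finset.mem_filter.mp hk).2, ?_⟩
  have hmem : ∀ k : ℤ, (k : ℝ) ^ 2 ≤ (K + 2) * N → k ∈ F := fun k hk => by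
    refine Finset.mem_filter.mpr ⟨Finset.mem_Icc.mpr (abs_le.mp (Int.le_floor.mpr ?_)), hk⟩
    refine le_trans ?_ hk
    have h1 : |k| ≤ k ^ 2 := by
      rw [← sq_abs]
      nlinarith [abs_nonneg k, Int.le_self_sq |k|]
    exact_mod_cast h1
  set good := Finset.univ.filter fun x : Edge N → Bool => (∀ v, 2 * z + 1 ≤ signSum x v) ∧
      ∑ j, (signSum x j : ℝ) ^ 2 ≤ K * N ^ 2 with hgood
  set g : ℤ → ℕ → ℝ := fun k i => Real.exp (-((2 * z + 1 : ℝ) + 2 * i - k) ^ 2 / (2 * N))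
        + Real.exp (-(N / 32 : ℝ)) with hg
  have hg0 : ∀ k i, 0 ≤ g k i := fun k i => by positivity
  set P := Fintype.piFinset fun _ : Fin N => Finset.range N with hP
  set φ : (Edge N → Bool) → Fin N → ℕ := fun x j => ((signSum x j - (2 * z + 1)) / 2).toNat with hφ
  have hφ1 : ∀ x ∈ good, ∀ j, signSum x j = 2 * z + 1 + 2 * φ x j := fun x hx j => by
    have i1 := (Finset.mem_filter.mp hx).2.1 j
    obtain ⟨m, hm⟩ := signSum_parity x j
    simp only [hφ]
    omega
  have hφ2 : ∀ x ∈ good, φ x ∈ P := fun x hx => by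
    refine Fintype.mem_piFinset.mpr fun j => Finset.mem_range.mpr ?_
    have i1 := hφ1 x hx j
    have i2 := (abs_le.mp (abs_signSum_le x j)).2
    omega
  set r := √(2 / (Real.pi * N)) with hr
  have hfib : ∀ f ∈ P, ((good.filter fun x => φ x = f).card : ℝ) / 2 ^ N.choose 2
      ≤ ∑ k ∈ F, C * (r ^ N * (Real.exp (-((k : ℝ) ^ 2 / 2)) * ∏ j, g k (f j))) := fun f _ => by
    have hnn : ∀ k ∈ F, 0 ≤ C * (r ^ N * (Real.exp (-((k : ℝ) ^ 2 / 2)) * ∏ j, g k (f j))) := fun k _ => by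
      have := Finset.prod_nonneg fun j (_ : j ∈ Finset.univ) => hg0 k (f j)
      positivity
    rcases (good.filter fun x => φ x = f).eq_empty_or_nonempty with h0 | ⟨x, hx⟩
    · rw [h0]
      simpa using Finset.sum_nonneg hnn
    · obtain ⟨hx1, rfl⟩ := Finset.mem_filter.mp hx
      have hx2 := (Finset.mem_filter.mp hx1).2.2
      obtain ⟨k, hk1, hk2⟩ := exists_floor_near (by omega) hx2
      refine le_trans ?_ (Finset.single_le_sum hnn (hmem k hk2))
      have hH := H (by omega) (signSum x) (signSum_parity x) (sum_signSum_mod x) hx2 k hk1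
      have hcard : (good.filter fun y => φ y = φ x).card ≤ signCount (signSum x) := by
        refine Finset.card_le_card fun y hy => ?_
        obtain ⟨hy1, hy2⟩ := Finset.mem_filter.mp hy
        refine Finset.mem_filter.mpr ⟨Finset.mem_univ _, funext fun j => ?_⟩
        rw [hφ1 x hx1, hφ1 y hy1, hy2]
      refine le_trans (by gcongr) (hH.trans (le_of_eq ?_))
      congr 3
      refine Finset.prod_congr rfl fun j _ => ?_
      rw [hφ1 x hx1 j, hg]
      push_cast
      rfl
  calc (good.card : ℝ) / 2 ^ N.choose 2
      = ∑ f ∈ P, ((good.filter fun x => φ x = f).card : ℝ) / 2 ^ N.choose 2 := by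
        rw [Finset.card_eq_sum_card_fiberwise (f := φ) (t := P) hφ2, ← Finset.sum_div]
        push_cast
        rfl
    _ ≤ ∑ f ∈ P, ∑ k ∈ F, C * (r ^ N * (Real.exp (-((k : ℝ) ^ 2 / 2)) * ∏ j, g k (f j))) :=
        Finset.sum_le_sum hfib
    _ = C * ∑ k ∈ F, Real.exp (-((k : ℝ) ^ 2 / 2)) * (r * ∑ i ∈ Finset.range N, g k i) ^ N := by
        rw [Finset.sum_comm, Finset.mul_sum]
        refine Finset.sum_congr rfl fun k _ => ?_
        have : (∑ i ∈ Finset.range N, g k i) ^ N = ∑ f ∈ P, ∏ j, g k (f j) := by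
          rw [hP, ← Finset.prod_univ_sum (fun _ : Fin N => Finset.range N) (fun _ i => g k i)]
          simp
        rw [mul_pow, this, Finset.mul_sum, Finset.mul_sum, Finset.mul_sum]
        exact Finset.sum_congr rfl fun f _ => by ring

theorem exp_mul_gaussTail_pow {n : ℕ} (hn : 1 ≤ n) {γ z : ℝ} (hz : γ * √n = z) (α : ℝ) :
    Real.exp (-((-(2 * α * √n)) ^ 2 / 2)) * gaussTail ((2 * z - -(2 * α * √n)) / √(2 * n)) ^ (2 * n)
      = Real.exp (2 * n * (F1 γ α - Real.log 2)) := by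
  have hn0 : (0 : ℝ) < n := by exact_mod_cast hn
  have h1 : (2 * z - -(2 * α * √n)) / √(2 * n) = (γ + α) * √2 := by
    rw [← hz, Real.sqrt_mul (by norm_num), div_eq_iff (by positivity)]
    linear_combination (-(γ + α) * √n) * Real.sq_sqrt (show (0 : ℝ) ≤ 2 by norm_num)
  have h2 : (-(2 * α * √n)) ^ 2 / 2 = 2 * n * α ^ 2 := by
    rw [neg_sq, mul_pow, Real.sq_sqrt hn0.le]; ring
  rw [h1, h2, F1, ← Real.exp_log (gaussTail_pos ((γ + α) * √2)), ← Real.exp_nat_mul, ← Real.exp_add,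
    Real.log_exp]
  congr 1
  push_cast
  ring

theorem sum_int_exp_neg_sq_le (F : Finset ℤ) (a : ℝ) :
    ∑ k ∈ F, Real.exp (-((k - a) ^ 2 / 2)) ≤ Real.exp (1 / 8) * (√(8 * Real.pi) / 2) := by
  obtain ⟨L, hL⟩ : ∃ L : ℕ, ∀ k ∈ F, |k| < L := by
    refine ⟨F.sup (fun k => k.natAbs) + 1, fun k hk => ?_⟩
    have := Finset.le_sup (f := fun k : ℤ => k.natAbs) hk
    rw [Int.abs_eq_natAbs]
    omega
  have h1 : ∑ k ∈ F, Real.exp (-((k - a) ^ 2 / 2))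
      ≤ ∑ k ∈ (Finset.range (2 * L)).image (fun i : ℕ => (i : ℤ) - L), Real.exp (-((k - a) ^ 2 / 2)) := by
    refine Finset.sum_le_sum_of_subset_of_nonneg (fun k hk => ?_) fun k _ _ => (Real.exp_pos _).le
    have := abs_lt.mp (hL k hk)
    exact Finset.mem_image.mpr ⟨(k + L).toNat, Finset.mem_range.mpr (by omega), by omega⟩
  refine h1.trans ?_
  rw [Finset.sum_image fun i _ j _ h => by omega]
  have h2 := sum_exp_neg_sq_le (by norm_num : (0 : ℝ) < 4) (-2 * L) (2 * a) (2 * L)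
  have h3 := gaussTail_le_one ((-2 * L - 1 - 2 * a) / √4)
  refine le_trans (le_of_eq (Finset.sum_congr rfl fun i _ => ?_)) (h2.trans ?_)
  · congr 1; push_cast; ring
  · rw [show (1 : ℝ) / (2 * 4) = 1 / 8 by norm_num, show 2 * Real.pi * 4 = 8 * Real.pi by ring]
    gcongr
    exact mul_le_of_le_one_right (by positivity) h3

theorem add_exp_pow_le {τ T x : ℝ} (hτ : 0 < τ) (hT : τ ≤ T) {N : ℕ} (hN : 1 ≤ N)
    (h0 : 0 ≤ x) (hx : x ≤ Real.exp (1 / (2 * N)) * T + N * Real.exp (-(N / 32 : ℝ))) :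
    x ^ N ≤ Real.exp (1 / 2 + 2048 / τ) * T ^ N := by
  have hN0 : (0 : ℝ) < N := by exact_mod_cast hN
  have h1 : (N : ℝ) ^ 2 * Real.exp (-(N / 32 : ℝ)) ≤ 2048 := by
    have := Real.pow_div_factorial_le_exp (N / 32 : ℝ) (by positivity) 2
    rw [Real.exp_neg, ← div_eq_mul_inv, div_le_iff₀ (Real.exp_pos _)]
    norm_num [Nat.factorial] at this
    linarith [show ((N : ℝ) / 32) ^ 2 / 2 * 2048 = N ^ 2 by ring]
  have h2 : (N : ℝ) * Real.exp (-(N / 32 : ℝ)) ≤ 2048 / (N * τ) * T := by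
    have : (N : ℝ) * Real.exp (-(N / 32 : ℝ)) ≤ 2048 / N := by
      rw [le_div_iff₀ hN0]; linarith
    refine this.trans ?_
    rw [← div_div, div_mul_eq_mul_div, le_div_iff₀ hτ]
    gcongr
  have h3 : x ≤ Real.exp (1 / (2 * N) + 2048 / (N * τ)) * T := by
    have hT0 : 0 ≤ T := hτ.le.trans hT
    have e1 := Real.add_one_le_exp (2048 / (N * τ))
    have e2 : 1 ≤ Real.exp (1 / (2 * N)) := Real.one_le_exp (by positivity)
    have e3 : 0 ≤ 2048 / (N * τ) := by positivity
    rw [Real.exp_add]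
    calc x ≤ Real.exp (1 / (2 * N)) * T + 2048 / (N * τ) * T := by linarith
      _ ≤ Real.exp (1 / (2 * N)) * T + Real.exp (1 / (2 * N)) * (2048 / (N * τ)) * T := by
        gcongr
        exact le_mul_of_one_le_left e3 e2
      _ = Real.exp (1 / (2 * N)) * (2048 / (N * τ) + 1) * T := by ring
      _ ≤ _ := by gcongr
  refine (pow_le_pow_left₀ h0 h3 N).trans (le_of_eq ?_)
  rw [mul_pow, ← Real.exp_nat_mul]
  congr 2
  field_simp

theorem exp_mul_sum_pow_le {K : ℝ} (hK : 0 ≤ K) {n : ℕ} (hn : 8 ≤ n) {γ : ℝ} {z : ℤ} (hγ : |γ| ≤ 1)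
    (hz : γ * √n = z) {α₀ : ℝ} (hα₀ : ∀ α, F1 γ α ≤ F1 γ α₀ - (α - α₀) ^ 2) {k : ℤ}
    (hk : (k : ℝ) ^ 2 ≤ (K + 2) * (2 * n : ℕ)) :
    Real.exp (-((k : ℝ) ^ 2 / 2)) * (√(2 / (Real.pi * (2 * n : ℕ))) *
      ∑ i ∈ Finset.range (2 * n), (Real.exp (-((2 * z + 1 : ℝ) + 2 * i - k) ^ 2 / (2 * (2 * n : ℕ)))
        + Real.exp (-((2 * n : ℕ) / 32 : ℝ)))) ^ (2 * n)
      ≤ Real.exp (1 / 2 + 2048 / gaussTail ((1 + (K + 2)) * √2)) *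
        Real.exp ((2 * n : ℕ) * (F1 γ α₀ - Real.log 2)) * Real.exp (-((k - -(2 * α₀ * √n)) ^ 2 / 2)) := by
  set τ := gaussTail ((1 + (K + 2)) * √2) with hτ
  have hτ0 : 0 < τ := gaussTail_pos _
  set C₂ := Real.exp (1 / 2 + 2048 / τ) with hC₂
  have hn0 : (0 : ℝ) < n := by exact_mod_cast (by omega : 0 < n)
  have hsn : 0 < √(n : ℝ) := Real.sqrt_pos.mpr hn0
  have hsn2 : √(n : ℝ) ^ 2 = n := Real.sq_sqrt hn0.le
  obtain ⟨N, hN⟩ : ∃ N, N = 2 * n := ⟨_, rfl⟩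
  rw [← hN] at hk ⊢
  have hNr : (N : ℝ) = 2 * n := by rw [hN]; push_cast; ring
  have hN0 : (0 : ℝ) < N := by rw [hNr]; positivity
  have hN1 : (1 : ℝ) ≤ N := by exact_mod_cast (by omega : 1 ≤ N)
  set E := Real.exp (N * (F1 γ α₀ - Real.log 2)) with hE
  obtain ⟨α, hα⟩ : ∃ α : ℝ, (k : ℝ) = -(2 * α * √n) := ⟨-k / (2 * √n), by field_simp⟩
  set T := gaussTail ((2 * z - k) / √(2 * n)) with hT
  have hα2 : α ^ 2 ≤ (K + 2) / 2 := by
    have h1 := hk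
    rw [hα, hNr, neg_sq, mul_pow, hsn2] at h1
    nlinarith
  have hα1 : |α| ≤ K + 2 := by
    refine abs_le_of_sq_le_sq (hα2.trans ?_) (by positivity)
    nlinarith
  have hτT : τ ≤ T := by
    refine gaussTail_antitone ?_
    rw [hα, ← hz, Real.sqrt_mul (by norm_num), div_le_iff₀ (by positivity)]
    have h1 : γ + α ≤ 1 + (K + 2) := add_le_add (abs_le.mp hγ).2 (abs_le.mp hα1).2
    have h2 : √(2 : ℝ) * √2 = 2 := Real.mul_self_sqrt (by norm_num)
    calc _ = (γ + α) * (2 * √n) := by ring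
      _ ≤ (1 + (K + 2)) * (2 * √n) := by gcongr
      _ = _ := by linear_combination (-(1 + (K + 2)) * √n) * h2
  have hr : √(2 / (Real.pi * N)) ≤ 1 := by
    rw [Real.sqrt_le_one, div_le_one (by positivity)]
    nlinarith [Real.pi_gt_three]
  have hone : √(2 / (Real.pi * N)) * (√(2 * Real.pi * N) / 2) = 1 := by
    rw [← mul_div_assoc, ← Real.sqrt_mul (by positivity),
      show 2 / (Real.pi * N) * (2 * Real.pi * N) = 2 ^ 2 by field_simp, Real.sqrt_sq (by norm_num)]
    norm_num
  have hx : √(2 / (Real.pi * N)) * ∑ i ∈ Finset.range N,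
      (Real.exp (-((2 * z + 1 : ℝ) + 2 * i - k) ^ 2 / (2 * N)) + Real.exp (-(N / 32 : ℝ)))
      ≤ Real.exp (1 / (2 * N)) * T + N * Real.exp (-(N / 32 : ℝ)) := by
    have h1 := sum_exp_neg_sq_le hN0 (2 * z + 1) k N
    rw [add_sub_cancel_right, hNr, ← hT, ← hNr] at h1
    rw [Finset.sum_add_distrib, mul_add]
    refine add_le_add ?_ ?_
    · calc _ ≤ √(2 / (Real.pi * N)) * (Real.exp (1 / (2 * N)) * (√(2 * Real.pi * N) / 2 * T)) := by gcongr
        _ = Real.exp (1 / (2 * N)) * T * (√(2 / (Real.pi * N)) * (√(2 * Real.pi * N) / 2)) := by ring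
        _ = _ := by rw [hone, mul_one]
    · rw [Finset.sum_const, Finset.card_range, nsmul_eq_mul]
      exact mul_le_of_le_one_left (by positivity) hr
  have hp := add_exp_pow_le hτ0 hτT (N := N) (by omega)
    (mul_nonneg (Real.sqrt_nonneg _) (Finset.sum_nonneg fun i _ => by positivity)) hx
  have hid := exp_mul_gaussTail_pow (by omega : 1 ≤ n) hz α
  rw [← hα, ← hT, ← hN, ← hNr] at hid
  calc _ ≤ Real.exp (-((k : ℝ) ^ 2 / 2)) * (C₂ * T ^ N) := by gcongr
    _ = C₂ * (Real.exp (-((k : ℝ) ^ 2 / 2)) * T ^ N) := by ring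
    _ ≤ C₂ * (E * Real.exp (-((k - -(2 * α₀ * √n)) ^ 2 / 2))) := by
      rw [hid]
      refine mul_le_mul_of_nonneg_left ?_ (Real.exp_pos _).le
      rw [hE, ← Real.exp_add]
      refine Real.exp_le_exp.mpr ?_
      have h4 := hα₀ α
      have h5 : ((k : ℝ) - -(2 * α₀ * √n)) ^ 2 / 2 = N * (α - α₀) ^ 2 := by
        rw [hα, hNr, show -(2 * α * √n) - -(2 * α₀ * √n) = (-2 * (α - α₀)) * √n by ring, mul_pow, hsn2]
        ring
      rw [h5]
      nlinarith
    _ = _ := by ring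

theorem friendlyCount_le : ∃ C, 0 < C ∧ ∀ n : ℕ, 8 ≤ n → ∀ (γ : ℝ) (z : ℤ), |γ| ≤ 1 → γ * √n = z →
    ∀ α₀, (∀ α, F1 γ α ≤ F1 γ α₀ - (α - α₀) ^ 2) →
    (friendlyCount (2 * n) (2 * z + 1) : ℝ) / 2 ^ (2 * n).choose 2
      ≤ C * Real.exp (2 * n * (F1 γ α₀ - Real.log 2)) := by
  classical
  set A := -Real.log (gaussTail √2) with hA
  have hA0 : 0 ≤ A := neg_nonneg.mpr (Real.log_nonpos (gaussTail_pos _).le (gaussTail_le_one _))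
  set K := 8 * (1 + A) with hK
  have hK0 : 0 ≤ K := by positivity
  obtain ⟨C, hC, H⟩ := card_friendly_le_sum (K := K)
  set τ := gaussTail ((1 + (K + 2)) * √2) with hτ
  have hτ0 : 0 < τ := gaussTail_pos _
  set C₁ := Real.exp (1 / 8) * (√(8 * Real.pi) / 2) with hC₁
  have hC₁0 : 0 < C₁ := by positivity
  set C₂ := Real.exp (1 / 2 + 2048 / τ) with hC₂
  refine ⟨1 + C * (C₂ * C₁), by positivity, fun n hn γ z hγ hz α₀ hα₀ => ?_⟩
  have hn0 : (0 : ℝ) < n := by exact_mod_cast (by omega : 0 < n)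
  have hn1 : (1 : ℝ) ≤ n := by exact_mod_cast (by omega : 1 ≤ n)
  have hsn : 0 < √(n : ℝ) := Real.sqrt_pos.mpr hn0
  have hsn2 : √(n : ℝ) ^ 2 = n := Real.sq_sqrt hn0.le
  have hzn : -(n : ℤ) ≤ z := by
    have : -(n : ℝ) ≤ z := by
      rw [← hz]
      have h1 := (abs_le.mp hγ).1
      nlinarith [Real.one_le_sqrt.mpr hn1]
    exact_mod_cast this
  obtain ⟨F, hF, hle⟩ := H hn z hzn
  set N := 2 * n with hN
  have hNr : (N : ℝ) = 2 * n := by rw [hN]; push_cast; ring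
  have hN0 : (0 : ℝ) < N := by rw [hNr]; positivity
  rw [← hNr]
  set E := Real.exp (N * (F1 γ α₀ - Real.log 2)) with hE
  set good := Finset.univ.filter fun x : Edge N → Bool => (∀ v, 2 * z + 1 ≤ signSum x v) ∧
      ∑ j, (signSum x j : ℝ) ^ 2 ≤ K * N ^ 2 with hgood
  set bad := Finset.univ.filter fun x : Edge N → Bool => K * N ^ 2 < ∑ j, (signSum x j : ℝ) ^ 2 with hbad
  have hsplit : (friendlyCount N (2 * z + 1) : ℝ) ≤ bad.card + good.card := by
    have : friendlyCount N (2 * z + 1) ≤ bad.card + good.card := by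
      refine le_trans (Finset.card_le_card fun x hx => ?_) (Finset.card_union_le bad good)
      have hx1 := (Finset.mem_filter.mp hx).2
      rw [Finset.mem_union, hbad, hgood, Finset.mem_filter, Finset.mem_filter]
      rcases lt_or_ge (K * N ^ 2) (∑ j, (signSum x j : ℝ) ^ 2) with h | h
      · exact Or.inl ⟨Finset.mem_univ _, h⟩
      · exact Or.inr ⟨Finset.mem_univ _, hx1, h⟩
    exact_mod_cast this
  have hbadle : (bad.card : ℝ) / 2 ^ N.choose 2 ≤ E := by
    refine (card_signSum_sq_ge_le (by omega) K).trans (Real.exp_le_exp.mpr ?_)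
    refine mul_le_mul_of_nonneg_left ?_ hN0.le
    have h1 := hα₀ 0
    have h2 : Real.log (gaussTail √2) ≤ Real.log (gaussTail ((γ + 0) * √2)) := by
      refine Real.log_le_log (gaussTail_pos _) (gaussTail_antitone ?_)
      have := (abs_le.mp hγ).2
      nlinarith [Real.sqrt_nonneg 2]
    have h3 : F1 γ 0 = Real.log 2 + Real.log (gaussTail ((γ + 0) * √2)) := by
      rw [F1]; ring
    nlinarith [sq_nonneg (0 - α₀)]
  have hterm : ∀ k ∈ F, _ := fun k hk => exp_mul_sum_pow_le hK0 (by omega : 8 ≤ n) hγ hz hα₀ (hF k hk)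
  have hgoodle : (good.card : ℝ) / 2 ^ N.choose 2 ≤ C * (C₂ * C₁) * E := by
    calc _ ≤ _ := hle
      _ ≤ C * ∑ k ∈ F, C₂ * E * Real.exp (-((k - -(2 * α₀ * √n)) ^ 2 / 2)) :=
        mul_le_mul_of_nonneg_left (Finset.sum_le_sum hterm) hC.le
      _ = C * (C₂ * E * ∑ k ∈ F, Real.exp (-((k - -(2 * α₀ * √n)) ^ 2 / 2))) := by
        rw [← Finset.mul_sum]
      _ ≤ C * (C₂ * E * C₁) := by
        gcongr
        exact sum_int_exp_neg_sq_le F _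
      _ = _ := by ring
  calc _ ≤ ((bad.card : ℝ) + good.card) / 2 ^ N.choose 2 := by gcongr
    _ = (bad.card : ℝ) / 2 ^ N.choose 2 + good.card / 2 ^ N.choose 2 := add_div _ _ _
    _ ≤ E + C * (C₂ * C₁) * E := add_le_add hbadle hgoodle
    _ = _ := by ring

open Classical in
/-- The sign pattern recording, for each edge, whether the graph `G` and the partition into `S` and its
complement agree on it. -/
noncomputable def agreement {N : ℕ} (S : Finset (Fin N)) (G : SimpleGraph (Fin N)) : Edge N → Bool :=
  fun e => decide (G.Adj e.1.1 e.1.2 ↔ (e.1.1 ∈ S ↔ e.1.2 ∈ S))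

theorem agreement_compl {N : ℕ} (S : Finset (Fin N)) (G : SimpleGraph (Fin N)) :
    agreement Sᶜ G = agreement S G := by
  funext e
  simp [agreement, not_iff_not]

theorem agreement_bijective {N : ℕ} (S : Finset (Fin N)) : Function.Bijective (agreement S) := by
  classical
  constructor
  · intro G G' h
    have key : ∀ j k, j < k → (G.Adj j k ↔ G'.Adj j k) := fun j k hjk => by
      have := congrFun h ⟨(j, k), hjk⟩
      simp only [agreement, decide_eq_decide] at this
      tauto
    ext j k
    rcases lt_trichotomy j k with hjk | rfl | hjk
    · exact key j k hjk
    · simp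
    · rw [G.adj_comm, G'.adj_comm]
      exact key k j hjk
  · intro x
    refine ⟨SimpleGraph.fromRel fun j k => ∃ h : j < k, x ⟨(j, k), h⟩ = decide (j ∈ S ↔ k ∈ S), ?_⟩
    funext e
    obtain ⟨⟨j, k⟩, hjk⟩ := e
    have h1 : ¬ k < j := hjk.not_gt
    have h2 : j < k := hjk
    simp only [agreement, SimpleGraph.fromRel_adj, h1, h2, h2.ne, IsEmpty.exists_iff, or_false,
      exists_true_left, ne_eq, not_false_eq_true, true_and]
    cases x ⟨(j, k), hjk⟩ <;> by_cases h3 : (j ∈ S ↔ k ∈ S) <;> simp [h3]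

theorem degIn_eq_sum {n : ℕ} (G : SimpleGraph (Fin n)) [DecidableRel G.Adj] (v : Fin n) (S : Finset (Fin n)) :
    (degIn G v S : ℝ) = ∑ k, if k ∈ S ∧ G.Adj v k then 1 else 0 := by
  rw [degIn, Nat.card_eq_fintype_card, Fintype.card_subtype, Finset.sum_boole]

theorem signSum_agreement {N : ℕ} {S : Finset (Fin N)} (G : SimpleGraph (Fin N)) {v : Fin N} (hv : v ∈ S) :
    (signSum (agreement S G) v : ℝ)
      = 2 * (degIn G v S - degIn G v Sᶜ) + ((Sᶜ.card : ℝ) - S.card) + 1 := by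
  classical
  set σ : Fin N → Fin N → ℝ := fun j k => if (G.Adj j k ↔ (j ∈ S ↔ k ∈ S)) then 1 else -1 with hσ
  have hsymm : ∀ j k, σ j k = σ k j := fun j k => by
    simp only [hσ, G.adj_comm j k, iff_comm (a := j ∈ S)]
  have h1 : (signSum (agreement S G) v : ℝ)
      = ∑ e : Edge N, σ e.1.1 e.1.2 * ((if e.1.1 = v then 1 else 0) + (if e.1.2 = v then 1 else 0)) := by
    rw [signSum]
    push_cast [inc]
    refine Finset.sum_congr rfl fun e _ => ?_
    congr 1
    simp only [sgn, agreement, hσ, decide_eq_true_eq]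
    split_ifs <;> simp
  have h2 : ∀ k, σ v k = 2 * (if k ∈ S ∧ G.Adj v k then 1 else 0) - (if k ∈ S then 1 else 0)
      - 2 * (if k ∈ Sᶜ ∧ G.Adj v k then 1 else 0) + (if k ∈ Sᶜ then 1 else 0) := fun k => by
    by_cases h3 : k ∈ S <;> by_cases h4 : G.Adj v k <;> norm_num [hσ, hv, h3, h4]
  rw [h1, sum_edge_symm (fun j k => σ j k * ((if j = v then 1 else 0) + (if k = v then 1 else 0)))
    (fun j k => by simp only [hsymm j k]; ring)]
  have h5 : ∑ k, σ k v = ∑ k, σ v k := Finset.sum_congr rfl fun k _ => hsymm k v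
  have h6 : σ v v = -1 := by simp [hσ]
  have h7 : ∑ k, σ v k = 2 * (degIn G v S : ℝ) - S.card - 2 * degIn G v Sᶜ + Sᶜ.card := by
    have hT : ∀ T : Finset (Fin N), ∑ k, (if k ∈ T then (1 : ℝ) else 0) = T.card := fun T => by simp
    simp only [h2, Finset.sum_add_distrib, Finset.sum_sub_distrib, ← Finset.mul_sum, degIn_eq_sum, hT]
  simp only [mul_add, Finset.sum_add_distrib, mul_ite, mul_one, mul_zero, Finset.sum_ite_eq',
    Finset.mem_univ, if_true, h5, h6]
  have h8 : ∑ j, ∑ k, (if j = v then σ j k else 0) = ∑ k, σ v k := by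
    rw [Finset.sum_comm]
    simp
  rw [h8, h7]
  ring

theorem EXgamma_eq {n : ℕ} {γ : ℝ} {z : ℤ} (hz : γ * √n = z) :
    EXgamma n γ = (2 * n).choose n * ((friendlyCount (2 * n) (2 * z + 1) : ℝ) / 2 ^ (2 * n).choose 2) := by
  classical
  set Q : Finset (Fin (2 * n)) → SimpleGraph (Fin (2 * n)) → Prop := fun A G =>
    (∀ v ∈ A, (degIn G v Aᶜ : ℝ) + γ * √n ≤ (degIn G v A : ℝ)) ∧
    (∀ v ∈ (Aᶜ : Finset (Fin (2 * n))), (degIn G v A : ℝ) + γ * √n ≤ (degIn G v Aᶜ : ℝ)) with hQ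
  have hiff : ∀ A : Finset (Fin (2 * n)), A.card = n → ∀ G,
      (Q A G ↔ ∀ v, 2 * z + 1 ≤ signSum (agreement A G) v) := fun A hA G => by
    have hAc : Aᶜ.card = n := by rw [Finset.card_compl, hA, Fintype.card_fin]; omega
    have i1 : ∀ v, (2 * z + 1 ≤ signSum (agreement A G) v ↔
        2 * (z : ℝ) + 1 ≤ (signSum (agreement A G) v : ℝ)) := fun v => by
      rw [← Int.cast_le (R := ℝ)]; push_cast; rfl
    have i2 : ∀ v ∈ A, ((degIn G v Aᶜ : ℝ) + γ * √n ≤ (degIn G v A : ℝ) ↔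
        2 * z + 1 ≤ signSum (agreement A G) v) := fun v hv => by
      rw [i1, signSum_agreement G hv, hA, hAc, hz]
      constructor <;> intro h <;> linarith
    have i3 : ∀ v ∈ Aᶜ, ((degIn G v A : ℝ) + γ * √n ≤ (degIn G v Aᶜ : ℝ) ↔
        2 * z + 1 ≤ signSum (agreement A G) v) := fun v hv => by
      rw [i1, ← agreement_compl, signSum_agreement G hv, compl_compl, hA, hAc, hz]
      constructor <;> intro h <;> linarith
    constructor
    · rintro ⟨h1, h2⟩ v
      by_cases hv : v ∈ A
      · exact (i2 v hv).mp (h1 v hv)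
      · exact (i3 v (Finset.mem_compl.mpr hv)).mp (h2 v (Finset.mem_compl.mpr hv))
    · intro h
      exact ⟨fun v hv => (i2 v hv).mpr (h v), fun v hv => (i3 v hv).mpr (h v)⟩
  have hcard : ∀ A ∈ Finset.powersetCard n (Finset.univ : Finset (Fin (2 * n))),
      (Finset.univ.filter (Q A)).card = friendlyCount (2 * n) (2 * z + 1) := fun A hA => by
    refine Finset.card_bijective (agreement A) (agreement_bijective A) fun G => ?_
    rw [Finset.mem_filter, Finset.mem_filter, hiff A (Finset.mem_powersetCard.mp hA).2 G]
    simp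
  have hX : ∀ G, Xgamma n γ G
      = ∑ A ∈ Finset.powersetCard n (Finset.univ : Finset (Fin (2 * n))), if Q A G then 1 else 0 := fun G => by
    rw [Xgamma, Nat.card_eq_fintype_card, Fintype.card_subtype, ← Finset.card_filter]
    congr 1
    ext A
    simp [Finset.mem_powersetCard, hQ]
  have htot : ∑ G, Xgamma n γ G = (2 * n).choose n * friendlyCount (2 * n) (2 * z + 1) := by
    simp only [hX]
    rw [Finset.sum_comm]
    rw [Finset.sum_congr rfl fun A hA => (Finset.card_filter _ _).symm.trans (hcard A hA), Finset.sum_const, Finset.card_powersetCard, Finset.card_univ,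
      Fintype.card_fin, smul_eq_mul]
  rw [EXgamma, ← Nat.cast_sum]
  have htot' : ((∑ G, Xgamma n γ G : ℕ) : ℝ) = (2 * n).choose n * friendlyCount (2 * n) (2 * z + 1) := by
    exact_mod_cast htot
  rw [← mul_div_assoc, ← htot']

/-- first moment. There are absolute constants `c, C > 0` and `n₀` with:
for all `n ≥ n₀` and `γ ∈ [−1,1]` with `γ√n ∈ ℤ`,
`c · 4⁻ⁿ · C(2n,n) · exp(2n supₐ F₁(α)) ≤ E[X_γ] ≤ C · 4⁻ⁿ · C(2n,n) · exp(2n supₐ F₁(α))`. -/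
theorem first_moment_friendly_bisections :
    ∃ c C : ℝ, 0 < c ∧ 0 < C ∧ ∃ n₀ : ℕ, ∀ n : ℕ, n₀ ≤ n →
      ∀ γ : ℝ, |γ| ≤ 1 → (∃ z : ℤ, γ * Real.sqrt n = (z : ℝ)) →
        c * (((2 * n).choose n : ℝ) / 4 ^ n * Real.exp (2 * n * ⨆ α : ℝ, F1 γ α))
            ≤ EXgamma n γ ∧
        EXgamma n γ
            ≤ C * (((2 * n).choose n : ℝ) / 4 ^ n * Real.exp (2 * n * ⨆ α : ℝ, F1 γ α)) := by
  set A := -Real.log (gaussTail √2) with hA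
  have hA0 : 0 ≤ A := neg_nonneg.mpr (Real.log_nonpos (gaussTail_pos _).le (gaussTail_le_one _))
  obtain ⟨c, hc, n₁, hlow⟩ := friendlyCount_ge (W := 4 * A) (τ := gaussTail ((1 + √A) * √2)) (by positivity)
    (gaussTail_pos _)
  obtain ⟨C, hC, hup⟩ := friendlyCount_le
  refine ⟨c, C, hc, hC, n₁ + 8, fun n hn γ hγ ⟨z, hz⟩ => ?_⟩
  obtain ⟨α₀, h1, h2, h3⟩ := exists_F1_maximizer hγ
  have hn0 : (0 : ℝ) < n := by exact_mod_cast (by omega : 0 < n)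
  have hexp : Real.exp (2 * n * (F1 γ α₀ - Real.log 2)) = Real.exp (2 * n * F1 γ α₀) / 4 ^ n := by
    rw [mul_sub, Real.exp_sub]
    congr 1
    rw [show (2 : ℝ) * n * Real.log 2 = ((2 * n : ℕ) : ℝ) * Real.log 2 by push_cast; ring, Real.exp_nat_mul,
      Real.exp_log (by norm_num), pow_mul]
    norm_num
  rw [EXgamma_eq hz, h2]
  have hlow' := hlow n (by omega) z (-(2 * α₀ * √n)) (by
    rw [neg_sq, mul_pow, Real.sq_sqrt hn0.le]
    nlinarith) (gaussTail_antitone (by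
      have hα : α₀ ≤ √A := Real.le_sqrt_of_sq_le h1
      have h4 : √(2 : ℝ) * √2 = 2 := Real.mul_self_sqrt (by norm_num)
      rw [← hz, Real.sqrt_mul (by norm_num), div_le_iff₀ (by positivity)]
      calc _ = (γ + α₀) * (2 * √n) := by ring
        _ ≤ (1 + √A) * (2 * √n) := by
          gcongr
          exact (abs_le.mp hγ).2
        _ = _ := by linear_combination (-(1 + √A) * √n) * h4))
  rw [exp_mul_gaussTail_pow (by omega) hz α₀, hexp] at hlow'
  have hup' := hup n (by omega) γ z hγ hz α₀ h3
  rw [hexp] at hup'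
  constructor
  · calc _ = ((2 * n).choose n : ℝ) * (c * (Real.exp (2 * n * F1 γ α₀) / 4 ^ n)) := by ring
      _ ≤ _ := by gcongr
  · calc _ ≤ ((2 * n).choose n : ℝ) * (C * (Real.exp (2 * n * F1 γ α₀) / 4 ^ n)) := by gcongr
      _ = _ := by ring
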